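/- arXiv:2511.11271 — 3 statements merged into one kernel-verified Lean document; each statement's English description precedes it below -/
import Mathlib

section
/- Every nondegenerate Peano continuum contains a point x satisfying one of the following: (1) x is not a local cut point of X, or (2) x is a local cut point of X that is not a cut point of X and has Menger order equal to 2. -/
open Set Topology

/-- `x` is a cut point of `X` if `X \ {x}` is disconnected. -/
def IsCutPoint {X : Type*} [TopologicalSpace X] (x : X) : Prop :=
  ¬ IsPreconnected ({x}ᶜ : Set X)

/-- `x` is a local cut point of `X` if some connected open neighborhood `U` of `x`
has `U \ {x}` disconnected. -/
def IsLocalCutPoint {X : Type*} [TopologicalSpace X] (x : X) : Prop :=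
  ∃ U : Set X, IsOpen U ∧ x ∈ U ∧ IsConnected U ∧ ¬ IsPreconnected (U \ {x})

/-- `x` has Menger order at most `n`: it has a neighborhood basis of sets whose
boundaries have at most `n` points. -/
def MengerOrderLE {X : Type*} [TopologicalSpace X] (x : X) (n : ℕ) : Prop :=
  ∀ U ∈ 𝓝 x, ∃ V ∈ 𝓝 x, V ⊆ U ∧ (frontier V).Finite ∧ (frontier V).ncard ≤ n

namespace PeanoAux

variable {X : Type*} [MetricSpace X]

lemma comp_closure (F : Set X) (a : X) (z : X)
    (hz : z ∈ closure (connectedComponentIn F a)) (hzF : z ∈ F) :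
    z ∈ connectedComponentIn F a := by
  by_cases ha : a ∈ F
  · have h1 : IsPreconnected (closure (connectedComponentIn F a) ∩ F) :=
      isPreconnected_connectedComponentIn.subset_closure
        (fun w hw => ⟨subset_closure hw, connectedComponentIn_subset _ _ hw⟩) inter_subset_left
    exact h1.subset_connectedComponentIn ⟨subset_closure (mem_connectedComponentIn ha), ha⟩
      inter_subset_right ⟨hz, hzF⟩
  · rw [connectedComponentIn_eq_empty ha] at hz
    simp at hz

/-- The basic separation: a cut point of a connected open set. -/
lemma sep {U : Set X} {x : X} (hU : IsOpen U) (hc : IsPreconnected U) (hx : x ∈ U)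
    (h : ¬ IsPreconnected (U \ {x})) :
    ∃ A B : Set X, IsOpen A ∧ IsOpen B ∧ A.Nonempty ∧ B.Nonempty ∧ Disjoint A B ∧
      A ∪ B = U \ {x} ∧ x ∈ closure A ∧ x ∈ closure B := by
  have hUx : IsOpen (U \ {x}) := hU.sdiff isClosed_singleton
  have key : ∀ A B : Set X, IsOpen A → IsOpen B → A.Nonempty → Disjoint A B →
      A ∪ B = U \ {x} → x ∈ closure A := by
    intro A B hA hB hAn hd hAB
    by_contra hcl
    have h1 := hc A (B ∪ (closure A)ᶜ) hA (hB.union isClosed_closure.isOpen_compl)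
      (by
        intro z hz
        by_cases hzx : z = x
        · subst hzx; right; right; exact hcl
        · have : z ∈ A ∪ B := by rw [hAB]; exact ⟨hz, hzx⟩
          rcases this with h | h
          · left; exact h
          · right; left; exact h)
      (by
        obtain ⟨a, ha⟩ := hAn
        have : a ∈ U \ {x} := by rw [← hAB]; left; exact ha
        exact ⟨a, this.1, ha⟩)
      ⟨x, hx, Or.inr hcl⟩
    obtain ⟨z, _, hzA, hzB | hzB⟩ := h1
    · exact Set.disjoint_left.1 hd hzA hzB
    · exact hzB (subset_closure hzA)
  unfold IsPreconnected at h
  push Not at h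
  obtain ⟨u, v, hu, hv, huv, hnu, hnv, hd⟩ := h
  have hA := hUx.inter hu
  have hB := hUx.inter hv
  have hdis : Disjoint ((U \ {x}) ∩ u) ((U \ {x}) ∩ v) := by
    rw [Set.disjoint_left]
    intro z hz hz'
    have : z ∈ (U \ {x}) ∩ (u ∩ v) := ⟨hz.1, hz.2, hz'.2⟩
    rw [hd] at this
    exact this
  have hun : ((U \ {x}) ∩ u) ∪ ((U \ {x}) ∩ v) = U \ {x} := by
    rw [← inter_union_distrib_left]
    exact inter_eq_left.2 huv
  refine ⟨_, _, hA, hB, hnu, hnv, hdis, hun, key _ _ hA hB hnu hdis hun, ?_⟩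
  exact key _ _ hB hA hnv hdis.symm (by rw [union_comm]; exact hun)

lemma ep_aux {U A B O : Set X} {x : X} (hc : IsPreconnected U) (hx : x ∈ U)
    (hA : IsOpen A) (hB : IsOpen B) (hd : Disjoint A B) (hAB : A ∪ B = U \ {x})
    (hO : IsOpen O) (hxO : x ∈ O) (hf : ∀ z ∈ B, z ∉ frontier O) : B ⊆ O := by
  intro b hb
  by_contra hbO
  have hf' : ∀ z ∈ B, z ∉ O → z ∉ closure O := by
    intro z hz hzO hzc
    exact hf z hz (by rw [hO.frontier_eq]; exact ⟨hzc, hzO⟩)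
  have hbU : b ∈ U \ {x} := by rw [← hAB]; right; exact hb
  obtain ⟨z, _, hz1, hz2⟩ := hc (A ∪ O) (B ∩ (closure O)ᶜ) (hA.union hO)
    (hB.inter isClosed_closure.isOpen_compl)
    (by
      intro z hz
      by_cases hzx : z = x
      · subst hzx; left; right; exact hxO
      · have : z ∈ A ∪ B := by rw [hAB]; exact ⟨hz, hzx⟩
        rcases this with h | h
        · left; left; exact h
        · by_cases hzO : z ∈ O
          · left; right; exact hzO
          · right; exact ⟨h, hf' z h hzO⟩)
    ⟨x, hx, Or.inr hxO⟩ ⟨b, hbU.1, hb, hf' b hb hbO⟩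
  rcases hz1 with h | h
  · exact Set.disjoint_left.1 hd h hz2.1
  · exact hz2.2 (subset_closure h)

lemma ep {U A B O : Set X} {x : X} (hc : IsPreconnected U) (hx : x ∈ U)
    (hA : IsOpen A) (hB : IsOpen B) (hd : Disjoint A B) (hAB : A ∪ B = U \ {x})
    (hO : IsOpen O) (hxO : x ∈ O) (hf : (frontier O).Subsingleton) : A ⊆ O ∨ B ⊆ O := by
  by_cases h : ∃ q ∈ A, q ∈ frontier O
  · obtain ⟨q, hqA, hq⟩ := h
    right
    refine ep_aux hc hx hA hB hd hAB hO hxO ?_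
    intro z hz hzf
    have := hf hq hzf
    subst this
    exact Set.disjoint_left.1 hd hqA hz
  · push Not at h
    left
    exact ep_aux hc hx hB hA hd.symm (by rw [union_comm]; exact hAB) hO hxO h

lemma not_order_one {x : X} (hx : IsLocalCutPoint x) : ¬ MengerOrderLE x 1 := by
  intro hm
  obtain ⟨U, hU, hxU, hc, hn⟩ := hx
  obtain ⟨A, B, hA, hB, ⟨a, ha⟩, ⟨b, hb⟩, hd, hAB, -, -⟩ := sep hU hc.isPreconnected hxU hn
  have hax : a ∈ U \ {x} := by rw [← hAB]; left; exact ha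
  have hbx : b ∈ U \ {x} := by rw [← hAB]; right; exact hb
  have hN : ({a, b} : Set X)ᶜ ∈ 𝓝 x := by
    apply (Set.Finite.isClosed (by simp)).isOpen_compl.mem_nhds
    intro h
    rcases h with h | h
    · exact hax.2 h.symm
    · exact hbx.2 h.symm
  obtain ⟨V, hV, hVs, hfin, hcard⟩ := hm _ hN
  have hsub : (frontier V).Subsingleton := by
    intro p hp q hq
    exact (Set.ncard_le_one hfin).1 hcard p hp q hq
  have hsub' : (frontier (interior V)).Subsingleton := hsub.anti frontier_interior_subset
  rcases ep hc.isPreconnected hxU hA hB hd hAB isOpen_interior (mem_interior_iff_mem_nhds.2 hV)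
    hsub' with h | h
  · exact hVs (interior_subset (h ha)) (by simp)
  · exact hVs (interior_subset (h hb)) (by simp)

/-- Nonempty connected open sets with at most one boundary point. -/
def G (X : Type*) [MetricSpace X] : Set (Set X) :=
  {P | IsOpen P ∧ P.Nonempty ∧ IsPreconnected P ∧ (frontier P).Subsingleton}

lemma G_closure {P Q : Set X} (hP : P ∈ G X) (hQ : Q ∈ G X) (hQP : Q ⊆ P) (hne : ¬ P ⊆ Q) :
    closure Q ⊆ P := by
  intro q hq
  by_contra hqP
  have hqf : q ∈ frontier Q := by
    rw [hQ.1.frontier_eq]; exact ⟨hq, fun h => hqP (hQP h)⟩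
  have hstep : ∀ z ∈ P, z ∉ Q → z ∉ closure Q := by
    intro z hz hzQ hzc
    have : z ∈ frontier Q := by rw [hQ.1.frontier_eq]; exact ⟨hzc, hzQ⟩
    have := hQ.2.2.2 this hqf
    subst this
    exact hqP hz
  obtain ⟨p, hp, hpQ⟩ := Set.not_subset.1 hne
  obtain ⟨r, hr⟩ := hQ.2.1
  obtain ⟨z, _, hz1, hz2⟩ := hP.2.2.1 Q (closure Q)ᶜ hQ.1 isClosed_closure.isOpen_compl
    (by
      intro z hz
      by_cases h : z ∈ Q
      · left; exact h
      · right; exact hstep z hz h)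
    ⟨r, hQP hr, hr⟩ ⟨p, hp, hstep p hp hpQ⟩
  exact hz2 (subset_closure hz1)

lemma frontier_comp [LocallyConnectedSpace X] {F : Set X} (hF : IsOpen F) {a z : X}
    (hz : z ∈ frontier (connectedComponentIn F a)) : z ∈ closure F ∧ z ∉ F := by
  have ho : IsOpen (connectedComponentIn F a) := hF.connectedComponentIn
  rw [ho.frontier_eq] at hz
  exact ⟨closure_mono (connectedComponentIn_subset _ _) hz.1,
    fun h => hz.2 (comp_closure F a z hz.1 h)⟩

lemma conn_nhd [LocallyConnectedSpace X] {O : Set X} (hO : IsOpen O) {x : X} (hx : x ∈ O) :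
    ∃ N, IsOpen N ∧ x ∈ N ∧ IsPreconnected N ∧ N ⊆ O :=
  ⟨connectedComponentIn O x, hO.connectedComponentIn, mem_connectedComponentIn hx,
    isPreconnected_connectedComponentIn, connectedComponentIn_subset _ _⟩

lemma meets_frontier {N P : Set X} (hN : IsPreconnected N) {z : X} (hz : z ∈ N) (hzP : z ∈ P)
    (hne : ¬ N ⊆ P) (hP : IsOpen P) : ∃ q ∈ N, q ∈ frontier P := by
  by_contra hcon
  push Not at hcon
  obtain ⟨p, hp, hpP⟩ := Set.not_subset.1 hne
  have hstep : ∀ w ∈ N, w ∉ P → w ∉ closure P := by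
    intro w hw hwP hwc
    exact hcon w hw (by rw [hP.frontier_eq]; exact ⟨hwc, hwP⟩)
  obtain ⟨w, _, h1, h2⟩ := hN P (closure P)ᶜ hP isClosed_closure.isOpen_compl
    (by
      intro w hw
      by_cases h : w ∈ P
      · left; exact h
      · right; exact hstep w hw h)
    ⟨z, hz, hzP⟩ ⟨p, hp, hstep p hp hpP⟩
  exact h2 (subset_closure h1)

lemma chain_bound [CompactSpace X] [LocallyConnectedSpace X]
    (hloc : ∀ x : X, IsLocalCutPoint x) (c : Set (Set X)) (hcG : c ⊆ G X)
    (hch : IsChain (· ⊆ ·) c) (hcn : c.Nonempty) : ∃ lb ∈ G X, ∀ s ∈ c, lb ⊆ s := by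
  by_cases hmin : ∃ m ∈ c, ∀ P ∈ c, m ⊆ P
  · obtain ⟨m, hm, h⟩ := hmin
    exact ⟨m, hcG hm, h⟩
  push Not at hmin
  have hstep : ∀ P ∈ c, ∃ Q ∈ c, closure Q ⊆ P := by
    intro P hP
    obtain ⟨Q, hQ, hPQ⟩ := hmin P hP
    refine ⟨Q, hQ, ?_⟩
    rcases hch.total hP hQ with h | h
    · exact absurd h hPQ
    · exact G_closure (hcG hP) (hcG hQ) h hPQ
  have hKeq : ⋂₀ c = ⋂ P : c, closure (P : Set X) := by
    apply Subset.antisymm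
    · intro z hz
      rw [mem_iInter]
      intro P
      exact subset_closure (hz P P.2)
    · intro z hz P hP
      rw [mem_iInter] at hz
      obtain ⟨Q, hQ, h⟩ := hstep P hP
      exact h (hz ⟨Q, hQ⟩)
  have hKc : IsClosed (⋂₀ c) := by
    rw [hKeq]; exact isClosed_iInter fun P => isClosed_closure
  have hKn : (⋂₀ c).Nonempty := by
    rw [hKeq]
    have : Nonempty c := hcn.to_subtype
    apply IsCompact.nonempty_iInter_of_directed_nonempty_isCompact_isClosed
    · intro P Q
      rcases hch.total P.2 Q.2 with h | h
      · exact ⟨P, Subset.rfl, closure_mono h⟩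
      · exact ⟨Q, closure_mono h, Subset.rfl⟩
    · intro P
      exact (hcG P.2).2.1.closure
    · intro P
      exact isClosed_closure.isCompact
    · intro P
      exact isClosed_closure
  have hfr : (frontier (⋂₀ c)).Subsingleton := by
    intro z hz w hw
    by_contra hzw
    obtain ⟨u, v, hu, hv, hzu, hwv, hd⟩ := t2_separation hzw
    have aux : ∀ (z : X) (u : Set X), IsOpen u → z ∈ u → z ∈ frontier (⋂₀ c) →
        ∃ P ∈ c, ∀ Q ∈ c, Q ⊆ P → ∃ q ∈ u, q ∈ frontier Q := by
      intro z u hu hzu hz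
      obtain ⟨N, hN, hzN, hNc, hNu⟩ := conn_nhd hu hzu
      have hzK : z ∈ ⋂₀ c := hKc.frontier_subset hz
      have hNK : ¬ N ⊆ ⋂₀ c := by
        intro h
        exact hz.2 (mem_interior.2 ⟨N, h, hN, hzN⟩)
      rw [subset_sInter_iff] at hNK
      push Not at hNK
      obtain ⟨P, hP, hNP⟩ := hNK
      refine ⟨P, hP, fun Q hQ hQP => ?_⟩
      obtain ⟨q, hq, hqf⟩ := meets_frontier hNc hzN (hzK Q hQ) (fun h => hNP (h.trans hQP))
        (hcG hQ).1
      exact ⟨q, hNu hq, hqf⟩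
    obtain ⟨P, hP, hP'⟩ := aux z u hu hzu hz
    obtain ⟨Q, hQ, hQ'⟩ := aux w v hv hwv hw
    have : ∃ R ∈ c, R ⊆ P ∧ R ⊆ Q := by
      rcases hch.total hP hQ with h | h
      · exact ⟨P, hP, Subset.rfl, h⟩
      · exact ⟨Q, hQ, h, Subset.rfl⟩
    obtain ⟨R, hR, hRP, hRQ⟩ := this
    obtain ⟨q, hq, hqf⟩ := hP' R hR hRP
    obtain ⟨r, hr, hrf⟩ := hQ' R hR hRQ
    have := (hcG hR).2.2.2 hqf hrf
    subst this
    exact Set.disjoint_left.1 hd hq hr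
  rcases (⋂₀ c).subsingleton_or_nontrivial with hs | hnt
  · exfalso
    obtain ⟨z, hz⟩ := hKn
    obtain ⟨U, hU, hxU, hc, hn⟩ := hloc z
    obtain ⟨A, B, hA, hB, ⟨a, ha⟩, ⟨b, hb⟩, hd, hAB, -, -⟩ := sep hU hc.isPreconnected hxU hn
    have hax : a ∈ U \ {z} := by rw [← hAB]; left; exact ha
    have hbx : b ∈ U \ {z} := by rw [← hAB]; right; exact hb
    have h1 : ∀ P ∈ c, A ⊆ P ∨ B ⊆ P := fun P hP =>
      ep hc.isPreconnected hxU hA hB hd hAB (hcG hP).1 (hz P hP) (hcG hP).2.2.2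
    have haK : a ∉ ⋂₀ c := fun h => hax.2 (hs h hz)
    have hbK : b ∉ ⋂₀ c := fun h => hbx.2 (hs h hz)
    rw [mem_sInter] at haK hbK
    push Not at haK hbK
    obtain ⟨P, hP, haP⟩ := haK
    obtain ⟨Q, hQ, hbQ⟩ := hbK
    rcases hch.total hP hQ with h | h
    · rcases h1 P hP with h' | h'
      · exact haP (h' ha)
      · exact hbQ (h (h' hb))
    · rcases h1 Q hQ with h' | h'
      · exact haP (h (h' ha))
      · exact hbQ (h' hb)
  · have hint : (interior (⋂₀ c)).Nonempty := by
      obtain ⟨u, hu, v, hv, huv⟩ := hnt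
      by_contra hemp
      rw [Set.not_nonempty_iff_eq_empty] at hemp
      have hf : frontier (⋂₀ c) = ⋂₀ c := by rw [hKc.frontier_eq, hemp, sdiff_empty]
      rw [hf] at hfr
      exact huv (hfr hu hv)
    obtain ⟨k, hk⟩ := hint
    refine ⟨connectedComponentIn (interior (⋂₀ c)) k,
      ⟨isOpen_interior.connectedComponentIn, ⟨k, mem_connectedComponentIn hk⟩,
        isPreconnected_connectedComponentIn, ?_⟩, ?_⟩
    · refine hfr.anti fun z hz => ?_
      obtain ⟨h1, h2⟩ := frontier_comp isOpen_interior hz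
      exact ⟨closure_mono interior_subset h1, h2⟩
    · intro s hs
      exact (connectedComponentIn_subset _ _).trans (interior_subset.trans (sInter_subset_of_mem hs))

lemma exists_open_noncut [CompactSpace X] [LocallyConnectedSpace X] [ConnectedSpace X]
    (hloc : ∀ x : X, IsLocalCutPoint x) :
    ∃ O : Set X, IsOpen O ∧ O.Nonempty ∧ ∀ x ∈ O, ¬ IsCutPoint x := by
  have huniv : (univ : Set X) ∈ G X :=
    ⟨isOpen_univ, univ_nonempty, isPreconnected_univ, by simp⟩
  obtain ⟨P, -, hPm⟩ := zorn_superset_nonempty (G X)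
    (fun c hc hch hn => chain_bound hloc c hc hch hn) univ huniv
  have hP : P ∈ G X := hPm.prop
  refine ⟨P, hP.1, hP.2.1, fun x hx hcut => ?_⟩
  have hcut' : ¬ IsPreconnected ((univ : Set X) \ {x}) := by
    rw [← compl_eq_univ_sdiff]; exact hcut
  obtain ⟨A, B, hA, hB, hAn, hBn, hd, hAB, hxA, hxB⟩ :=
    sep isOpen_univ isPreconnected_univ (mem_univ x) hcut'
  have key : ∀ A B : Set X, IsOpen A → IsOpen B → Disjoint A B → A ∪ B = univ \ {x} →
      x ∈ closure A → ∃ q ∈ A, q ∈ frontier P := by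
    intro A B hA hB hd hAB hxA
    by_contra hcon
    push Not at hcon
    obtain ⟨a, haP, haA⟩ := mem_closure_iff.1 hxA P hP.1 hx
    have hAP : IsOpen (A ∩ P) := hA.inter hP.1
    have hsub : connectedComponentIn (A ∩ P) a ⊆ A ∩ P := connectedComponentIn_subset _ _
    have hC : connectedComponentIn (A ∩ P) a ∈ G X := by
      refine ⟨hAP.connectedComponentIn, ⟨a, mem_connectedComponentIn ⟨haA, haP⟩⟩,
        isPreconnected_connectedComponentIn, ?_⟩
      refine (subsingleton_singleton (a := x)).anti fun z hz => ?_
      obtain ⟨h1, h2⟩ := frontier_comp hAP hz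
      by_contra hzx
      have hzA : z ∈ closure A := closure_mono inter_subset_left h1
      have hzP : z ∈ closure P := closure_mono inter_subset_right h1
      have : z ∈ A ∪ B := by rw [hAB]; exact ⟨mem_univ _, hzx⟩
      rcases this with h | h
      · refine hcon z h ?_
        rw [hP.1.frontier_eq]
        exact ⟨hzP, fun h' => h2 ⟨h, h'⟩⟩
      · obtain ⟨w, hw, hw'⟩ := mem_closure_iff.1 hzA B hB h
        exact Set.disjoint_left.1 hd hw' hw
    have := hPm.le_of_le hC (hsub.trans inter_subset_right)
    have hxA' : x ∈ A := (hsub (this hx)).1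
    have : x ∈ univ \ {x} := by rw [← hAB]; left; exact hxA'
    exact this.2 rfl
  obtain ⟨q, hq, hqf⟩ := key A B hA hB hd hAB hxA
  obtain ⟨r, hr, hrf⟩ := key B A hB hA hd.symm (by rw [union_comm]; exact hAB) hxB
  have := hP.2.2.2 hqf hrf
  subst this
  exact Set.disjoint_left.1 hd hq hr

/-- Exhaustion of a connected open set missing `x` by connected sets staying away from `x`. -/
lemma exhaust [LocallyConnectedSpace X] {U K : Set X} (hU : IsOpen U) (hc : IsPreconnected U)
    {a x : X} (ha : a ∈ U) (hx : x ∉ U) (hK : IsCompact K) (hKU : K ⊆ U) :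
    ∃ H : Set X, IsPreconnected H ∧ H ⊆ U ∧ a ∈ H ∧ K ⊆ H ∧
      ∃ O, IsOpen O ∧ x ∈ O ∧ Disjoint O H := by
  let H : Set.Ioi (0 : ℝ) → Set X :=
    fun r => connectedComponentIn (U \ Metric.closedBall x r) a
  have hopen : ∀ r, IsOpen (H r) := fun r =>
    (hU.sdiff Metric.isClosed_closedBall).connectedComponentIn
  have hmono : ∀ r s : Set.Ioi (0 : ℝ), (r : ℝ) ≤ s → H s ⊆ H r := by
    intro r s hrs
    exact connectedComponentIn_mono _ (sdiff_subset_sdiff_right (Metric.closedBall_subset_closedBall hrs))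
  have hsubU : ∀ r, H r ⊆ U := fun r => (connectedComponentIn_subset _ _).trans sdiff_subset
  have hax : 0 < dist a x := dist_pos.2 (fun h => hx (h ▸ ha))
  have haH : ∀ r : Set.Ioi (0 : ℝ), (r : ℝ) < dist a x → a ∈ H r := by
    intro r hr
    exact mem_connectedComponentIn ⟨ha, by simpa using hr⟩
  -- absorbing lemma
  have habs : ∀ y ∈ U, ∃ N, IsOpen N ∧ y ∈ N ∧ ∀ r, (N ∩ H r).Nonempty → ∃ s, N ⊆ H s := by
    intro y hy
    have hyx : 0 < dist y x := dist_pos.2 (fun h => hx (h ▸ hy))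
    obtain ⟨N, hN, hyN, hNc, hNs⟩ := conn_nhd (O := U \ Metric.closedBall x (dist y x / 2))
      (hU.sdiff Metric.isClosed_closedBall) (x := y) ⟨hy, fun h => by
        have := Metric.mem_closedBall.1 h; linarith⟩
    refine ⟨N, hN, hyN, fun r hr => ?_⟩
    let s : Set.Ioi (0 : ℝ) := ⟨min (r : ℝ) (dist y x / 2), lt_min (mem_Ioi.1 r.2) (half_pos (by assumption))⟩
    obtain ⟨z, hzN, hzH⟩ := hr
    refine ⟨s, ?_⟩
    have hzs : z ∈ H s := hmono s r (min_le_left _ _) hzH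
    have h1 : H s = connectedComponentIn (U \ Metric.closedBall x s) z :=
      connectedComponentIn_eq hzs
    rw [h1]
    refine hNc.subset_connectedComponentIn hzN (hNs.trans ?_)
    exact sdiff_subset_sdiff_right (Metric.closedBall_subset_closedBall (min_le_right _ _))
  have hcover : U ⊆ ⋃ r, H r := by
    intro y hy
    by_contra hyn
    have hcl : ∀ y ∈ U, y ∉ (⋃ r, H r) → y ∉ closure (⋃ r, H r) := by
      intro y hy hyn hyc
      obtain ⟨N, hN, hyN, h⟩ := habs y hy
      obtain ⟨z, hzN, hz⟩ := mem_closure_iff.1 hyc N hN hyN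
      obtain ⟨r, hr⟩ := mem_iUnion.1 hz
      obtain ⟨s, hs⟩ := h r ⟨z, hzN, hr⟩
      exact hyn (mem_iUnion.2 ⟨s, hs hyN⟩)
    obtain ⟨w, _, h1, h2⟩ := hc (⋃ r, H r) (closure (⋃ r, H r))ᶜ (isOpen_iUnion hopen)
      isClosed_closure.isOpen_compl
      (by
        intro w hw
        by_cases h : w ∈ ⋃ r, H r
        · left; exact h
        · right; exact hcl w hw h)
      ⟨a, ha, mem_iUnion.2 ⟨⟨dist a x / 2, half_pos hax⟩, haH _ (half_lt_self hax)⟩⟩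
      ⟨y, hy, hcl y hy hyn⟩
    exact h2 (subset_closure h1)
  have hdir : Directed (· ⊆ ·) H := by
    intro r s
    exact ⟨⟨min (r : ℝ) s, lt_min (mem_Ioi.1 r.2) (mem_Ioi.1 s.2)⟩, hmono _ _ (min_le_left _ _), hmono _ _ (min_le_right _ _)⟩
  have : Nonempty (Set.Ioi (0 : ℝ)) := ⟨⟨1, by simp⟩⟩
  obtain ⟨r, hr⟩ := hK.elim_directed_cover H hopen (hKU.trans hcover) hdir
  let s : Set.Ioi (0 : ℝ) := ⟨min (r : ℝ) (dist a x / 2), lt_min (mem_Ioi.1 r.2) (half_pos (by assumption))⟩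
  refine ⟨H s, isPreconnected_connectedComponentIn, hsubU s,
    haH s (lt_of_le_of_lt (min_le_right _ _) (by linarith)), hr.trans (hmono s r (min_le_left _ _)),
    Metric.ball x s, Metric.isOpen_ball, Metric.mem_ball_self s.2, ?_⟩
  rw [Set.disjoint_left]
  intro z hz hzH
  exact (connectedComponentIn_subset _ _ hzH).2 (Metric.ball_subset_closedBall hz)

/-- points separating `a` from `b` in `V`. -/
def T (V : Set X) (a b : X) : Set X :=
  {x | x ∈ V ∧ x ≠ a ∧ x ≠ b ∧ b ∉ connectedComponentIn (V \ {x}) a}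

lemma T_closed [LocallyConnectedSpace X] {V : Set X} (hV : IsOpen V) {a b : X} (ha : a ∈ V)
    {x : X} (hx : x ∈ V) (hxa : x ≠ a) (hxb : x ≠ b) (hcl : x ∈ closure (T V a b)) :
    x ∈ T V a b := by
  refine ⟨hx, hxa, hxb, fun hb => ?_⟩
  have hO : IsOpen (V \ {x}) := hV.sdiff isClosed_singleton
  have hsub : connectedComponentIn (V \ {x}) a ⊆ V \ {x} := connectedComponentIn_subset _ _
  obtain ⟨H, hH, hHU, haH, hbH, O, hOo, hxO, hd⟩ := exhaust (K := {b}) (x := x)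
    hO.connectedComponentIn isPreconnected_connectedComponentIn
    (mem_connectedComponentIn (x := a) (F := V \ {x}) ⟨ha, fun h => hxa h.symm⟩)
    (fun h => (hsub h).2 rfl) isCompact_singleton (by simpa using hb)
  obtain ⟨y, hyO, hyT⟩ := mem_closure_iff.1 hcl O hOo hxO
  refine hyT.2.2.2 (hH.subset_connectedComponentIn haH ?_ (hbH rfl))
  intro z hz
  refine ⟨(hsub (hHU hz)).1, fun h => ?_⟩
  rw [mem_singleton_iff] at h
  subst h
  exact Set.disjoint_left.1 hd hyO hz

lemma baire_step [CompactSpace X] [LocallyConnectedSpace X] [Nonempty X]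
    (hloc : ∀ x : X, IsLocalCutPoint x) {O : Set X} (hO : IsOpen O) (hOn : O.Nonempty) :
    ∃ (V W : Set X) (a b : X), IsOpen V ∧ IsPreconnected V ∧ a ∈ V ∧ b ∈ V ∧
      IsOpen W ∧ W.Nonempty ∧ W ⊆ O ∧ W ⊆ T V a b := by
  let D : Set X := range (TopologicalSpace.denseSeq X)
  have hD : Dense D := TopologicalSpace.denseRange_denseSeq X
  have hDc : D.Countable := countable_range _
  have : Countable D := hDc.to_subtype
  let 𝓑 := TopologicalSpace.countableBasis X
  have h𝓑 := TopologicalSpace.isBasis_countableBasis X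
  have : Countable 𝓑 := (TopologicalSpace.countable_countableBasis X).to_subtype
  let ι := {p : 𝓑 × D × D × D // (p.2.2.1 : X) ∈ connectedComponentIn (p.1 : Set X) (p.2.1 : X) ∧
    (p.2.2.2 : X) ∈ connectedComponentIn (p.1 : Set X) (p.2.1 : X)}
  let V : ι → Set X := fun p => connectedComponentIn (p.1.1 : Set X) (p.1.2.1 : X)
  have hVo : ∀ i, IsOpen (V i) := fun i =>
    (h𝓑.isOpen i.1.1.2).connectedComponentIn
  let f : ι → Set X := fun i => closure (T (V i) (i.1.2.2.1 : X) (i.1.2.2.2 : X))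
  have hun : ⋃ i, f i = univ := by
    rw [eq_univ_iff_forall]
    intro x
    obtain ⟨U, hU, hxU, hc, hn⟩ := hloc x
    obtain ⟨A, B, hA, hB, -, -, hd, hAB, hxA, hxB⟩ := sep hU hc.isPreconnected hxU hn
    obtain ⟨S, hS, hxS, hSU⟩ := h𝓑.exists_subset_of_mem_open hxU hU
    have hSo := h𝓑.isOpen hS
    have hCo : IsOpen (connectedComponentIn S x) := hSo.connectedComponentIn
    have hxC : x ∈ connectedComponentIn S x := mem_connectedComponentIn hxS
    obtain ⟨d, hdC, hdD⟩ := hD.inter_open_nonempty _ hCo ⟨x, hxC⟩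
    have heq : connectedComponentIn S x = connectedComponentIn S d := connectedComponentIn_eq hdC
    obtain ⟨a, ⟨haC, haA⟩, haD⟩ := hD.inter_open_nonempty _ (hCo.inter hA)
      (mem_closure_iff.1 hxA _ hCo hxC)
    obtain ⟨b, ⟨hbC, hbB⟩, hbD⟩ := hD.inter_open_nonempty _ (hCo.inter hB)
      (mem_closure_iff.1 hxB _ hCo hxC)
    have hax : a ∈ U \ {x} := by rw [← hAB]; left; exact haA
    have hbx : b ∈ U \ {x} := by rw [← hAB]; right; exact hbB
    rw [heq] at haC hbC hxC
    refine mem_iUnion.2 ⟨⟨(⟨S, hS⟩, ⟨d, hdD⟩, ⟨a, haD⟩, ⟨b, hbD⟩), haC, hbC⟩, subset_closure ?_⟩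
    refine ⟨hxC, fun h => hax.2 h.symm, fun h => hbx.2 h.symm, fun hb => ?_⟩
    have haV : a ∈ connectedComponentIn S d \ {x} := ⟨haC, hax.2⟩
    obtain ⟨z, _, hzA, hzB⟩ := (isPreconnected_connectedComponentIn
      (F := connectedComponentIn S d \ {x}) (x := a)) A B hA hB
      (by
        intro z hz
        have h1 := connectedComponentIn_subset _ _ hz
        rw [hAB]
        exact ⟨hSU (connectedComponentIn_subset _ _ h1.1), h1.2⟩)
      ⟨a, mem_connectedComponentIn haV, haA⟩ ⟨b, hb, hbB⟩
    exact Set.disjoint_left.1 hd hzA hzB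
  have hdense := dense_iUnion_interior_of_closed (f := f) (fun i => isClosed_closure) hun
  obtain ⟨w, hwO, hw⟩ := hdense.inter_open_nonempty O hO hOn
  obtain ⟨i, hi⟩ := mem_iUnion.1 hw
  obtain ⟨y, ⟨hyO, hyi⟩, hyT⟩ := mem_closure_iff.1 (interior_subset hi) (O ∩ interior (f i))
    (hO.inter isOpen_interior) ⟨hwO, hi⟩
  refine ⟨V i, (O ∩ interior (f i)) ∩ (V i \ {(i.1.2.2.1 : X), (i.1.2.2.2 : X)}),
    i.1.2.2.1, i.1.2.2.2, hVo i, isPreconnected_connectedComponentIn, i.2.1, i.2.2,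
    (hO.inter isOpen_interior).inter ((hVo i).sdiff (Set.Finite.isClosed (by simp))),
    ⟨y, ⟨hyO, hyi⟩, hyT.1, ?_⟩, fun z hz => hz.1.1, ?_⟩
  · rintro (h | h)
    · exact hyT.2.1 h
    · exact hyT.2.2.1 h
  · rintro z ⟨⟨hzO, hzi⟩, hzV, hzn⟩
    simp only [mem_insert_iff, mem_singleton_iff, not_or] at hzn
    exact T_closed (hVo i) i.2.1 hzV hzn.1 hzn.2 (interior_subset hzi)

lemma comp_adh [LocallyConnectedSpace X] {V : Set X} (hV : IsOpen V) (hc : IsPreconnected V)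
    {y w : X} (hy : y ∈ V) (hw : w ∈ V) (hwy : w ≠ y) :
    y ∈ closure (connectedComponentIn (V \ {y}) w) := by
  by_contra hcl
  have hO : IsOpen (V \ {y}) := hV.sdiff isClosed_singleton
  obtain ⟨z, _, h1, h2⟩ := hc (connectedComponentIn (V \ {y}) w)
    (closure (connectedComponentIn (V \ {y}) w))ᶜ hO.connectedComponentIn
    isClosed_closure.isOpen_compl
    (by
      intro z hz
      by_cases h : z ∈ closure (connectedComponentIn (V \ {y}) w)
      · left
        refine comp_closure _ _ _ h ⟨hz, fun h' => ?_⟩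
        rw [mem_singleton_iff] at h'
        subst h'
        exact hcl h
      · right; exact h)
    ⟨w, hw, mem_connectedComponentIn ⟨hw, hwy⟩⟩ ⟨y, hy, hcl⟩
  exact h2 (subset_closure h1)

lemma comp_insert [LocallyConnectedSpace X] {V : Set X} (hV : IsOpen V) (hc : IsPreconnected V)
    {y w : X} (hy : y ∈ V) (hw : w ∈ V) (hwy : w ≠ y) :
    IsPreconnected (insert y (connectedComponentIn (V \ {y}) w)) :=
  isPreconnected_connectedComponentIn.subset_closure (subset_insert _ _)
    (insert_subset (comp_adh hV hc hy hw hwy) subset_closure)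

lemma two_comps [LocallyConnectedSpace X] {V W : Set X} {a b : X} (hV : IsOpen V)
    (hc : IsPreconnected V) (ha : a ∈ V) (hb : b ∈ V) (hW : IsOpen W) (hWT : W ⊆ T V a b)
    {y w : X} (hy : y ∈ W) (hw : w ∈ V) (hwy : w ≠ y) :
    w ∈ connectedComponentIn (V \ {y}) a ∨ w ∈ connectedComponentIn (V \ {y}) b := by
  by_contra hcon
  push Not at hcon
  obtain ⟨hyV, hya, hyb, hys⟩ := hWT hy
  obtain ⟨t, htW, ht⟩ := mem_closure_iff.1 (comp_adh hV hc hyV hw hwy) W hW hy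
  have hty := (connectedComponentIn_subset _ _ ht).2
  have hwt : ∀ p, t ∈ connectedComponentIn (V \ {y}) p → w ∈ connectedComponentIn (V \ {y}) p := by
    intro p hp
    rw [connectedComponentIn_eq hp, ← connectedComponentIn_eq ht]
    exact mem_connectedComponentIn ⟨hw, hwy⟩
  have h1 := comp_insert hV hc hyV ha hya.symm
  have h2 := comp_insert hV hc hyV hb hyb.symm
  have h3 := h1.union y (mem_insert _ _) (mem_insert _ _) h2
  refine (hWT htW).2.2.2 (h3.subset_connectedComponentIn
    (Or.inl (Or.inr (mem_connectedComponentIn ⟨ha, hya.symm⟩))) ?_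
    (Or.inr (Or.inr (mem_connectedComponentIn ⟨hb, hyb.symm⟩))))
  have hsub : ∀ p, (t ∉ connectedComponentIn (V \ {y}) p) →
      insert y (connectedComponentIn (V \ {y}) p) ⊆ V \ {t} := by
    rintro p hp z (rfl | hz)
    · exact ⟨hyV, fun h => hty h.symm⟩
    · refine ⟨(connectedComponentIn_subset _ _ hz).1, fun h => ?_⟩
      rw [mem_singleton_iff] at h
      subst h
      exact hp hz
  exact union_subset (hsub a fun h => hcon.1 (hwt a h)) (hsub b fun h => hcon.2 (hwt b h))

lemma T_symm {V : Set X} {a b : X} (hb : b ∈ V) : T V a b ⊆ T V b a := by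
  rintro x ⟨hx, hxa, hxb, h⟩
  refine ⟨hx, hxb, hxa, fun h' => h ?_⟩
  rw [← connectedComponentIn_eq h']
  exact mem_connectedComponentIn ⟨hb, hxb.symm⟩

/-- One-sided choice of a boundary point close to `x`. -/
lemma side [LocallyConnectedSpace X] [CompactSpace X] {V W N : Set X} {a b : X} (hV : IsOpen V)
    (hc : IsPreconnected V) (ha : a ∈ V) (hb : b ∈ V) (hW : IsOpen W) (hWT : W ⊆ T V a b)
    {x : X} (hx : x ∈ W) (hN : IsOpen N) (hxN : x ∈ N) (hNV : closure N ⊆ V) (hNW : N ⊆ W) :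
    ∃ s ∈ N, x ∈ connectedComponentIn (V \ {s}) b ∧
      ∀ z ∈ frontier N, z ∈ connectedComponentIn (V \ {x}) a →
        z ∉ connectedComponentIn (V \ {s}) b := by
  obtain ⟨hxV, hxa, hxb, hxs⟩ := hWT hx
  have hO : IsOpen (V \ {x}) := hV.sdiff isClosed_singleton
  have hsub : ∀ p, connectedComponentIn (V \ {x}) p ⊆ V \ {x} :=
    fun p => connectedComponentIn_subset _ _
  have hxf : x ∉ frontier N := by
    rw [hN.frontier_eq]; exact fun h => h.2 hxN
  have hKeq : frontier N ∩ connectedComponentIn (V \ {x}) a =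
      frontier N ∩ closure (connectedComponentIn (V \ {x}) a) := by
    apply Subset.antisymm (inter_subset_inter_right _ subset_closure)
    rintro z ⟨hz, hz'⟩
    refine ⟨hz, comp_closure _ _ _ hz' ⟨hNV (frontier_subset_closure hz), fun h => ?_⟩⟩
    rw [mem_singleton_iff] at h
    subst h
    exact hxf hz
  have hK : IsCompact (frontier N ∩ connectedComponentIn (V \ {x}) a) := by
    rw [hKeq]
    exact (isClosed_frontier.inter isClosed_closure).isCompact
  obtain ⟨H, hH, hHU, haH, hKH, Q, hQo, hxQ, hd⟩ := exhaust (x := x)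
    hO.connectedComponentIn isPreconnected_connectedComponentIn
    (mem_connectedComponentIn (x := a) (F := V \ {x}) ⟨ha, hxa.symm⟩)
    (fun h => (hsub _ h).2 rfl) hK inter_subset_right
  obtain ⟨s, ⟨hsN, hsQ⟩, hs⟩ := mem_closure_iff.1 (comp_adh hV hc hxV ha hxa.symm) (N ∩ Q)
    (hN.inter hQo) ⟨hxN, hxQ⟩
  obtain ⟨hsV, hsa, hsb, hss⟩ := hWT (hNW hsN)
  refine ⟨s, hsN, ?_, ?_⟩
  · refine (comp_insert hV hc hxV hb hxb.symm).subset_connectedComponentIn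
      (Or.inr (mem_connectedComponentIn ⟨hb, hxb.symm⟩)) ?_ (mem_insert _ _)
    rintro z (rfl | hz)
    · exact ⟨hxV, fun h => (hsub _ hs).2 h.symm⟩
    · refine ⟨(hsub _ hz).1, fun h => ?_⟩
      rw [mem_singleton_iff] at h
      subst h
      apply hxs
      rw [connectedComponentIn_eq hs, ← connectedComponentIn_eq hz]
      exact mem_connectedComponentIn ⟨hb, hxb.symm⟩
  · intro z hz hza hzb
    have hzA : z ∈ connectedComponentIn (V \ {s}) a := by
      refine hH.subset_connectedComponentIn haH ?_ (hKH ⟨hz, hza⟩)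
      intro p hp
      refine ⟨(hsub _ (hHU hp)).1, fun h => ?_⟩
      rw [mem_singleton_iff] at h
      subst h
      exact Set.disjoint_left.1 hd hsQ hp
    apply hss
    rw [connectedComponentIn_eq hzA, ← connectedComponentIn_eq hzb]
    exact mem_connectedComponentIn ⟨hb, hsb.symm⟩

lemma order_two [LocallyConnectedSpace X] [CompactSpace X] {V W : Set X} {a b : X} (hV : IsOpen V)
    (hc : IsPreconnected V) (ha : a ∈ V) (hb : b ∈ V) (hW : IsOpen W) (hWT : W ⊆ T V a b)
    {x : X} (hx : x ∈ W) : MengerOrderLE x 2 := by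
  intro U hU
  have hnh : U ∩ W ∈ 𝓝 x := Filter.inter_mem hU (hW.mem_nhds hx)
  obtain ⟨r, hr, hrs⟩ := Metric.nhds_basis_closedBall.mem_iff.1 hnh
  let N := Metric.ball x r
  have hN : IsOpen N := Metric.isOpen_ball
  have hxN : x ∈ N := Metric.mem_ball_self hr
  have hcN : closure N ⊆ U ∩ W := Metric.closure_ball_subset_closedBall.trans hrs
  have hNW : N ⊆ W := subset_closure.trans (hcN.trans inter_subset_right)
  have hNV : closure N ⊆ V := fun z hz => (hWT (hcN hz).2).1
  obtain ⟨s, hsN, hxs, hsf⟩ := side hV hc ha hb hW hWT hx hN hxN hNV hNW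
  obtain ⟨t, htN, hxt, htf⟩ := side hV hc hb ha hW (hWT.trans (T_symm hb)) hx hN hxN hNV hNW
  have hos : IsOpen (connectedComponentIn (V \ {s}) b) :=
    (hV.sdiff isClosed_singleton).connectedComponentIn
  have hot : IsOpen (connectedComponentIn (V \ {t}) a) :=
    (hV.sdiff isClosed_singleton).connectedComponentIn
  set M := connectedComponentIn (V \ {s}) b ∩ connectedComponentIn (V \ {t}) a with hM
  have hMo : IsOpen (M ∩ N) := (hos.inter hot).inter hN
  have hfr : frontier (M ∩ N) ⊆ {s, t} := by
    intro z hz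
    rw [hMo.frontier_eq] at hz
    by_contra hzn
    simp only [mem_insert_iff, mem_singleton_iff, not_or] at hzn
    have hzN : z ∈ closure N := closure_mono inter_subset_right hz.1
    have hzV := hNV hzN
    have hz1 : z ∈ connectedComponentIn (V \ {s}) b :=
      comp_closure _ _ _ (closure_mono (inter_subset_left.trans inter_subset_left) hz.1)
        ⟨hzV, hzn.1⟩
    have hz2 : z ∈ connectedComponentIn (V \ {t}) a :=
      comp_closure _ _ _ (closure_mono (inter_subset_left.trans inter_subset_right) hz.1)
        ⟨hzV, hzn.2⟩
    have hzf : z ∈ frontier N := by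
      rw [hN.frontier_eq]
      exact ⟨hzN, fun h => hz.2 ⟨⟨hz1, hz2⟩, h⟩⟩
    have hzx : z ≠ x := by
      rintro rfl
      rw [hN.frontier_eq] at hzf
      exact hzf.2 hxN
    rcases two_comps hV hc ha hb hW hWT hx hzV hzx with h | h
    · exact hsf z hzf h hz1
    · exact htf z hzf h hz2
  have hfin : ({s, t} : Set X).Finite := by simp
  refine ⟨M ∩ N, hMo.mem_nhds ⟨⟨hxs, hxt⟩, hxN⟩, fun z hz => (hcN (subset_closure hz.2)).1,
    hfin.subset hfr, (Set.ncard_le_ncard hfr hfin).trans ?_⟩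
  exact (Set.ncard_insert_le s {t}).trans (by simp)

end PeanoAux

/-- Every nondegenerate Peano continuum contains a point which either is not a
local cut point, or is a local cut point that is not a cut point and has Menger
order exactly 2. -/
theorem exists_nonLocalCut_or_order_two {X : Type*} [MetricSpace X] [CompactSpace X]
    [ConnectedSpace X] [LocallyConnectedSpace X] [Nontrivial X] :
    ∃ x : X, (¬ IsLocalCutPoint x) ∨
      (IsLocalCutPoint x ∧ ¬ IsCutPoint x ∧ MengerOrderLE x 2 ∧ ¬ MengerOrderLE x 1) := by
  by_cases hloc : ∀ x : X, IsLocalCutPoint x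
  · obtain ⟨O, hO, hOn, hcut⟩ := PeanoAux.exists_open_noncut hloc
    obtain ⟨V, W, a, b, hV, hc, ha, hb, hW, ⟨x, hx⟩, hWO, hWT⟩ :=
      PeanoAux.baire_step hloc hO hOn
    exact ⟨x, Or.inr ⟨hloc x, hcut x (hWO hx), PeanoAux.order_two hV hc ha hb hW hWT hx,
      PeanoAux.not_order_one (hloc x)⟩⟩
  · push Not at hloc
    obtain ⟨x, hx⟩ := hloc
    exact ⟨x, Or.inl hx⟩
end

section
/- Every nondegenerate Peano continuum admits a continuous surjection onto itself that is topologically mixing but not exact and has a dense set of periodic points. -/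
open Set Topology

def TopExact {Z : Type*} [TopologicalSpace Z] (T : Z → Z) : Prop :=
  ∀ U : Set Z, IsOpen U → U.Nonempty → ∃ n : ℕ, T^[n] '' U = univ

def TopMixing {Z : Type*} [TopologicalSpace Z] (T : Z → Z) : Prop :=
  ∀ U V : Set Z, IsOpen U → IsOpen V → U.Nonempty → V.Nonempty →
    ∃ n₀ : ℕ, ∀ n ≥ n₀, (T^[n] '' U ∩ V).Nonempty

open Set Topology

namespace PureMix

/-- smooth zigzag -/
noncomputable def kap (x : ℝ) : ℝ := (1 - Real.cos (Real.pi * x)) / 2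

lemma kap_cont : Continuous kap := by unfold kap; fun_prop

lemma kap_zero : kap 0 = 0 := by simp [kap]
lemma kap_one : kap 1 = 1 := by simp [kap]
lemma kap_nonneg (x : ℝ) : 0 ≤ kap x := by
  unfold kap; have := Real.cos_le_one (Real.pi * x); linarith
lemma kap_le_one (x : ℝ) : kap x ≤ 1 := by
  unfold kap; have := Real.neg_one_le_cos (Real.pi * x); linarith

lemma kap_even (i : ℤ) : kap (2 * i) = 0 := by
  unfold kap
  have : Real.pi * (2 * (i:ℝ)) = i * (2 * Real.pi) := by ring
  rw [this, Real.cos_int_mul_two_pi]; norm_num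

lemma kap_odd (i : ℤ) : kap (2 * i + 1) = 1 := by
  unfold kap
  have : Real.pi * (2 * (i:ℝ) + 1) = i * (2 * Real.pi) + Real.pi := by ring
  rw [this, Real.cos_int_mul_two_pi_add_pi]; norm_num

lemma kap_lip (x y : ℝ) : |kap x - kap y| ≤ 2 * |x - y| := by
  unfold kap
  have h := Real.abs_cos_sub_cos_le (Real.pi * x) (Real.pi * y)
  have h2 : (1 - Real.cos (Real.pi * x)) / 2 - (1 - Real.cos (Real.pi * y)) / 2
     = -((Real.cos (Real.pi * x) - Real.cos (Real.pi * y)) / 2) := by ring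
  rw [h2, abs_neg, abs_div]
  have h3 : Real.pi * x - Real.pi * y = Real.pi * (x - y) := by ring
  rw [h3, abs_mul, abs_of_pos Real.pi_pos] at h
  have := Real.pi_le_four
  have h4 := abs_nonneg (x - y)
  rw [abs_of_pos (by norm_num : (0:ℝ) < 2)]
  nlinarith

/-- `kap` is nonconstant on every interval. -/
lemma kap_nonconst {a b : ℝ} (hab : a < b) : ∃ s ∈ Icc a b, ∃ t ∈ Icc a b, kap s < kap t := by
  by_contra! H
  have hc : ∀ s ∈ Icc a b, kap s = kap a := fun s hs =>
    le_antisymm (H a (left_mem_Icc.2 hab.le) s hs) (H s hs a (left_mem_Icc.2 hab.le))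
  -- derivative vanishes on the interior, hence sin vanishes, hence second derivative
  have hd : ∀ s ∈ Ioo a b, Real.sin (Real.pi * s) = 0 := by
    intro s hs
    have h1 : HasDerivAt kap (Real.sin (Real.pi * s) * Real.pi / 2) s := by
      unfold kap
      have := ((((hasDerivAt_id s).const_mul Real.pi).cos).const_sub 1).div_const 2
      have e : Real.sin (Real.pi * s) * Real.pi / 2 =
        -(-Real.sin (Real.pi * id s) * (Real.pi * 1)) / 2 := by simp
      rw [e]
      exact this
    have h2 : HasDerivAt kap 0 s := by
      refine (hasDerivAt_const s (kap a)).congr_of_eventuallyEq ?_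
      filter_upwards [Ioo_mem_nhds hs.1 hs.2] with t ht
      exact hc t (Ioo_subset_Icc_self ht)
    have := h1.unique h2
    have hp := Real.pi_pos
    have h5 : Real.sin (Real.pi * s) * Real.pi = 0 := by linarith
    exact (mul_eq_zero.1 h5).resolve_right hp.ne'
  have hIntg : ∀ s ∈ Ioo a b, ∃ n : ℤ, (n : ℝ) = s := by
    intro s hs
    obtain ⟨n, hn⟩ := Real.sin_eq_zero_iff.1 (hd s hs)
    refine ⟨n, ?_⟩
    have hp := Real.pi_pos
    have : (n:ℝ) * Real.pi = s * Real.pi := by rw [hn]; ring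
    exact mul_right_cancel₀ hp.ne' this
  obtain ⟨x, hx, hx2⟩ := ((Set.countable_range (fun n : ℤ => (n:ℝ))).dense_compl ℝ).exists_between hab
  obtain ⟨n, hn⟩ := hIntg x hx2
  exact hx ⟨n, hn⟩

/-- Sub-interval version of the intermediate value theorem. -/
lemma ivt_sub {φ : ℝ → ℝ} {a b : ℝ} (hφ : ContinuousOn φ (Icc a b)) {x y : ℝ} (hx : x ∈ Icc a b)
    (hy : y ∈ Icc a b) {c d : ℝ} (hcd : c < d) (hxc : φ x ≤ c) (hyd : d ≤ φ y) :
    ∃ α β, a ≤ α ∧ α < β ∧ β ≤ b ∧ (∀ t ∈ Icc α β, φ t ∈ Icc c d) ∧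
      ((φ α = c ∧ φ β = d) ∨ (φ α = d ∧ φ β = c)) := by
  -- core lemma for increasing position
  have core : ∀ (φ : ℝ → ℝ) (x y : ℝ), x ≤ y → ContinuousOn φ (Icc x y) → φ x ≤ c → d ≤ φ y →
      ∃ α β, x ≤ α ∧ α < β ∧ β ≤ y ∧ (∀ t ∈ Icc α β, φ t ∈ Icc c d) ∧ (φ α = c ∧ φ β = d) := by
    intro φ x y hxy hφ hxc hyd
    -- first time β with φ = d
    have hS : IsCompact (Icc x y ∩ φ ⁻¹' Ici d) :=
      isCompact_Icc.of_isClosed_subset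
        (hφ.preimage_isClosed_of_isClosed isClosed_Icc isClosed_Ici) inter_subset_left
    obtain ⟨β, hβ⟩ := hS.exists_isLeast ⟨y, right_mem_Icc.2 hxy, hyd⟩
    have hβm := hβ.1
    have hS2 : IsCompact (Icc x β ∩ φ ⁻¹' Iic c) :=
      isCompact_Icc.of_isClosed_subset
        ((hφ.mono (Icc_subset_Icc_right hβm.1.2)).preimage_isClosed_of_isClosed isClosed_Icc
        isClosed_Iic) inter_subset_left
    obtain ⟨α, hα⟩ := hS2.exists_isGreatest ⟨x, left_mem_Icc.2 hβm.1.1, hxc⟩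
    have hαm := hα.1
    have hαd : φ α ≤ c := hαm.2
    have hβd : d ≤ φ β := hβm.2
    have hlt : α < β := lt_of_le_of_ne hαm.1.2 (by rintro rfl; linarith)
    have hcont : ContinuousOn φ (Icc α β) := hφ.mono (Icc_subset_Icc hαm.1.1 hβm.1.2)
    have hi := intermediate_value_Icc hlt.le hcont
    have hφα : φ α = c := by
      obtain ⟨t, ht, htc⟩ := hi ⟨hαd, by linarith⟩
      have := hα.2 ⟨⟨hαm.1.1.trans ht.1, ht.2⟩, (le_of_eq htc : φ t ≤ c)⟩
      rw [← htc, le_antisymm ht.1 this]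
    have hφβ : φ β = d := by
      obtain ⟨t, ht, htc⟩ := hi ⟨by linarith, hβd⟩
      have := hβ.2 ⟨⟨hαm.1.1.trans ht.1, ht.2.trans hβm.1.2⟩, (le_of_eq htc.symm : d ≤ φ t)⟩
      rw [← htc, le_antisymm ht.2 this]
    refine ⟨α, β, hαm.1.1, hlt, hβm.1.2, ?_, hφα, hφβ⟩
    intro t ht
    constructor
    · by_contra! h
      have := hα.2 ⟨⟨hαm.1.1.trans ht.1, ht.2⟩, (h.le : φ t ≤ c)⟩
      have e : t = α := le_antisymm this ht.1
      rw [e] at h; linarith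
    · by_contra! h
      have := hβ.2 ⟨⟨hαm.1.1.trans ht.1, ht.2.trans hβm.1.2⟩, (h.le : d ≤ φ t)⟩
      have e : t = β := le_antisymm ht.2 this
      rw [e] at h; linarith
  rcases le_total x y with hxy | hxy
  · obtain ⟨α, β, h1, h2, h3, h4, h5⟩ := core φ x y hxy
      (hφ.mono (Icc_subset_Icc hx.1 hy.2)) hxc hyd
    exact ⟨α, β, hx.1.trans h1, h2, h3.trans hy.2, h4, Or.inl h5⟩
  · have hc' : ContinuousOn (fun t => φ (-t)) (Icc (-x) (-y)) := by
      refine hφ.comp continuous_neg.continuousOn ?_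
      intro t ht
      exact ⟨by have := hy.1; have := ht.2; linarith, by have := hx.2; have := ht.1; linarith⟩
    obtain ⟨α, β, h1, h2, h3, h4, h5⟩ := core (fun t => φ (-t)) (-x) (-y) (by linarith) hc'
      (by simpa using hxc) (by simpa using hyd)
    refine ⟨-β, -α, by have := hy.1; linarith, by linarith, by have := hx.2; linarith, ?_,
      Or.inr ⟨h5.2, h5.1⟩⟩
    intro t ht
    have := h4 (-t) ⟨by linarith [ht.2], by linarith [ht.1]⟩
    simpa using this

lemma geo (k : ℕ) : HasSum (fun j : ℕ => 6 * (1/4 : ℝ) ^ (j + k)) (8 * (1/4 : ℝ) ^ k) := by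
  have h := (hasSum_geometric_of_lt_one (r := (1/4:ℝ)) (by norm_num) (by norm_num)).mul_left
    (6 * (1/4:ℝ)^k)
  have e : 8 * (1/4 : ℝ) ^ k = 6 * (1/4:ℝ)^k * (1 - 1/4)⁻¹ := by
    have : (1 - 1/4 : ℝ)⁻¹ = 4/3 := by norm_num
    rw [this]; ring
  rw [e]
  refine h.congr_fun ?_
  intro j
  rw [pow_add]; ring

set_option maxHeartbeats 1000000 in
/-- The wild function. -/
lemma wild (ε : ℝ → ℝ) (hε : ∀ c, 0 < c → 0 < ε c) :
    ∃ w : ℝ → ℝ, Continuous w ∧ w 0 = 0 ∧ w 1 = 1 ∧ (∀ x, w x ∈ Icc (-10 : ℝ) 10) ∧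
      (∀ a b : ℝ, 1 / 2 ≤ b - a → ∃ x ∈ Icc a b, ∃ y ∈ Icc a b, w x + 2 ≤ w y) ∧
      (∀ a b : ℝ, a < b → (∃ x ∈ Icc a b, ∃ y ∈ Icc a b, w x + 2 ≤ w y) ∨
        ∃ c, 0 < c ∧ 2 * (b - a) ≤ ε c ∧ ∃ x ∈ Icc a b, ∃ y ∈ Icc a b, w x + c ≤ w y) := by
  set A : ℕ → ℝ := fun k => 6 * (1/4 : ℝ) ^ k with hA
  have hApos : ∀ k, 0 < A k := fun k => by positivity
  have hAsum : HasSum A 8 := by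
    simpa [hA] using geo 0
  set s : ℕ → ℝ := fun k => min (ε (A (k+1) / 3) / 2) ((1/2 : ℝ) ^ (k+1)) with hs
  have hspos : ∀ k, 0 < s k := fun k =>
    lt_min (half_pos (hε _ (by have := hApos (k+1); positivity))) (by positivity)
  -- frequency function
  let Nf : ℕ → ℝ → ℕ := fun k L => 2 * (⌈max (3 / s k) (3 * L / A k)⌉₊ + 1)
  let Ls : ℕ → ℝ := fun k => Nat.rec (2:ℝ) (fun k L => L + 2 * A k * Nf k L) k
  let N : ℕ → ℕ := fun k => Nf k (Ls k)
  have hL0 : Ls 0 = 2 := rfl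
  have hLs : ∀ k, Ls (k+1) = Ls k + 2 * A k * N k := fun k => rfl
  have hNmax : ∀ k, max (3 / s k) (3 * Ls k / A k) ≤ N k := by
    intro k
    have h1 := Nat.le_ceil (max (3 / s k) (3 * Ls k / A k))
    have h2 : (N k : ℝ) = 2 * ((⌈max (3 / s k) (3 * Ls k / A k)⌉₊ : ℝ) + 1) := by
      simp only [N, Nf]; push_cast; ring
    rw [h2]
    have : (0:ℝ) ≤ (⌈max (3 / s k) (3 * Ls k / A k)⌉₊ : ℝ) := Nat.cast_nonneg _
    linarith
  have hNpos : ∀ k, 0 < (N k : ℝ) := fun k =>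
    lt_of_lt_of_le (lt_of_lt_of_le (by have := hspos k; positivity) (le_max_left _ _)) (hNmax k)
  have hNs : ∀ k, 3 / (N k : ℝ) ≤ s k := by
    intro k
    have := (le_max_left _ _).trans (hNmax k)
    rw [div_le_iff₀ (hspos k)] at this
    rw [div_le_iff₀ (hNpos k)]; linarith
  have hNL : ∀ k, Ls k / N k ≤ A k / 3 := by
    intro k
    have := (le_max_right _ _).trans (hNmax k)
    rw [div_le_iff₀ (hApos k)] at this
    rw [div_le_iff₀ (hNpos k)]; linarith
  have hNeven : ∀ k, ∃ i : ℤ, (N k : ℝ) = 2 * i := by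
    intro k
    exact ⟨(⌈max (3 / s k) (3 * Ls k / A k)⌉₊ + 1 : ℕ), by simp only [N, Nf]; push_cast; ring⟩
  let u : ℕ → ℝ → ℝ := fun k x => A k * kap (N k * x)
  have hu0 : ∀ k x, 0 ≤ u k x := fun k x => mul_nonneg (hApos k).le (kap_nonneg _)
  have huA : ∀ k x, u k x ≤ A k := fun k x => by
    have := mul_le_mul_of_nonneg_left (kap_le_one (N k * x)) (hApos k).le
    simpa [u] using this
  have husum : ∀ x, Summable (fun k => u k x) := fun x =>
    Summable.of_nonneg_of_le (fun k => hu0 k x) (fun k => huA k x) hAsum.summable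
  let w : ℝ → ℝ := fun x => kap x + ∑' k, u k x
  have hosc : ∀ k a b, s k ≤ b - a → ∃ x ∈ Icc a b, ∃ y ∈ Icc a b, w x + A k / 3 ≤ w y := by
    intro k a b hab
    have hN := hNpos k
    set i : ℤ := ⌈N k * a / 2⌉ with hi
    have hi1 : N k * a / 2 ≤ i := Int.le_ceil _
    have hi2 : (i:ℝ) < N k * a / 2 + 1 := Int.ceil_lt_add_one _
    have h3 : 3 ≤ (b - a) * N k := by
      have := (hNs k).trans hab
      rwa [div_le_iff₀ hN] at this
    set x : ℝ := 2 * i / N k with hx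
    set y : ℝ := (2 * i + 1) / N k with hy
    have hxa : a ≤ x := by rw [hx, le_div_iff₀ hN]; linarith
    have hxy : x < y := by rw [hx, hy]; gcongr; linarith
    have hyb : y ≤ b := by rw [hy, div_le_iff₀ hN]; nlinarith
    refine ⟨x, ⟨hxa, hxy.le.trans hyb⟩, y, ⟨hxa.trans hxy.le, hyb⟩, ?_⟩
    have hux : u k x = 0 := by
      simp only [u]
      rw [hx, mul_div_cancel₀ _ hN.ne', kap_even, mul_zero]
    have huy : u k y = A k := by
      simp only [u]
      rw [hy, mul_div_cancel₀ _ hN.ne', kap_odd, mul_one]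
    have hyx : |y - x| = 1 / N k := by
      rw [abs_of_pos (by linarith), hx, hy]; field_simp; ring
    -- partial sums are Lipschitz
    have hpart : ∀ m, |(kap y + ∑ j ∈ Finset.range m, u j y) - (kap x + ∑ j ∈ Finset.range m, u j x)|
        ≤ Ls m * |y - x| := by
      intro m
      induction m with
      | zero => simpa [hL0] using kap_lip y x
      | succ m ih =>
        rw [Finset.sum_range_succ, Finset.sum_range_succ, hLs]
        have h1 : |u m y - u m x| ≤ 2 * A m * N m * |y - x| := by
          simp only [u]
          rw [← mul_sub, abs_mul, abs_of_pos (hApos m)]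
          have := kap_lip (N m * y) (N m * x)
          rw [← mul_sub, abs_mul, abs_of_pos (hNpos m)] at this
          have := mul_le_mul_of_nonneg_left this (hApos m).le
          linarith
        have h2 : kap y + (∑ j ∈ Finset.range m, u j y + u m y) - (kap x + (∑ j ∈ Finset.range m, u j x + u m x))
          = ((kap y + ∑ j ∈ Finset.range m, u j y) - (kap x + ∑ j ∈ Finset.range m, u j x)) + (u m y - u m x) := by ring
        rw [h2]
        refine (abs_add_le _ _).trans ?_
        rw [add_mul]
        exact add_le_add ih h1
    have hp := hpart k
    rw [hyx] at hp
    have hp2 : Ls k * (1 / N k) ≤ A k / 3 := by have := hNL k; rw [mul_one_div]; exact this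
    have hsplit : ∀ z, w z = (kap z + ∑ j ∈ Finset.range k, u j z) + u k z + ∑' j, u (j + (k+1)) z := by
      intro z
      simp only [w]
      rw [← (husum z).sum_add_tsum_nat_add (k+1), Finset.sum_range_succ]; ring
    have htail : ∑' j, u (j + (k+1)) x ≤ A k / 3 := by
      have h1 : HasSum (fun j => A (j + (k+1))) (A k / 3) := by
        have h := geo (k+1)
        have e : A k / 3 = 8 * (1/4 : ℝ) ^ (k+1) := by
          show 6 * (1/4 : ℝ) ^ k / 3 = 8 * (1/4 : ℝ) ^ (k+1)
          rw [pow_succ]; ring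
        rw [e]; exact h
      rw [← h1.tsum_eq]
      exact Summable.tsum_le_tsum (fun j => huA _ x) ((summable_nat_add_iff (k+1)).2 (husum x)) h1.summable
    have htail2 : 0 ≤ ∑' j, u (j + (k+1)) y := tsum_nonneg (fun j => hu0 _ y)
    rw [hsplit x, hsplit y, hux, huy]
    have := abs_le.1 (hp.trans hp2)
    linarith [this.1]
  refine ⟨w, ?_, ?_, ?_, ?_, ?_, ?_⟩
  · refine kap_cont.add (continuous_tsum (u := A) (fun k => ?_) hAsum.summable (fun k x => ?_))
    · exact continuous_const.mul (kap_cont.comp (continuous_const.mul continuous_id))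
    · rw [Real.norm_eq_abs, abs_of_nonneg (hu0 k x)]; exact huA k x
  · simp [w, u, kap_zero]
  · have : ∀ k, u k 1 = 0 := by
      intro k
      obtain ⟨i, hi⟩ := hNeven k
      simp only [u]; rw [hi, mul_one, kap_even, mul_zero]
    simp [w, this, kap_one]
  · intro x
    have h1 : ∑' k, u k x ≤ 8 := by
      rw [← hAsum.tsum_eq]
      exact Summable.tsum_le_tsum (fun j => huA _ x) (husum x) hAsum.summable
    have h2 : 0 ≤ ∑' k, u k x := tsum_nonneg (fun k => hu0 k x)
    have := kap_nonneg x
    have := kap_le_one x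
    exact ⟨by simp only [w]; linarith, by simp only [w]; linarith⟩
  · intro a b hab
    have h1 : s 0 ≤ b - a := (min_le_right _ _).trans (by simpa using hab)
    obtain ⟨x, hx, y, hy, h⟩ := hosc 0 a b h1
    refine ⟨x, hx, y, hy, ?_⟩
    simp only [hA] at h; norm_num at h; exact h
  · intro a b hab
    have hex : ∃ k, s k ≤ b - a := by
      obtain ⟨k, hk⟩ := exists_pow_lt_of_lt_one (sub_pos.2 hab) (by norm_num : (1/2:ℝ) < 1)
      refine ⟨k, (min_le_right _ _).trans ?_⟩
      rw [pow_succ]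
      have : (0:ℝ) < (1/2)^k := by positivity
      linarith
    classical
    rcases hk : Nat.find hex with _ | k
    · left
      have h1 : s 0 ≤ b - a := by have := Nat.find_spec hex; rwa [hk] at this
      obtain ⟨x, hx, y, hy, h⟩ := hosc 0 a b h1
      refine ⟨x, hx, y, hy, ?_⟩
      simp only [hA] at h; norm_num at h; exact h
    · right
      have h1 : s (k+1) ≤ b - a := by have := Nat.find_spec hex; rwa [hk] at this
      have h2 : b - a < s k := by
        have := Nat.find_min hex (m := k) (by omega)
        exact not_le.1 this
      refine ⟨A (k+1) / 3, by have := hApos (k+1); positivity, ?_, hosc (k+1) a b h1⟩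
      have := h2.trans_le (min_le_left _ _)
      linarith

end PureMix

open Set Topology
set_option linter.unusedSectionVars false
set_option linter.unusedVariables false

namespace PureMix

section HM
variable {X : Type*} [MetricSpace X]

/-- `x, y` lie in a common connected open set of small diameter. -/
def Rel (ε : ℝ) (x y : X) : Prop :=
  ∃ C : Set X, IsOpen C ∧ IsPreconnected C ∧ x ∈ C ∧ y ∈ C ∧ ∀ z ∈ C, ∀ z' ∈ C, dist z z' ≤ ε

lemma Rel.symm {ε : ℝ} {x y : X} (h : Rel ε x y) : Rel ε y x := by
  obtain ⟨C, h1, h2, h3, h4, h5⟩ := h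
  exact ⟨C, h1, h2, h4, h3, h5⟩

lemma rel_nhds [LocallyConnectedSpace X] {ε : ℝ} (hε : 0 < ε) (x : X) : ∀ᶠ y in 𝓝 x, Rel ε x y := by
  have hx : x ∈ Metric.ball x (ε/2) := Metric.mem_ball_self (by positivity)
  have ho : IsOpen (connectedComponentIn (Metric.ball x (ε/2)) x) :=
    Metric.isOpen_ball.connectedComponentIn
  have hm := mem_connectedComponentIn hx
  filter_upwards [ho.mem_nhds hm] with y hy
  refine ⟨_, ho, isPreconnected_connectedComponentIn, hm, hy, ?_⟩
  intro z hz z' hz'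
  have h1 := connectedComponentIn_subset _ _ hz
  have h2 := connectedComponentIn_subset _ _ hz'
  rw [Metric.mem_ball] at h1 h2
  have := dist_triangle_right z z' x
  linarith

lemma rel_refl [LocallyConnectedSpace X] {ε : ℝ} (hε : 0 < ε) (x : X) : Rel ε x x :=
  (rel_nhds hε x).self_of_nhds

def Chain (δ : ℝ) (B : Set X) (m : ℕ) (x y : X) (c : ℕ → X) : Prop :=
  c 0 = x ∧ c m = y ∧ (∀ j < m, Rel δ (c j) (c (j+1))) ∧ ∀ j ≤ m, c j ∈ B

lemma Chain.concat {δ : ℝ} {B : Set X} {m m' : ℕ} {x y z : X} {c c' : ℕ → X}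
    (h : Chain δ B m x y c) (h' : Chain δ B m' y z c') :
    ∃ c'', Chain δ B (m + m') x z c'' ∧ (∀ j ≤ m, c'' j = c j) ∧ ∀ j ≤ m', c'' (m + j) = c' j := by
  obtain ⟨h1, h2, h3, h4⟩ := h
  obtain ⟨h1', h2', h3', h4'⟩ := h'
  let c'' : ℕ → X := fun j => if j ≤ m then c j else c' (j - m)
  have e1 : ∀ j ≤ m, c'' j = c j := fun j hj => if_pos hj
  have e2 : ∀ j ≤ m', c'' (m + j) = c' j := by
    intro j hj
    rcases Nat.eq_zero_or_pos j with rfl | hj0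
    · rw [e1 _ (by simp), h1']; simpa using h2
    · simp only [c'']
      rw [if_neg (by omega)]; congr 1; omega
  refine ⟨c'', ⟨by rw [e1 _ (by omega), h1], by rw [e2 _ le_rfl, h2'], ?_, ?_⟩, e1, e2⟩
  · intro j hj
    rcases lt_or_ge j m with hm | hm
    · rw [e1 _ hm.le, e1 _ hm]; exact h3 j hm
    · obtain ⟨i, rfl⟩ := Nat.exists_eq_add_of_le hm
      rw [e2 i (by omega), add_assoc, e2 (i+1) (by omega)]
      exact h3' i (by omega)
  · intro j hj
    rcases le_total j m with hm | hm
    · rw [e1 _ hm]; exact h4 j hm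
    · obtain ⟨i, rfl⟩ := Nat.exists_eq_add_of_le hm
      rw [e2 i (by omega)]; exact h4' i (by omega)

lemma chain_exists [LocallyConnectedSpace X] {δ : ℝ} (hδ : 0 < δ) {C : Set X} (hC : IsOpen C)
    (hC' : IsPreconnected C) {x y : X} (hx : x ∈ C) (hy : y ∈ C) :
    ∃ m c, Chain δ C m x y c := by
  refine hC'.induction₂' (fun x y => x ∈ C → y ∈ C → ∃ m c, Chain δ C m x y c) ?_ ?_ hx hy hx hy
  · intro x hx
    filter_upwards [mem_nhdsWithin_of_mem_nhds (rel_nhds hδ x), self_mem_nhdsWithin] with y hy hyC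
    have key : ∀ x y : X, x ∈ C → y ∈ C → Rel δ x y → ∃ m c, Chain δ C m x y c := by
      intro x y hx hy h
      refine ⟨1, fun j => if j = 0 then x else y, by simp, by simp, ?_, ?_⟩
      · intro j hj
        have : j = 0 := by omega
        subst this; simpa using h
      · intro j _
        dsimp only
        split_ifs <;> assumption
    exact ⟨fun a b => key _ _ a b hy, fun a b => key _ _ a b hy.symm⟩
  · intro x y z hx hy hz h1 h2 _ _
    obtain ⟨m, c, h⟩ := h1 hx hy
    obtain ⟨m', c', h'⟩ := h2 hy hz
    obtain ⟨c'', h'', -⟩ := h.concat h'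
    exact ⟨_, c'', h''⟩

lemma Chain.mono {δ : ℝ} {B B' : Set X} {m : ℕ} {x y : X} {c : ℕ → X}
    (h : Chain δ B m x y c) (hB : B ⊆ B') : Chain δ B' m x y c :=
  ⟨h.1, h.2.1, h.2.2.1, fun j hj => hB (h.2.2.2 j hj)⟩

lemma chain_visit [LocallyConnectedSpace X] {δ ε : ℝ} (hδ : 0 < δ) {x y : X} (hxy : Rel ε x y)
    (G : Set X) (hG : G.Finite) (hGx : ∀ z ∈ G, Rel ε x z) :
    ∀ᶠ m : ℕ in Filter.atTop, ∃ c, Chain δ (Metric.closedBall x ε) m x y c ∧ ∀ z ∈ G, ∃ j < m, c j = z := by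
  have hloop : ∀ z, Rel ε x z → (∃ m c, Chain δ (Metric.closedBall x ε) m x z c) ∧
      (∃ m c, Chain δ (Metric.closedBall x ε) m z x c) := by
    rintro z ⟨C, h1, h2, h3, h4, h5⟩
    have hs : C ⊆ Metric.closedBall x ε := fun w hw => Metric.mem_closedBall.2 (h5 w hw x h3)
    obtain ⟨m, c, h⟩ := chain_exists hδ h1 h2 h3 h4
    obtain ⟨m', c', h'⟩ := chain_exists hδ h1 h2 h4 h3
    exact ⟨⟨m, c, h.mono hs⟩, ⟨m', c', h'.mono hs⟩⟩
  have main : ∃ m c, Chain δ (Metric.closedBall x ε) m x y c ∧ ∀ z ∈ G, ∃ j ≤ m, c j = z := by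
    induction G, hG using Set.Finite.induction_on with
    | empty => obtain ⟨m, c, h⟩ := (hloop y hxy).1; exact ⟨m, c, h, by simp⟩
    | @insert z G _ _ ih =>
      obtain ⟨m, c, h, hv⟩ := ih (fun z hz => hGx z (mem_insert_of_mem _ hz))
      obtain ⟨⟨m1, c1, h1⟩, ⟨m2, c2, h2⟩⟩ := hloop z (hGx z (mem_insert _ _))
      obtain ⟨c3, h3, e3, f3⟩ := h1.concat h2
      obtain ⟨c4, h4, e4, f4⟩ := h3.concat h
      refine ⟨_, c4, h4, ?_⟩
      intro z' hz'
      rcases hz' with rfl | hz'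
      · exact ⟨m1, by omega, by rw [e4 _ (by omega), e3 _ le_rfl, h1.2.1]⟩
      · obtain ⟨j, hj, hjz⟩ := hv z' hz'
        exact ⟨m1 + m2 + j, by omega, by rw [f4 j hj, hjz]⟩
  obtain ⟨m, c, h, hv⟩ := main
  filter_upwards [Filter.eventually_gt_atTop m] with m' hm'
  have hyB : y ∈ Metric.closedBall x ε := by have := h.2.2.2 m le_rfl; rwa [h.2.1] at this
  have hc : Chain δ (Metric.closedBall x ε) (m' - m) y y (fun _ => y) :=
    ⟨rfl, rfl, fun _ _ => rel_refl hδ y, fun _ _ => hyB⟩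
  obtain ⟨c', h', e', -⟩ := h.concat hc
  have : m + (m' - m) = m' := by omega
  rw [this] at h'
  refine ⟨c', h', fun z hz => ?_⟩
  obtain ⟨j, hj, hjz⟩ := hv z hz
  exact ⟨j, by omega, by rw [e' j hj, hjz]⟩

lemma exists_seq_dep {S : Type*} (P : ℕ → S → Prop) (Q : ℕ → S → S → Prop) (h0 : ∃ s, P 0 s)
    (h : ∀ k s, P k s → ∃ s', P (k+1) s' ∧ Q k s s') :
    ∃ f : ℕ → S, (∀ k, P k (f k)) ∧ ∀ k, Q k (f k) (f (k+1)) := by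
  obtain ⟨s0, hs0⟩ := h0
  choose! nx hnx hq using h
  let f : ℕ → S := fun k => Nat.rec s0 (fun k s => nx k s) k
  have hf : ∀ k, P k (f k) := by
    intro k
    induction k with
    | zero => exact hs0
    | succ k ih => exact hnx k _ ih
  exact ⟨f, hf, fun k => hq k _ (hf k)⟩

variable [CompactSpace X] [ConnectedSpace X] [LocallyConnectedSpace X] [Nontrivial X]

def HInv (E : ℕ → ℝ) (k : ℕ) (s : ℕ × (ℤ → X)) : Prop :=
  0 < s.1 ∧ (range s.2).Finite ∧ (∀ i, Rel (E k) (s.2 i) (s.2 (i+1))) ∧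
    ∀ z, ∃ i : ℤ, 0 ≤ i ∧ i < s.1 ∧ Rel (E k) (s.2 i) z

def HStep (E : ℕ → ℝ) (k : ℕ) (s s' : ℕ × (ℤ → X)) : Prop :=
  ∃ M : ℕ, 2 ≤ M ∧ s'.1 = s.1 * M ∧ (∀ i, s'.2 (M * i) = s.2 i) ∧
    (∀ i j : ℤ, 0 ≤ j → j < M → dist (s.2 i) (s'.2 (M * i + j)) ≤ E k) ∧
    ∀ i : ℤ, ∃ j : ℤ, 0 ≤ j ∧ j < M ∧ s'.2 (M * i + j) ≠ s.2 i

lemma finite_net {ε : ℝ} (hε : 0 < ε) : ∃ F : Set X, F.Finite ∧ ∀ z, ∃ y ∈ F, Rel ε y z := by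
  obtain ⟨t, -, ht⟩ := isCompact_univ.elim_nhds_subcover (fun x => {y : X | Rel ε x y})
    (fun x _ => rel_nhds hε x)
  refine ⟨t, t.finite_toSet, fun z => ?_⟩
  have := ht (mem_univ z)
  simp only [mem_iUnion] at this
  obtain ⟨y, hy, h⟩ := this
  exact ⟨y, hy, h⟩

lemma exists_rel_ne {ε : ℝ} (hε : 0 < ε) (x : X) : ∃ z, z ≠ x ∧ Rel ε x z := by
  have h : (𝓝[≠] x).NeBot := inferInstance
  have h1 : ∀ᶠ y in 𝓝[≠] x, Rel ε x y := mem_nhdsWithin_of_mem_nhds (rel_nhds hε x)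
  have h2 : ∀ᶠ y in 𝓝[≠] x, y ∈ ({x}ᶜ : Set X) := self_mem_nhdsWithin
  obtain ⟨z, hz, hz'⟩ := (h1.and h2).exists
  exact ⟨z, hz', hz⟩

lemma hstep (E : ℕ → ℝ) (hE : ∀ k, 0 < E k) (k : ℕ) (s : ℕ × (ℤ → X)) (hs : HInv E k s) :
    ∃ s', HInv E (k+1) s' ∧ HStep E k s s' := by
  obtain ⟨N, ψ⟩ := s
  obtain ⟨hN, hfin, hrel, hcov⟩ := hs
  simp only at hN hfin hrel hcov
  obtain ⟨F, hF, hFz⟩ := finite_net (X := X) (hE (k+1))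
  choose z hzne hzrel using fun x : X => exists_rel_ne (hE k) x
  let G : X → Set X := fun x => insert (z x) (F ∩ {y | Rel (E k) x y})
  have hGf : ∀ x, (G x).Finite := fun x => (hF.inter_of_left _).insert _
  have hGr : ∀ x, ∀ y ∈ G x, Rel (E k) x y := by
    intro x y hy
    rcases hy with rfl | hy
    · exact hzrel x
    · exact hy.2
  have hev : ∀ᶠ m : ℕ in Filter.atTop, ∀ xy ∈ range ψ ×ˢ range ψ, Rel (E k) xy.1 xy.2 →
      ∃ c, Chain (E (k+1)) (Metric.closedBall xy.1 (E k)) m xy.1 xy.2 c ∧ ∀ z ∈ G xy.1, ∃ j < m, c j = z := by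
    rw [Filter.eventually_all_finite (hfin.prod hfin)]
    intro xy _
    by_cases h : Rel (E k) xy.1 xy.2
    · filter_upwards [chain_visit (hE (k+1)) h (G xy.1) (hGf _) (hGr _)] with m hm _ using hm
    · exact Filter.Eventually.of_forall (fun m h' => absurd h' h)
  obtain ⟨M, hM, hM2⟩ := (hev.and (Filter.eventually_ge_atTop 2)).exists
  have hM' : ∀ i : ℤ, ∃ c, Chain (E (k+1)) (Metric.closedBall (ψ i) (E k)) M (ψ i) (ψ (i+1)) c ∧
      ∀ z ∈ G (ψ i), ∃ j < M, c j = z := fun i =>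
    hM (ψ i, ψ (i+1)) ⟨mem_range_self _, mem_range_self _⟩ (hrel i)
  -- choose depending only on the pair
  have hM'' : ∀ xy : X × X, ∃ c : ℕ → X, (xy ∈ range ψ ×ˢ range ψ → Rel (E k) xy.1 xy.2 →
      Chain (E (k+1)) (Metric.closedBall xy.1 (E k)) M xy.1 xy.2 c ∧ ∀ z ∈ G xy.1, ∃ j < M, c j = z) := by
    intro xy
    by_cases h : xy ∈ range ψ ×ˢ range ψ ∧ Rel (E k) xy.1 xy.2
    · obtain ⟨c, hc⟩ := hM xy h.1 h.2
      exact ⟨c, fun _ _ => hc⟩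
    · exact ⟨fun _ => xy.1, fun h1 h2 => absurd ⟨h1, h2⟩ h⟩
  choose c hc using hM''
  have hci : ∀ i : ℤ, Chain (E (k+1)) (Metric.closedBall (ψ i) (E k)) M (ψ i) (ψ (i+1)) (c (ψ i, ψ (i+1))) ∧
      ∀ z ∈ G (ψ i), ∃ j < M, (c (ψ i, ψ (i+1))) j = z := fun i =>
    hc (ψ i, ψ (i+1)) ⟨mem_range_self _, mem_range_self _⟩ (hrel i)
  have hM0 : (0:ℤ) < M := by omega
  let ψ' : ℤ → X := fun a => c (ψ (a / M), ψ (a / M + 1)) (a % M).toNat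
  have hψ' : ∀ (i : ℤ) (j : ℕ), j < M → ψ' (M * i + j) = c (ψ i, ψ (i+1)) j := by
    intro i j hj
    have e1 : ((M:ℤ) * i + j) / M = i := by
      rw [Int.add_comm, Int.add_mul_ediv_left _ _ (by omega), Int.ediv_eq_zero_of_lt (by omega) (by omega)]
      simp
    have e2 : ((M:ℤ) * i + j) % M = j := by
      rw [Int.add_comm, Int.add_mul_emod_self_left, Int.emod_eq_of_lt (by omega) (by omega)]
    simp only [ψ', e1, e2, Int.toNat_natCast]
  have hψ0 : ∀ i : ℤ, ψ' (M * i) = ψ i := by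
    intro i
    have := hψ' i 0 (by omega)
    simp only [Nat.cast_zero, add_zero] at this
    rw [this, (hci i).1.1]
  have hψM : ∀ (i : ℤ) (j : ℕ), j ≤ M → ψ' (M * i + j) = c (ψ i, ψ (i+1)) j := by
    intro i j hj
    rcases hj.lt_or_eq with hj | rfl
    · exact hψ' i j hj
    · have : ((j:ℤ) * i + j) = j * (i + 1) := by ring
      rw [this, hψ0, (hci i).1.2.1]
  have hdec : ∀ a : ℤ, ∃ (i : ℤ) (j : ℕ), j < M ∧ a = M * i + j := by
    intro a
    refine ⟨a / M, (a % M).toNat, ?_, ?_⟩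
    · have := Int.emod_lt_of_pos a hM0
      have := Int.emod_nonneg a hM0.ne'
      omega
    · rw [Int.toNat_of_nonneg (Int.emod_nonneg a hM0.ne')]
      exact (Int.mul_ediv_add_emod a M).symm
  refine ⟨(N * M, ψ'), ⟨by positivity, ?_, ?_, ?_⟩, ⟨M, hM2, rfl, hψ0, ?_, ?_⟩⟩
  · refine Set.Finite.subset (((hfin.prod hfin).prod (Set.finite_lt_nat M)).image
      (fun q : (X × X) × ℕ => c q.1 q.2)) ?_
    rintro _ ⟨a, rfl⟩
    obtain ⟨i, j, hj, rfl⟩ := hdec a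
    exact ⟨((ψ i, ψ (i+1)), j), ⟨⟨mem_range_self _, mem_range_self _⟩, hj⟩, (hψ' i j hj).symm⟩
  · intro a
    obtain ⟨i, j, hj, rfl⟩ := hdec a
    have e : (M:ℤ) * i + j + 1 = M * i + (j + 1 : ℕ) := by push_cast; ring
    simp only
    rw [e, hψ' i j hj, hψM i (j+1) hj]
    exact (hci i).1.2.2.1 j hj
  · intro w
    obtain ⟨y, hy, hyw⟩ := hFz w
    obtain ⟨i, hi0, hiN, hi⟩ := hcov y
    obtain ⟨j, hj, hjy⟩ := (hci i).2 y (mem_insert_of_mem _ ⟨hy, hi⟩)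
    refine ⟨M * i + j, by positivity, ?_, ?_⟩
    · have h1 : i + 1 ≤ N := by omega
      have h2 : (M:ℤ) * (i+1) ≤ M * N := mul_le_mul_of_nonneg_left h1 hM0.le
      push_cast
      have : (j:ℤ) < M := by exact_mod_cast hj
      nlinarith
    · simp only
      rw [hψ' i j hj, hjy]; exact hyw
  · intro i j hj0 hjM
    lift j to ℕ using hj0
    have hj : j < M := by exact_mod_cast hjM
    simp only
    rw [hψ' i j hj, dist_comm]
    exact (hci i).1.2.2.2 j hj.le
  · intro i
    obtain ⟨j, hj, hjy⟩ := (hci i).2 (z (ψ i)) (mem_insert _ _)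
    refine ⟨j, by positivity, by exact_mod_cast hj, ?_⟩
    simp only
    rw [hψ' i j hj, hjy]
    exact hzne _

variable (X) in
/-- Hahn–Mazurkiewicz with a nowhere constant parametrization. -/
theorem hahn_mazurkiewicz : ∃ Ψ : ℝ → X, Continuous Ψ ∧ (∀ x, ∃ t ∈ Icc (0:ℝ) 1, Ψ t = x) ∧
    ∀ a b : ℝ, a < b → ∃ s ∈ Icc a b, ∃ t ∈ Icc a b, Ψ s ≠ Ψ t := by
  set Dm : ℝ := Metric.diam (univ : Set X) + 1 with hDm
  have hDm0 : 0 < Dm := by have := Metric.diam_nonneg (s := (univ : Set X)); linarith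
  set E : ℕ → ℝ := fun k => (2 * Dm) / 2 / 2 ^ k with hE
  have hE0 : ∀ k, 0 < E k := fun k => by positivity
  have hstart : ∃ s : ℕ × (ℤ → X), HInv E 0 s := by
    obtain ⟨x0⟩ : Nonempty X := inferInstance
    have hr : ∀ x y : X, Rel (E 0) x y := fun x y =>
      ⟨univ, isOpen_univ, isPreconnected_univ, mem_univ _, mem_univ _, fun z _ z' _ => by
        have := Metric.dist_le_diam_of_mem (isCompact_univ (X := X)).isBounded (mem_univ z) (mem_univ z')
        simp only [hE]; simp; linarith⟩
    exact ⟨(1, fun _ => x0), one_pos, by simp, fun _ => hr _ _, fun z => ⟨0, le_rfl, by simp, hr _ _⟩⟩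
  obtain ⟨f, hf, hq⟩ := exists_seq_dep (HInv E) (HStep E) hstart (fun k s hs => hstep E hE0 k s hs)
  set N : ℕ → ℕ := fun k => (f k).1 with hN
  set ψ : ℕ → ℤ → X := fun k => (f k).2 with hψ
  have hN0 : ∀ k, (0:ℝ) < N k := fun k => by exact_mod_cast (hf k).1
  choose M hM2 hMN hM0 hMd hMn using hq
  have hNM : ∀ k, (N (k+1) : ℝ) = N k * M k := fun k => by
    have := hMN k
    simp only [hN]; rw [this]; push_cast; ring
  have hNbig : ∀ k, (2:ℝ) ^ k ≤ N k := by
    intro k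
    induction k with
    | zero => have : 1 ≤ N 0 := (hf 0).1
              simpa using this
    | succ k ih =>
      rw [hNM, pow_succ]
      have : (2:ℝ) ≤ M k := by exact_mod_cast hM2 k
      have := hN0 k
      gcongr
  let Φ : ℕ → ℝ → X := fun k t => ψ k ⌊N k * t⌋
  have hfloor : ∀ k t, ∃ j : ℤ, 0 ≤ j ∧ j < M k ∧ ⌊(N (k+1) : ℝ) * t⌋ = M k * ⌊(N k : ℝ) * t⌋ + j := by
    intro k t
    have hMp : (0:ℝ) < M k := by have := hM2 k; positivity
    refine ⟨⌊(N (k+1) : ℝ) * t⌋ - M k * ⌊(N k : ℝ) * t⌋, ?_, ?_, by ring⟩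
    · rw [sub_nonneg, Int.le_floor, hNM]
      push_cast
      have := Int.floor_le ((N k : ℝ) * t)
      nlinarith
    · rw [sub_lt_iff_lt_add, Int.floor_lt, hNM]
      push_cast
      have := Int.lt_floor_add_one ((N k : ℝ) * t)
      nlinarith
  have hΦ : ∀ t k, dist (Φ k t) (Φ (k+1) t) ≤ 2 * Dm / 2 / 2 ^ k := by
    intro t k
    obtain ⟨j, h0, h1, h2⟩ := hfloor k t
    simp only [Φ]; rw [h2]
    exact hMd k _ j h0 h1
  have hlim : ∀ t, ∃ x, Filter.Tendsto (fun k => Φ k t) Filter.atTop (𝓝 x) := fun t =>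
    cauchySeq_tendsto_of_complete (cauchySeq_of_le_geometric_two (hΦ t))
  choose Ψ hΨ using hlim
  have hd : ∀ t k, dist (Φ k t) (Ψ t) ≤ 2 * Dm / 2 ^ k := fun t k =>
    dist_le_of_le_geometric_two_of_tendsto (hΦ t) (hΨ t) k
  have hgrid : ∀ k (i : ℤ), Ψ (i / N k) = ψ k i := by
    intro k i
    have : ∀ m, Φ (k + m) (i / N k) = ψ k i ∧ ∃ q : ℤ, (N (k+m) : ℝ) * (i / N k) = q := by
      intro m
      induction m with
      | zero =>
        have e : (N k : ℝ) * (i / N k) = i := mul_div_cancel₀ _ (hN0 k).ne'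
        refine ⟨?_, i, by simpa using e⟩
        simp only [Φ, add_zero]; rw [e, Int.floor_intCast]
      | succ m ih =>
        obtain ⟨h1, q, hq⟩ := ih
        have e : (N (k+(m+1)) : ℝ) * (i / N k) = ((M (k+m) * q : ℤ) : ℝ) := by
          rw [← add_assoc, hNM]; push_cast; rw [← hq]; ring
        refine ⟨?_, _, e⟩
        simp only [Φ] at h1 ⊢
        rw [e, Int.floor_intCast]
        rw [hq, Int.floor_intCast] at h1
        rw [← h1]
        exact hM0 (k+m) q
    have ht := (hΨ (i / N k)).comp (Filter.tendsto_add_atTop_nat k)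
    refine tendsto_nhds_unique ht ?_
    refine tendsto_const_nhds.congr (fun m => ?_)
    simp only [Function.comp]
    rw [add_comm]; exact (this m).1.symm
  have hsmall : ∀ ε > 0, ∃ k : ℕ, 5 * Dm / 2 ^ k < ε := by
    intro ε hε
    obtain ⟨k, hk⟩ := exists_pow_lt_of_lt_one (show 0 < ε / (5 * Dm) by positivity)
      (by norm_num : (1/2:ℝ) < 1)
    refine ⟨k, ?_⟩
    rw [lt_div_iff₀ (by positivity)] at hk
    rw [one_div, inv_pow] at hk
    rw [div_eq_mul_inv]; linarith
  have hcont : Continuous Ψ := by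
    rw [Metric.continuous_iff]
    intro t ε hε
    obtain ⟨k, hk⟩ := hsmall ε hε
    refine ⟨1 / N k, by have := hN0 k; positivity, fun s hs => ?_⟩
    have h1 : dist (Φ k s) (Φ k t) ≤ E k := by
      simp only [Φ]
      have hst : |(N k:ℝ) * s - N k * t| < 1 := by
        rw [← mul_sub, abs_mul, abs_of_pos (hN0 k)]
        rw [Real.dist_eq, lt_div_iff₀ (hN0 k)] at hs
        linarith
      rw [abs_lt] at hst
      have a1 := Int.floor_le ((N k:ℝ) * s)
      have a2 := Int.lt_floor_add_one ((N k:ℝ) * s)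
      have a3 := Int.floor_le ((N k:ℝ) * t)
      have a4 := Int.lt_floor_add_one ((N k:ℝ) * t)
      have b1 : ⌊(N k:ℝ) * s⌋ < ⌊(N k:ℝ) * t⌋ + 2 := by
        have : (⌊(N k:ℝ) * s⌋ : ℝ) < ⌊(N k:ℝ) * t⌋ + 2 := by linarith
        exact_mod_cast this
      have b2 : ⌊(N k:ℝ) * t⌋ < ⌊(N k:ℝ) * s⌋ + 2 := by
        have : (⌊(N k:ℝ) * t⌋ : ℝ) < ⌊(N k:ℝ) * s⌋ + 2 := by linarith
        exact_mod_cast this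
      have hr := (hf k).2.2.1
      have hrd : ∀ i, dist (ψ k i) (ψ k (i+1)) ≤ E k := by
        intro i
        obtain ⟨C, _, _, h3, h4, h5⟩ := hr i
        exact h5 _ h3 _ h4
      obtain h | h | h : ⌊(N k:ℝ) * s⌋ = ⌊(N k:ℝ) * t⌋ ∨ ⌊(N k:ℝ) * s⌋ = ⌊(N k:ℝ) * t⌋ + 1 ∨
        ⌊(N k:ℝ) * t⌋ = ⌊(N k:ℝ) * s⌋ + 1 := by omega
      · rw [h, dist_self]; exact (hE0 k).le
      · rw [h, dist_comm]; exact hrd _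
      · rw [h]; exact hrd _
    have h2 := hd s k
    have h3 := hd t k
    have h4 := dist_triangle4 (Ψ s) (Φ k s) (Φ k t) (Ψ t)
    rw [dist_comm (Ψ s) (Φ k s)] at h4
    have h5 : E k = Dm / 2 ^ k := by simp only [hE]; ring
    rw [h5] at h1
    have h6 : 5 * Dm / 2 ^ k = 2 * Dm / 2 ^ k + Dm / 2^k + 2 * Dm / 2^k := by ring
    linarith
  refine ⟨Ψ, hcont, ?_, ?_⟩
  · intro x
    have hcl : IsClosed (Ψ '' Icc (0:ℝ) 1) := (isCompact_Icc.image hcont).isClosed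
    have : x ∈ closure (Ψ '' Icc (0:ℝ) 1) := by
      rw [Metric.mem_closure_iff]
      intro ε hε
      obtain ⟨k, hk⟩ := hsmall ε hε
      obtain ⟨i, hi0, hiN, C, _, _, h3, h4, h5⟩ := (hf k).2.2.2 x
      refine ⟨ψ k i, ⟨i / N k, ⟨?_, ?_⟩, hgrid k i⟩, ?_⟩
      · have := hN0 k
        have : (0:ℝ) ≤ i := by exact_mod_cast hi0
        positivity
      · rw [div_le_one (hN0 k)]; exact_mod_cast hiN.le
      · have := h5 _ h4 _ h3
        have h5 : E k = Dm / 2 ^ k := by simp only [hE]; ring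
        have h6 : Dm / 2^k ≤ 5 * Dm / 2 ^ k := by gcongr; linarith
        have h7 : dist x (ψ k i) ≤ E k := this
        linarith
    rw [hcl.closure_eq] at this
    obtain ⟨t, ht, h⟩ := this
    exact ⟨t, ht, h⟩
  · intro a b hab
    obtain ⟨k, hk⟩ := exists_pow_lt_of_lt_one (show 0 < (b - a) / 2 by linarith)
      (by norm_num : (1/2:ℝ) < 1)
    have hNk : 1 / (N k : ℝ) < (b - a) / 2 := by
      refine lt_of_le_of_lt ?_ hk
      rw [one_div_pow]
      exact one_div_le_one_div_of_le (by positivity) (hNbig k)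
    have hNp := hN0 k
    rw [div_lt_iff₀ hNp] at hNk
    set i : ℤ := ⌈(N k:ℝ) * a⌉ with hi
    have hi1 : N k * a ≤ i := Int.le_ceil _
    have hi2 : (i:ℝ) < N k * a + 1 := Int.ceil_lt_add_one _
    obtain ⟨j, hj0, hjM, hj⟩ := hMn k i
    have hNp' := hN0 (k+1)
    have hMp : (0:ℝ) < M k := by have := hM2 k; positivity
    have hj0' : (0:ℝ) ≤ j := by exact_mod_cast hj0
    have hjM' : (j:ℝ) < M k := by exact_mod_cast hjM
    refine ⟨((M k * i + j : ℤ) : ℝ) / N (k+1), ⟨?_, ?_⟩, i / N k, ⟨?_, ?_⟩, ?_⟩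
    · rw [le_div_iff₀ hNp', hNM]; push_cast; nlinarith
    · rw [div_le_iff₀ hNp', hNM]; push_cast; nlinarith
    · rw [le_div_iff₀ hNp]; linarith
    · rw [div_le_iff₀ hNp]; nlinarith
    · rw [hgrid, hgrid]; exact hj

end HM
end PureMix

open Set Topology
set_option linter.unusedSectionVars false
set_option linter.unusedVariables false

namespace PureMix
section NC
variable {X : Type*} [MetricSpace X] [CompactSpace X] [ConnectedSpace X] [LocallyConnectedSpace X] [Nontrivial X]

/-- the complement of the component of `x0` in the complement of `q` -/
def Aq (x0 q : X) : Set X := (connectedComponentIn ({q}ᶜ) x0)ᶜ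

lemma Aq_closed (x0 q : X) : IsClosed (Aq x0 q) := by
  rw [Aq, isClosed_compl_iff]
  exact isOpen_compl_singleton.connectedComponentIn

lemma mem_Aq (x0 q : X) : q ∈ Aq x0 q := fun h => (connectedComponentIn_subset _ _ h) rfl

/-- a nonempty proper clopen-in-complement piece accumulates at the point. -/
lemma mem_closure_comp {p : X} {D : Set X} (hD : IsOpen D) (hne : D.Nonempty) (hp : p ∉ D)
    (hcl : closure D ⊆ D ∪ {p}) : p ∈ closure D := by
  by_contra h
  have : IsClosed D := by
    refine isClosed_of_closure_subset (fun x hx => ?_)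
    rcases hcl hx with h1 | h1
    · exact h1
    · rw [mem_singleton_iff] at h1; subst h1; exact absurd hx h
  have := IsClopen.eq_univ ⟨this, hD⟩ hne
  rw [this] at hp; exact hp (mem_univ _)

lemma closure_comp_subset {U : Set X} (hU : IsOpen U) (x : X) :
    closure (connectedComponentIn U x) ∩ U ⊆ connectedComponentIn U x := by
  rintro y ⟨hy, hyU⟩
  have ho : IsOpen (connectedComponentIn U y) := hU.connectedComponentIn
  obtain ⟨z, hz1, hz2⟩ := mem_closure_iff.1 hy _ ho (mem_connectedComponentIn hyU)
  have := mem_connectedComponentIn hyU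
  rwa [connectedComponentIn_eq hz1, ← connectedComponentIn_eq hz2] at this

lemma Aq_lt {x0 q r : X} (hq : q ≠ x0) (hr : r ∈ Aq x0 q) (hrq : r ≠ q) :
    Aq x0 r ⊆ Aq x0 q \ {q} := by
  set W := connectedComponentIn ({q}ᶜ) x0 with hW
  have hx0 : x0 ∈ ({q}ᶜ : Set X) := fun h => hq h.symm
  have hx0W : x0 ∈ W := mem_connectedComponentIn hx0
  have hWo : IsOpen W := isOpen_compl_singleton.connectedComponentIn
  have hqc : q ∈ closure W := by
    refine mem_closure_comp hWo ⟨x0, hx0W⟩ (mem_Aq x0 q) ?_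
    intro x hx
    by_cases h : x = q
    · exact Or.inr h
    · exact Or.inl (closure_comp_subset isOpen_compl_singleton x0 ⟨hx, h⟩)
  have hpre : IsPreconnected (insert q W) :=
    isPreconnected_connectedComponentIn.subset_closure (subset_insert _ _)
      (insert_subset hqc subset_closure)
  have hsub : insert q W ⊆ ({r}ᶜ : Set X) := by
    rintro x (rfl | hx)
    · exact fun h => hrq h.symm
    · rintro h; rw [mem_singleton_iff] at h; subst h; exact hr hx
  have := hpre.subset_connectedComponentIn (mem_insert_of_mem _ hx0W) hsub
  intro y hy
  refine ⟨fun h => hy (this (mem_insert_of_mem _ h)), fun h => hy (this ?_)⟩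
  rw [mem_singleton_iff] at h; rw [h]; exact mem_insert _ _

variable (X) in
theorem exists_noncut : ∃ p : X, IsPreconnected ({p}ᶜ : Set X) := by
  obtain ⟨x0, x1, h01⟩ := exists_pair_ne X
  have H : ∀ c ⊆ {A : Set X | ∃ q, q ≠ x0 ∧ A = Aq x0 q}, IsChain (· ⊆ ·) c → c.Nonempty →
      ∃ lb ∈ {A : Set X | ∃ q, q ≠ x0 ∧ A = Aq x0 q}, ∀ s ∈ c, lb ⊆ s := by
    intro c hc hchain hcne
    have hcl : ∀ A ∈ c, IsClosed A := by
      intro A hA; obtain ⟨q, _, rfl⟩ := hc hA; exact Aq_closed _ _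
    have hdir : DirectedOn (· ⊇ ·) c := by
      intro A hA B hB
      rcases hchain.total hA hB with h | h
      · exact ⟨A, hA, Subset.rfl, h⟩
      · exact ⟨B, hB, h, Subset.rfl⟩
    have hne : (⋂₀ c).Nonempty := by
      refine @IsCompact.nonempty_sInter_of_directed_nonempty_isCompact_isClosed _ _ c hcne.to_subtype
        hdir ?_ (fun A hA => (hcl A hA).isCompact) hcl
      intro A hA; obtain ⟨q, _, rfl⟩ := hc hA; exact ⟨q, mem_Aq _ _⟩
    obtain ⟨r, hr⟩ := hne
    have hrx : r ≠ x0 := by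
      rintro rfl
      obtain ⟨A, hA⟩ := hcne
      obtain ⟨q, hq, rfl⟩ := hc hA
      exact (hr _ hA) (mem_connectedComponentIn (fun h => hq h.symm))
    refine ⟨Aq x0 r, ⟨r, hrx, rfl⟩, fun A hA => ?_⟩
    obtain ⟨q, hq, rfl⟩ := hc hA
    by_cases h : r = q
    · subst h; exact Subset.rfl
    · exact (Aq_lt hq (hr _ hA) h).trans sdiff_subset
  obtain ⟨m, hm⟩ := zorn_superset_nonempty {A : Set X | ∃ q, q ≠ x0 ∧ A = Aq x0 q} H (Aq x0 x1) ⟨x1, h01.symm, rfl⟩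
  · obtain ⟨-, ⟨q, hq, rfl⟩, hmin⟩ := hm
    refine ⟨q, ?_⟩
    have hx0 : x0 ∈ ({q}ᶜ : Set X) := fun h => hq h.symm
    suffices h : ({q}ᶜ : Set X) = connectedComponentIn ({q}ᶜ) x0 by
      rw [h]; exact isPreconnected_connectedComponentIn
    refine Subset.antisymm (fun r hr => ?_) (connectedComponentIn_subset _ _)
    by_contra hrA
    have hlt := Aq_lt hq hrA hr
    have hrx : r ≠ x0 := by rintro rfl; exact hrA (mem_connectedComponentIn hx0)
    have := hmin ⟨r, hrx, rfl⟩ (hlt.trans sdiff_subset) (mem_Aq x0 q)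
    exact (hlt this).2 rfl
end NC
end PureMix

open Set Topology
set_option linter.unusedSectionVars false
set_option linter.unusedVariables false

namespace PureMix
section BF
variable {X : Type*} [MetricSpace X] [CompactSpace X]

theorem exists_f (p : X) (Ψ : ℝ → X) (hΨ : ∀ a b : ℝ, a < b → ∃ s ∈ Icc a b, ∃ t ∈ Icc a b, Ψ s ≠ Ψ t) :
    ∃ f : X → ℝ, Continuous f ∧ (∀ x, 0 ≤ f x) ∧ (∀ x, f x = 0 ↔ x = p) ∧
      ∀ a b : ℝ, a < b → ∃ s ∈ Icc a b, ∃ t ∈ Icc a b, f (Ψ s) ≠ f (Ψ t) := by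
  let F : C(X, ℝ) → X → ℝ := fun φ x => dist x p * Real.exp (φ x)
  have hF0 : ∀ φ x, F φ x = 0 ↔ x = p := by
    intro φ x; simp [F, (Real.exp_pos _).ne']
  have hcont : ∀ x, Continuous (fun φ => F φ x) := by
    intro x
    have : Continuous (fun φ : C(X, ℝ) => φ x) := by fun_prop
    exact continuous_const.mul (Real.continuous_exp.comp this)
  let U : ℚ × ℚ → Set C(X, ℝ) := fun q => {φ | (q.1:ℝ) < q.2 → ∃ s ∈ Icc (q.1:ℝ) q.2, ∃ t ∈ Icc (q.1:ℝ) q.2, F φ (Ψ s) ≠ F φ (Ψ t)}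
  have hUo : ∀ q, IsOpen (U q) := by
    intro q
    by_cases hq : (q.1:ℝ) < q.2
    · have : U q = ⋃ s ∈ Icc (q.1:ℝ) q.2, ⋃ t ∈ Icc (q.1:ℝ) q.2, {φ | F φ (Ψ s) ≠ F φ (Ψ t)} := by
        ext φ; simp only [U, hq, true_imp_iff, mem_ofPred_eq, mem_iUnion, exists_prop]
      rw [this]
      exact isOpen_biUnion fun s _ => isOpen_biUnion fun t _ => isOpen_ne_fun (hcont _) (hcont _)
    · have : U q = univ := by ext φ; simp only [U, hq, false_imp_iff, mem_ofPred_eq, mem_univ]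
      rw [this]; exact isOpen_univ
  have hUd : ∀ q, Dense (U q) := by
    intro q φ
    by_cases hφ : φ ∈ U q
    · exact subset_closure hφ
    have hφ' : (q.1:ℝ) < q.2 ∧ ∀ s ∈ Icc (q.1:ℝ) q.2, ∀ t ∈ Icc (q.1:ℝ) q.2, F φ (Ψ s) = F φ (Ψ t) := by
      simp only [U, mem_ofPred_eq] at hφ
      push Not at hφ
      exact hφ
    obtain ⟨hq, hc⟩ := hφ'
    obtain ⟨s, hs, t, ht, hst⟩ := hΨ _ _ hq
    let g : C(X, ℝ) := ⟨fun x => dist x (Ψ s), by fun_prop⟩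
    have hlim : Filter.Tendsto (fun ε : ℝ => φ + ε • g) (𝓝[>] 0) (𝓝 φ) := by
      have : Continuous (fun ε : ℝ => φ + ε • g) := by fun_prop
      have := this.tendsto 0
      simp only [zero_smul, add_zero] at this
      exact this.mono_left nhdsWithin_le_nhds
    refine mem_closure_of_tendsto hlim ?_
    filter_upwards [self_mem_nhdsWithin] with ε hε _
    refine ⟨s, hs, t, ht, ?_⟩
    have h1 := hc s hs t ht
    have e1 : F (φ + ε • g) (Ψ s) = F φ (Ψ s) := by simp [F, g]
    have e2 : F (φ + ε • g) (Ψ t) = F φ (Ψ t) * Real.exp (ε * dist (Ψ t) (Ψ s)) := by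
      simp [F, g, Real.exp_add, mul_assoc]
    rw [e1, e2, h1]
    intro h
    have hne : F φ (Ψ t) ≠ 0 := by
      intro h0
      have h2 := (hF0 _ _).1 h0
      rw [h0] at h1
      exact hst (((hF0 _ _).1 h1).trans h2.symm)
    have h3 : Real.exp (ε * dist (Ψ t) (Ψ s)) = 1 := by
      field_simp at h; exact h.symm
    rw [Real.exp_eq_one_iff] at h3
    have : 0 < ε * dist (Ψ t) (Ψ s) := mul_pos hε (dist_pos.2 (Ne.symm hst))
    linarith
  obtain ⟨φ, hφ⟩ := (dense_iInter_of_isOpen hUo hUd).nonempty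
  rw [mem_iInter] at hφ
  refine ⟨F φ, by fun_prop, fun x => by positivity, hF0 φ, fun a b hab => ?_⟩
  obtain ⟨q1, h1, h2⟩ := exists_rat_btwn hab
  obtain ⟨q2, h3, h4⟩ := exists_rat_btwn h2
  obtain ⟨s, hs, t, ht, hst⟩ := hφ (q1, q2) h3
  exact ⟨s, ⟨h1.le.trans hs.1, hs.2.trans h4.le⟩, t, ⟨h1.le.trans ht.1, ht.2.trans h4.le⟩, hst⟩
end BF
end PureMix

open Set Topology
set_option linter.unusedSectionVars false
set_option linter.unusedVariables false

namespace PureMix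

/-- the data fixed during the construction -/
structure Setup (X : Type*) [MetricSpace X] where
  p : X
  noncut : IsPreconnected ({p}ᶜ : Set X)
  Ψ : ℝ → X
  Ψc : Continuous Ψ
  Ψs : ∀ x, ∃ t ∈ Icc (0:ℝ) 1, Ψ t = x
  f : X → ℝ
  fc : Continuous f
  f0 : ∀ x, 0 ≤ f x
  fz : ∀ x, f x = 0 ↔ x = p
  fΨ : ∀ a b : ℝ, a < b → ∃ s ∈ Icc a b, ∃ t ∈ Icc a b, f (Ψ s) ≠ f (Ψ t)

theorem exists_setup (X : Type*) [MetricSpace X] [CompactSpace X] [ConnectedSpace X]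
    [LocallyConnectedSpace X] [Nontrivial X] : Nonempty (Setup X) := by
  obtain ⟨p, hp⟩ := exists_noncut X
  obtain ⟨Ψ, h1, h2, h3⟩ := hahn_mazurkiewicz X
  obtain ⟨f, g1, g2, g3, g4⟩ := exists_f p Ψ h3
  exact ⟨⟨p, hp, Ψ, h1, h2, f, g1, g2, g3, g4⟩⟩

section GP
variable {X : Type*} [MetricSpace X] [CompactSpace X] (S : Setup X)

def Good (ψ : ℝ → X) : Prop :=
  Continuous ψ ∧ ∀ a b : ℝ, a < b → ∃ s ∈ Icc a b, ∃ t ∈ Icc a b, S.f (ψ s) ≠ S.f (ψ t)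

def NC (w : ℝ → ℝ) : Prop :=
  Continuous w ∧ ∀ a b : ℝ, a < b → ∃ s ∈ Icc a b, ∃ t ∈ Icc a b, w s < w t

lemma nc_kap : NC kap := ⟨kap_cont, fun a b h => kap_nonconst h⟩

lemma NC.image {w : ℝ → ℝ} (hw : NC w) {a b : ℝ} (hab : a < b) :
    ∃ c d, c < d ∧ ∀ v ∈ Icc c d, ∃ t ∈ Icc a b, w t = v := by
  obtain ⟨s, hs, t, ht, hst⟩ := hw.2 a b hab
  refine ⟨w s, w t, hst, fun v hv => ?_⟩
  have := (isPreconnected_Icc (a := a) (b := b)).intermediate_value hs ht hw.1.continuousOn hv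
  exact this

variable {S}

lemma Good.comp {ψ : ℝ → X} (hψ : Good S ψ) {w : ℝ → ℝ} (hw : NC w) : Good S (fun t => ψ (w t)) := by
  refine ⟨hψ.1.comp hw.1, fun a b hab => ?_⟩
  obtain ⟨c, d, hcd, h⟩ := hw.image hab
  obtain ⟨s, hs, t, ht, hst⟩ := hψ.2 c d hcd
  obtain ⟨s', hs', rfl⟩ := h s hs
  obtain ⟨t', ht', rfl⟩ := h t ht
  exact ⟨s', hs', t', ht', hst⟩

lemma nc_affine {c d : ℝ} (hd : d ≠ 0) : NC (fun t => c + d * t) := by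
  refine ⟨by fun_prop, fun a b hab => ?_⟩
  rcases hd.lt_or_gt with h | h
  · exact ⟨b, ⟨hab.le, le_rfl⟩, a, ⟨le_rfl, hab.le⟩, by dsimp only; nlinarith⟩
  · exact ⟨a, ⟨le_rfl, hab.le⟩, b, ⟨hab.le, le_rfl⟩, by dsimp only; nlinarith⟩

lemma good_Ψ (S : Setup X) : Good S S.Ψ := ⟨S.Ψc, S.fΨ⟩

/-- the segment path -/
noncomputable def seg (S : Setup X) (s t : ℝ) : ℝ → X := fun r => S.Ψ (s + (t - s) * kap r)

lemma good_seg {s t : ℝ} (h : s ≠ t) : Good S (seg S s t) := by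
  have h1 := (good_Ψ S).comp (nc_affine (c := s) (d := t - s) (sub_ne_zero.2 h.symm))
  exact h1.comp nc_kap

def GP (S : Setup X) (D : Set X) (x y : X) (ψ : ℝ → X) : Prop :=
  Good S ψ ∧ (∀ t, ψ t ∈ D) ∧ ψ 0 = x ∧ ψ 1 = y

lemma gp_seg {J : Set ℝ} (hJ : Convex ℝ J) {D : Set X} (hJD : ∀ t ∈ J, S.Ψ t ∈ D) {s t : ℝ} (hs : s ∈ J)
    (ht : t ∈ J) (hst : s ≠ t) : GP S D (S.Ψ s) (S.Ψ t) (seg S s t) := by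
  refine ⟨good_seg hst, fun r => hJD _ ?_, by simp [seg, kap_zero], by simp [seg, kap_one]⟩
  have := hJ.add_smul_sub_mem hs ht ⟨kap_nonneg r, kap_le_one r⟩
  rw [smul_eq_mul, mul_comm] at this; exact this

noncomputable def cat (ψ ψ' : ℝ → X) : ℝ → X := fun t => if t ≤ 1/2 then ψ (2 * t) else ψ' (2 * t - 1)

lemma cat_left (ψ ψ' : ℝ → X) {t : ℝ} (h : t ≤ 1/2) : cat ψ ψ' t = ψ (2 * t) := if_pos h

lemma cat_right {ψ ψ' : ℝ → X} (h0 : ψ 1 = ψ' 0) {t : ℝ} (h : 1/2 ≤ t) : cat ψ ψ' t = ψ' (2 * t - 1) := by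
  rcases h.eq_or_lt with rfl | h
  · rw [cat_left _ _ le_rfl]; norm_num [h0]
  · exact if_neg (not_le.2 h)

lemma good_cat {ψ ψ' : ℝ → X} (h : Good S ψ) (h' : Good S ψ') (h0 : ψ 1 = ψ' 0) : Good S (cat ψ ψ') := by
  refine ⟨?_, ?_⟩
  · refine Continuous.if_le (by have := h.1; fun_prop) (by have := h'.1; fun_prop) continuous_id continuous_const ?_
    intro t ht; subst ht; norm_num [h0]
  · intro a b hab
    have k1 := h.comp (nc_affine (c := 0) (d := 2) (by norm_num))
    have k2 := h'.comp (nc_affine (c := -1) (d := 2) (by norm_num))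
    rcases lt_or_ge a (1/2) with ha | ha
    · obtain ⟨s, hs, t, ht, hst⟩ := k1.2 a (min b (1/2)) (lt_min hab ha)
      have m1 := min_le_left b (1/2)
      have m2 := min_le_right b (1/2)
      refine ⟨s, ⟨hs.1, hs.2.trans m1⟩, t, ⟨ht.1, ht.2.trans m1⟩, ?_⟩
      rw [cat_left _ _ (hs.2.trans m2), cat_left _ _ (ht.2.trans m2)]
      simpa using hst
    · obtain ⟨s, hs, t, ht, hst⟩ := k2.2 a b hab
      refine ⟨s, hs, t, ht, ?_⟩
      rw [cat_right h0 (ha.trans hs.1), cat_right h0 (ha.trans ht.1)]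
      convert hst using 3 <;> ring_nf

lemma GP.cat {D : Set X} {x y z : X} {ψ ψ' : ℝ → X} (h : GP S D x y ψ) (h' : GP S D y z ψ') :
    GP S D x z (cat ψ ψ') := by
  refine ⟨good_cat h.1 h'.1 (h.2.2.2.trans h'.2.2.1.symm), ?_, ?_, ?_⟩
  · intro t; unfold PureMix.cat; split_ifs
    · exact h.2.1 _
    · exact h'.2.1 _
  · rw [cat_left _ _ (by norm_num)]; simpa using h.2.2.1
  · rw [cat_right (h.2.2.2.trans h'.2.2.1.symm) (by norm_num)]
    have := h'.2.2.2
    norm_num; exact this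

lemma GP.rev {D : Set X} {x y : X} {ψ : ℝ → X} (h : GP S D x y ψ) : ∃ ψ', GP S D y x ψ' := by
  refine ⟨_, h.1.comp (nc_affine (c := 1) (d := -1) (by norm_num)), fun t => h.2.1 _, ?_, ?_⟩
  · simpa using h.2.2.2
  · simpa using h.2.2.1

lemma gp_local {D : Set X} (hD : IsOpen D) {x : X} (hx : x ∈ D) : ∀ᶠ y in 𝓝 x, ∃ ψ, GP S D x y ψ := by
  have hO : IsOpen (S.Ψ ⁻¹' D) := hD.preimage S.Ψc
  have hb : ∀ τ, S.Ψ τ = x → ∃ δ > 0, Metric.ball τ δ ⊆ S.Ψ ⁻¹' D := by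
    intro τ hτ
    exact Metric.isOpen_iff.1 hO τ (by rw [mem_preimage, hτ]; exact hx)
  let O : Set ℝ := ⋃ τ : {τ // S.Ψ τ = x}, ⋃ δ : {δ : ℝ // 0 < δ ∧ Metric.ball τ.1 δ ⊆ S.Ψ ⁻¹' D}, Metric.ball τ.1 δ.1
  have hOo : IsOpen O := isOpen_iUnion fun _ => isOpen_iUnion fun _ => Metric.isOpen_ball
  have hK : IsClosed (S.Ψ '' (Icc (0:ℝ) 1 \ O)) :=
    ((isCompact_Icc.diff hOo).image S.Ψc).isClosed
  have hxK : x ∉ S.Ψ '' (Icc (0:ℝ) 1 \ O) := by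
    rintro ⟨τ, ⟨_, h2⟩, rfl⟩
    obtain ⟨δ, hδ, hs⟩ := hb τ rfl
    exact h2 (mem_iUnion.2 ⟨⟨τ, rfl⟩, mem_iUnion.2 ⟨⟨δ, hδ, hs⟩, Metric.mem_ball_self hδ⟩⟩)
  filter_upwards [hK.isOpen_compl.mem_nhds hxK] with y hy
  obtain ⟨t, ht, rfl⟩ := S.Ψs y
  have htO : t ∈ O := by
    by_contra h; exact hy ⟨t, ⟨ht, h⟩, rfl⟩
  simp only [O, mem_iUnion] at htO
  obtain ⟨⟨τ, hτ⟩, ⟨δ, hδ, hs⟩, htb⟩ := htO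
  simp only at htb hs
  obtain ⟨v, hv, hv1, hv2⟩ : ∃ v ∈ Metric.ball τ δ, v ≠ τ ∧ v ≠ t := by
    by_cases h : t = τ + δ/2
    · exact ⟨τ + δ/3, by rw [Metric.mem_ball, Real.dist_eq, add_sub_cancel_left, abs_of_pos (by linarith)]; linarith,
        by intro h; linarith, by intro h; linarith⟩
    · exact ⟨τ + δ/2, by rw [Metric.mem_ball, Real.dist_eq, add_sub_cancel_left, abs_of_pos (by linarith)]; linarith,
        by intro h; linarith, fun h' => h h'.symm⟩
  have c := convex_ball τ δ
  have g1 := gp_seg (S := S) c (D := D) (fun t ht => hs ht) (Metric.mem_ball_self hδ) hv hv1.symm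
  have g2 := gp_seg (S := S) c (D := D) (fun t ht => hs ht) hv htb hv2
  rw [hτ] at g1
  exact ⟨_, g1.cat g2⟩

lemma gp_exists {D : Set X} (hD : IsOpen D) (hc : IsPreconnected D) {x y : X} (hx : x ∈ D) (hy : y ∈ D) :
    ∃ ψ, GP S D x y ψ := by
  refine hc.induction₂' (fun x y => ∃ ψ, GP S D x y ψ) ?_ ?_ hx hy
  · intro x hx
    filter_upwards [mem_nhdsWithin_of_mem_nhds (gp_local hD hx)] with y hy
    obtain ⟨ψ, h⟩ := hy
    exact ⟨⟨ψ, h⟩, h.rev⟩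
  · rintro x y z _ _ _ ⟨ψ, h⟩ ⟨ψ', h'⟩
    exact ⟨_, h.cat h'⟩

def Occ (φ ψ : ℝ → X) : Prop := ∃ a b : ℝ, 0 ≤ a ∧ a < b ∧ b ≤ 1 ∧ ∀ t ∈ Icc (0:ℝ) 1, ψ (a + (b - a) * t) = φ t

lemma Occ.trans {φ ψ χ : ℝ → X} (h : Occ φ ψ) (h' : Occ ψ χ) : Occ φ χ := by
  obtain ⟨a, b, h1, h2, h3, h4⟩ := h
  obtain ⟨a', b', h1', h2', h3', h4'⟩ := h'
  refine ⟨a' + (b' - a') * a, a' + (b' - a') * b, by nlinarith, by nlinarith, by nlinarith, fun t ht => ?_⟩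
  rw [← h4 t ht, ← h4' _ ⟨by nlinarith [ht.1, ht.2], by nlinarith [ht.1, ht.2]⟩]
  congr 1; ring

lemma occ_left (ψ ψ' : ℝ → X) : Occ ψ (cat ψ ψ') :=
  ⟨0, 1/2, le_rfl, by norm_num, by norm_num, fun t ht => by
    rw [cat_left _ _ (by linarith [ht.2])]; congr 1; ring⟩

lemma occ_right {ψ ψ' : ℝ → X} (h0 : ψ 1 = ψ' 0) : Occ ψ' (cat ψ ψ') :=
  ⟨1/2, 1, by norm_num, by norm_num, by norm_num, fun t ht => by
    rw [cat_right h0 (by linarith [ht.1])]; congr 1; ring⟩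

lemma multi {D : Set X} (hD : IsOpen D) (hc : IsPreconnected D) {y : X} (hy : y ∈ D)
    (L : List (ℝ → X)) (hL : ∀ φ ∈ L, Good S φ ∧ ∀ t, φ t ∈ D) :
    ∀ x ∈ D, ∃ ψ, GP S D x y ψ ∧ ∀ φ ∈ L, Occ φ ψ := by
  induction L with
  | nil =>
    intro x hx
    obtain ⟨ψ, h⟩ := gp_exists (S := S) hD hc hx hy
    exact ⟨ψ, h, by simp⟩
  | cons φ L ih =>
    intro x hx
    have hφ := hL φ (by simp)
    obtain ⟨ψ', h', ho⟩ := ih (fun φ h => hL φ (List.mem_cons_of_mem _ h)) (φ 1) (hφ.2 1)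
    obtain ⟨σ, hσ⟩ := gp_exists (S := S) hD hc hx (hφ.2 0)
    have hφ' : GP S D (φ 0) (φ 1) φ := ⟨hφ.1, hφ.2, rfl, rfl⟩
    have h1 := hφ'.cat h'
    refine ⟨_, hσ.cat h1, ?_⟩
    have o1 : Occ (cat φ ψ') (cat σ (cat φ ψ')) := occ_right (hσ.2.2.2.trans h1.2.2.1.symm)
    intro φ' hφ'
    rcases List.mem_cons.1 hφ' with rfl | hφ'
    · exact (occ_left _ _).trans o1
    · exact ((ho _ hφ').trans (occ_right h'.2.2.1.symm)).trans o1

lemma cover {D K : Set X} (hD : IsOpen D) (hK : IsCompact K) (hKD : K ⊆ D) :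
    ∃ L : List (ℝ → X), (∀ φ ∈ L, Good S φ ∧ ∀ t, φ t ∈ D) ∧ ∀ x ∈ K, ∃ φ ∈ L, ∃ t ∈ Icc (0:ℝ) 1, φ t = x := by
  have hO : IsOpen (S.Ψ ⁻¹' D) := hD.preimage S.Ψc
  have hK' : IsCompact (Icc (0:ℝ) 1 ∩ S.Ψ ⁻¹' K) := isCompact_Icc.inter_right (hK.isClosed.preimage S.Ψc)
  have hb : ∀ τ, ∃ δ > 0, τ ∈ Icc (0:ℝ) 1 ∩ S.Ψ ⁻¹' K → Metric.ball τ (2 * δ) ⊆ S.Ψ ⁻¹' D := by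
    intro τ
    by_cases h : τ ∈ Icc (0:ℝ) 1 ∩ S.Ψ ⁻¹' K
    · obtain ⟨δ, hδ, hs⟩ := Metric.isOpen_iff.1 hO τ (hKD h.2)
      exact ⟨δ/2, by positivity, fun _ => by rwa [mul_div_cancel₀ _ two_ne_zero]⟩
    · exact ⟨1, one_pos, fun h' => absurd h' h⟩
  choose δ hδ hs using hb
  obtain ⟨t, ht, htc⟩ := hK'.elim_nhds_subcover (fun τ => Metric.ball τ (δ τ))
    (fun τ _ => Metric.ball_mem_nhds _ (hδ τ))
  refine ⟨t.toList.map (fun τ => seg S (τ - δ τ) (τ + δ τ)), ?_, ?_⟩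
  · intro φ hφ
    rw [List.mem_map] at hφ
    obtain ⟨τ, hτ, rfl⟩ := hφ
    have hτ' := ht τ (Finset.mem_toList.1 hτ)
    have hd := hδ τ
    have := gp_seg (S := S) (convex_ball τ (2 * δ τ)) (D := D) (fun t ht => hs τ hτ' ht)
      (s := τ - δ τ) (t := τ + δ τ)
      (by rw [Metric.mem_ball, Real.dist_eq, abs_lt]; constructor <;> linarith)
      (by rw [Metric.mem_ball, Real.dist_eq, abs_lt]; constructor <;> linarith) (by intro h; linarith)
    exact ⟨this.1, this.2.1⟩
  · intro x hx
    obtain ⟨s, hs1, rfl⟩ := S.Ψs x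
    have := htc ⟨hs1, hx⟩
    simp only [mem_iUnion] at this
    obtain ⟨τ, hτ, hsτ⟩ := this
    refine ⟨_, List.mem_map.2 ⟨τ, Finset.mem_toList.2 hτ, rfl⟩, ?_⟩
    have hd := hδ τ
    rw [Metric.mem_ball, Real.dist_eq, abs_lt] at hsτ
    have hv : (s - (τ - δ τ)) / (2 * δ τ) ∈ Icc (kap 0) (kap 1) := by
      rw [kap_zero, kap_one]
      constructor
      · apply div_nonneg <;> linarith
      · rw [div_le_one (by linarith)]; linarith
    obtain ⟨r, hr, hrv⟩ := intermediate_value_Icc (zero_le_one) kap_cont.continuousOn hv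
    refine ⟨r, hr, ?_⟩
    simp only [seg]; rw [hrv]
    congr 1
    field_simp
    ring

end GP
end PureMix

open Set Topology
set_option linter.unusedSectionVars false
set_option linter.unusedVariables false

namespace PureMix
section Shell
variable {X : Type*} [MetricSpace X] [CompactSpace X] [ConnectedSpace X] [LocallyConnectedSpace X] [Nontrivial X]
variable (S : Setup X)

lemma exists_max : ∃ x : X, ∀ y, S.f y ≤ S.f x := by
  obtain ⟨x, -, hx⟩ := isCompact_univ.exists_isMaxOn (univ_nonempty (α := X)) S.fc.continuousOn
  exact ⟨x, fun y => hx (mem_univ y)⟩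

noncomputable def xm : X := (exists_max S).choose

lemma le_xm (y : X) : S.f y ≤ S.f (xm S) := (exists_max S).choose_spec y

lemma f_pos {x : X} (hx : x ≠ S.p) : 0 < S.f x :=
  lt_of_le_of_ne (S.f0 x) (fun h => hx ((S.fz x).1 h.symm))

lemma xm_pos : 0 < S.f (xm S) := by
  obtain ⟨x, hx⟩ := exists_ne S.p
  exact (f_pos S hx).trans_le (le_xm S x)

lemma xm_ne : xm S ≠ S.p := fun h => (xm_pos S).ne' ((S.fz _).2 h)

noncomputable def rr (n : ℕ) : ℝ := (4 / 3 * S.f (xm S)) / 2 ^ n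

lemma rr_pos (n : ℕ) : 0 < rr S n := by have := xm_pos S; unfold rr; positivity

lemma rr_succ (n : ℕ) : rr S n = 2 * rr S (n+1) := by unfold rr; rw [pow_succ]; field_simp

lemma rr_lt (n : ℕ) : rr S (n+1) < rr S n := by have := rr_pos S (n+1); rw [rr_succ S n]; linarith

lemma rr_anti : Antitone (rr S) := antitone_nat_of_succ_le fun n => (rr_lt S n).le

lemma rr_small {ε : ℝ} (hε : 0 < ε) : ∃ n, rr S n < ε := by
  have hp : 0 < 4 / 3 * S.f (xm S) := by have := xm_pos S; positivity
  obtain ⟨k, hk⟩ := exists_pow_lt_of_lt_one (show 0 < ε / (4 / 3 * S.f (xm S)) by positivity)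
      (by norm_num : (1/2:ℝ) < 1)
  refine ⟨k, ?_⟩
  rw [lt_div_iff₀ hp, one_div, inv_pow] at hk
  unfold rr; rw [div_eq_mul_inv]; linarith

def V (n : ℕ) : Set X := connectedComponentIn {x | S.f x < rr S n} S.p

lemma sub_open (n : ℕ) : IsOpen {x | S.f x < rr S n} := isOpen_lt S.fc continuous_const

lemma p_mem_sub (n : ℕ) : S.p ∈ {x | S.f x < rr S n} := by
  show S.f S.p < _
  rw [(S.fz S.p).2 rfl]; exact rr_pos S n

lemma V_open (n : ℕ) : IsOpen (V S n) := (sub_open S n).connectedComponentIn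

lemma p_mem_V (n : ℕ) : S.p ∈ V S n := mem_connectedComponentIn (p_mem_sub S n)

lemma V_conn (n : ℕ) : IsPreconnected (V S n) := isPreconnected_connectedComponentIn

lemma V_lt {n : ℕ} {x : X} (h : x ∈ V S n) : S.f x < rr S n :=
  (connectedComponentIn_subset {x | S.f x < rr S n} S.p) h

lemma V_zero : V S 0 = univ := by
  have : {x | S.f x < rr S 0} = univ := by
    refine eq_univ_of_forall fun x => ?_
    show S.f x < rr S 0
    have h1 := le_xm S x
    have h2 := xm_pos S
    simp only [rr, pow_zero, div_one]; linarith
  rw [V, this, connectedComponentIn_univ, PreconnectedSpace.connectedComponent_eq_univ]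

lemma V_cl_le {n : ℕ} {x : X} (h : x ∈ closure (V S n)) : S.f x ≤ rr S n := by
  have : closure (V S n) ⊆ {x | S.f x ≤ rr S n} :=
    closure_minimal (fun x hx => (V_lt S hx).le) (isClosed_le S.fc continuous_const)
  exact this h

lemma V_cl_sub (n : ℕ) : closure (V S (n+1)) ⊆ V S n := by
  refine (V_conn S (n+1)).closure.subset_connectedComponentIn (subset_closure (p_mem_V S _)) ?_
  intro x hx
  exact (V_cl_le S hx).trans_lt (rr_lt S n)

lemma V_anti : Antitone (V S) := antitone_nat_of_succ_le fun n => subset_closure.trans (V_cl_sub S n)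

lemma V_bd {n : ℕ} {x : X} (h : x ∈ closure (V S n)) (h' : x ∉ V S n) : S.f x = rr S n := by
  refine le_antisymm (V_cl_le S h) (not_lt.1 fun hlt => h' ?_)
  exact closure_comp_subset (sub_open S n) S.p ⟨h, hlt⟩

lemma V_nhds {U : Set X} (hU : U ∈ 𝓝 S.p) : ∃ n, V S n ⊆ U := by
  have hK : IsCompact (interior U)ᶜ := isOpen_interior.isClosed_compl.isCompact
  rcases ((interior U)ᶜ).eq_empty_or_nonempty with h | h
  · exact ⟨0, fun x _ => interior_subset (by rw [compl_empty_iff] at h; rw [h]; trivial)⟩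
  · obtain ⟨y, hy, hm⟩ := hK.exists_isMinOn h S.fc.continuousOn
    have hyp : y ≠ S.p := by rintro rfl; exact hy (mem_interior_iff_mem_nhds.2 hU)
    obtain ⟨n, hn⟩ := rr_small S (f_pos S hyp)
    refine ⟨n, fun x hx => ?_⟩
    by_contra hxU
    have h1 : S.f y ≤ S.f x := hm (fun h => hxU (interior_subset h))
    have := V_lt S hx
    linarith

lemma exists_notMem_V {x : X} (hx : x ≠ S.p) : ∃ n, x ∉ V S (n+1) := by
  obtain ⟨n, hn⟩ := rr_small S (f_pos S hx)
  refine ⟨n, fun h => ?_⟩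
  have := V_lt S h
  have := rr_lt S n
  linarith

lemma exists_level {x : X} (hx : x ≠ S.p) : ∃ n, x ∉ V S (n+1) ∧ x ∈ V S n := by
  classical
  have hex := exists_notMem_V S hx
  refine ⟨Nat.find hex, Nat.find_spec hex, ?_⟩
  rcases Nat.eq_zero_or_pos (Nat.find hex) with h | h
  · rw [h, V_zero]; trivial
  · obtain ⟨k, hk⟩ := Nat.exists_eq_succ_of_ne_zero h.ne'
    have := Nat.find_min hex (m := k) (by omega)
    rw [hk]
    exact not_not.1 this

lemma xm_notMem (n : ℕ) : xm S ∉ V S (n+1) := by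
  intro h
  have h1 := V_lt S (V_anti S (Nat.le_add_left 1 n) h)
  have := xm_pos S
  simp only [rr, pow_one] at h1
  linarith

def W (n : ℕ) : Set X := V S n ∩ {S.p}ᶜ

lemma W_open (n : ℕ) : IsOpen (W S n) := (V_open S n).inter isOpen_compl_singleton

lemma W_anti : Antitone (W S) := fun _ _ h => inter_subset_inter_left _ (V_anti S h)

lemma W_zero : W S 0 = {S.p}ᶜ := by rw [W, V_zero, univ_inter]

def Cmp (n : ℕ) (x : X) : Set X := connectedComponentIn (W S n) x

lemma Cmp_open (n : ℕ) (x : X) : IsOpen (Cmp S n x) := (W_open S n).connectedComponentIn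
lemma Cmp_conn (n : ℕ) (x : X) : IsPreconnected (Cmp S n x) := isPreconnected_connectedComponentIn
lemma Cmp_self {n : ℕ} {x : X} (h : x ∈ W S n) : x ∈ Cmp S n x := mem_connectedComponentIn h
lemma Cmp_sub (n : ℕ) (x : X) : Cmp S n x ⊆ W S n := connectedComponentIn_subset _ _
lemma Cmp_eq {n : ℕ} {x y : X} (h : y ∈ Cmp S n x) : Cmp S n y = Cmp S n x := (connectedComponentIn_eq h).symm
lemma Cmp_mono {n m : ℕ} (h : m ≤ n) (x : X) : Cmp S n x ⊆ Cmp S m x := connectedComponentIn_mono _ (W_anti S h)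
lemma Cmp_closed (n : ℕ) (x : X) : closure (Cmp S n x) ∩ W S n ⊆ Cmp S n x :=
  closure_comp_subset (W_open S n) x

lemma p_mem_cl {n : ℕ} {x : X} (hx : x ∈ W S n) : S.p ∈ closure (Cmp S n x) := by
  by_contra h
  have := (V_conn S n).subset_of_closure_inter_subset (Cmp_open S n x) ⟨x, hx.1, Cmp_self S hx⟩ (by
    rintro y ⟨hy, hyV⟩
    refine Cmp_closed S n x ⟨hy, hyV, ?_⟩
    rintro rfl; exact h hy)
  exact (Cmp_sub S n x (this (p_mem_V S n))).2 rfl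

lemma Cmp_exit {m : ℕ} {x : X} (hx : x ∈ W S m) : ∃ y ∈ Cmp S m x, y ∉ V S (m+1) := by
  by_contra hcon
  push Not at hcon
  have hcl : closure (Cmp S m x) ⊆ V S m := (closure_mono hcon).trans (V_cl_sub S m)
  have := S.noncut.subset_of_closure_inter_subset (Cmp_open S m x) ⟨x, hx.2, Cmp_self S hx⟩ (by
    rintro y ⟨hy, hyV⟩
    exact Cmp_closed S m x ⟨hy, hcl hy, hyV⟩)
  exact xm_notMem S m (hcon _ (this (xm_ne S)))

lemma Cmp_zero {x : X} (hx : x ∈ W S 0) : Cmp S 0 x = W S 0 := by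
  refine (Cmp_sub S 0 x).antisymm (IsPreconnected.subset_connectedComponentIn ?_ hx Subset.rfl)
  rw [W_zero]; exact S.noncut

def Sh (n : ℕ) : Set X := closure (V S n) \ V S (n+1)

lemma Sh_closed (n : ℕ) : IsClosed (Sh S n) := isClosed_closure.sdiff (V_open S _)

lemma Sh_sub_W (n : ℕ) : Sh S n ⊆ W S (n-1) := by
  rintro x ⟨h1, h2⟩
  refine ⟨?_, fun h => h2 ?_⟩
  · cases n with
    | zero => rw [V_zero]; trivial
    | succ n => exact V_cl_sub S n h1
  · rw [mem_singleton_iff] at h; rw [h]; exact p_mem_V S _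

noncomputable def F (n : ℕ) (x : X) : ℝ := S.f x / rr S (n+1) - 1

lemma F_cont (n : ℕ) : Continuous (F S n) := by have := S.fc; unfold F; fun_prop

lemma F_mem {n : ℕ} {x : X} (h : x ∈ Sh S n) : F S n x ∈ Icc (-1:ℝ) 1 := by
  have h1 := V_cl_le S h.1
  have h2 := S.f0 x
  have h3 := rr_pos S (n+1)
  rw [rr_succ] at h1
  have h4 : 0 ≤ S.f x / rr S (n+1) := by positivity
  have h5 : S.f x / rr S (n+1) ≤ 2 := by rw [div_le_iff₀ h3]; exact h1
  simp only [F]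
  constructor <;> linarith

def Trav (χ : ℝ → X) (a b : ℝ) (n : ℕ) (D : Set X) (lo hi : ℝ) : Prop :=
  ∃ α β, a ≤ α ∧ α < β ∧ β ≤ b ∧ (∀ t ∈ Icc α β, χ t ∈ Sh S n ∧ χ t ∈ D) ∧
    ((F S n (χ α) ≤ lo ∧ hi ≤ F S n (χ β)) ∨ (hi ≤ F S n (χ α) ∧ F S n (χ β) ≤ lo))

variable {S}

lemma Trav.mono {χ : ℝ → X} {a b a' b' : ℝ} {n : ℕ} {D : Set X} {lo hi : ℝ} (h : Trav S χ a b n D lo hi)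
    (ha : a' ≤ a) (hb : b ≤ b') : Trav S χ a' b' n D lo hi := by
  obtain ⟨α, β, h1, h2, h3, h4⟩ := h
  exact ⟨α, β, ha.trans h1, h2, h3.trans hb, h4⟩

lemma Trav.comp {χ : ℝ → X} {a b c d : ℝ} {n : ℕ} {D : Set X} {lo hi : ℝ} (h : Trav S χ c d n D lo hi)
    {w : ℝ → ℝ} (hw : Continuous w) {x y : ℝ} (hx : x ∈ Icc a b) (hy : y ∈ Icc a b) (hxc : w x ≤ c) (hyd : d ≤ w y) :
    Trav S (fun t => χ (w t)) a b n D lo hi := by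
  obtain ⟨α, β, h1, h2, h3, h4, h5⟩ := h
  obtain ⟨α', β', k1, k2, k3, k4, k5⟩ := ivt_sub (hw.continuousOn) hx hy h2 (hxc.trans h1) (h3.trans hyd)
  refine ⟨α', β', k1, k2, k3, fun t ht => h4 _ (k4 t ht), ?_⟩
  rcases k5 with ⟨e1, e2⟩ | ⟨e1, e2⟩
  · dsimp only; rw [e1, e2]; exact h5
  · dsimp only; rw [e1, e2]; exact h5.symm.imp And.symm And.symm

lemma Trav.occ {φ ψ : ℝ → X} {n : ℕ} {D : Set X} {lo hi : ℝ} (h : Trav S φ 0 1 n D lo hi) (ho : Occ φ ψ) :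
    Trav S ψ 0 1 n D lo hi := by
  obtain ⟨a, b, o1, o2, o3, o4⟩ := ho
  obtain ⟨α, β, h1, h2, h3, h4, h5⟩ := h
  have hba : 0 < b - a := by linarith
  refine ⟨a + (b-a) * α, a + (b-a) * β, by positivity, by nlinarith, by nlinarith, ?_, ?_⟩
  · intro t ht
    have e : t = a + (b-a) * ((t - a) / (b-a)) := by field_simp; ring
    have m : (t - a) / (b-a) ∈ Icc α β := by
      constructor
      · rw [le_div_iff₀ hba]; linarith [ht.1]
      · rw [div_le_iff₀ hba]; linarith [ht.2]
    rw [e, o4 _ ⟨h1.trans m.1, m.2.trans h3⟩]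
    exact h4 _ m
  · rw [o4 α ⟨h1, h2.le.trans h3⟩, o4 β ⟨h1.trans h2.le, h3⟩]; exact h5

variable (S)

def Valid (n : ℕ) (D : Set X) : Prop := ∃ x ∈ W S (n-1), D = Cmp S (n-1) x

variable {S}

lemma Valid.open {n : ℕ} {D : Set X} (h : Valid S n D) : IsOpen D := by
  obtain ⟨x, hx, rfl⟩ := h; exact Cmp_open S _ _
lemma Valid.conn {n : ℕ} {D : Set X} (h : Valid S n D) : IsPreconnected D := by
  obtain ⟨x, hx, rfl⟩ := h; exact Cmp_conn S _ _
lemma Valid.ne {n : ℕ} {D : Set X} (h : Valid S n D) : D.Nonempty := by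
  obtain ⟨x, hx, rfl⟩ := h; exact ⟨x, Cmp_self S hx⟩
lemma Valid.sub {n : ℕ} {D : Set X} (h : Valid S n D) : D ⊆ W S (n-1) := by
  obtain ⟨x, hx, rfl⟩ := h; exact Cmp_sub S _ _
lemma Valid.eq {n : ℕ} {D : Set X} (h : Valid S n D) {y : X} (hy : y ∈ D) : Cmp S (n-1) y = D := by
  obtain ⟨x, hx, rfl⟩ := h; exact Cmp_eq S hy
lemma valid_mk {n : ℕ} {x : X} (hx : x ∈ W S (n-1)) : Valid S n (Cmp S (n-1) x) := ⟨x, hx, rfl⟩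

/-- exit time -/
lemma exit_time {n : ℕ} {D : Set X} (h : Valid S n D) :
    ∃ φ : ℝ → X, Good S φ ∧ (∀ t, φ t ∈ D) ∧ φ 0 ∈ V S (n+1) ∧ ∃ β, 0 ≤ β ∧ β ≤ 1 ∧
      (∀ t ∈ Icc 0 β, φ t ∈ closure (V S n)) ∧ 1/2 ≤ F S n (φ β) ∧ φ β ∉ closure (V S (n+1)) := by
  obtain ⟨x, hx, hDx⟩ := id h
  obtain ⟨a, ha1, ha2⟩ := mem_closure_iff.1 (p_mem_cl S hx) _ (V_open S (n+1)) (p_mem_V S _)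
  rw [← hDx] at ha2
  cases n with
  | zero =>
    have hb : xm S ∈ D := by
      rw [hDx]; simp only [Nat.zero_sub] at hx ⊢; rw [Cmp_zero S hx, W_zero]; exact xm_ne S
    obtain ⟨φ, h1, h2, h3, h4⟩ := gp_exists (S := S) h.open h.conn ha2 hb
    refine ⟨φ, h1, h2, by rw [h3]; exact ha1, 1, zero_le_one, le_rfl, ?_, ?_, ?_⟩
    · intro t _; rw [V_zero]; simp
    · rw [h4]; have := xm_pos S
      simp only [F, rr]; field_simp; norm_num
    · rw [h4]; intro hc
      have h1 := V_cl_le S hc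
      have := xm_pos S
      simp only [rr] at h1; norm_num at h1
      linarith
  | succ n =>
    obtain ⟨b, hb1, hb2⟩ := Cmp_exit S hx
    simp only [Nat.add_sub_cancel] at hb1 hb2 hDx
    rw [← hDx] at hb1
    obtain ⟨φ, h1, h2, h3, h4⟩ := gp_exists (S := S) h.open h.conn ha2 hb1
    have hc : IsCompact (Icc (0:ℝ) 1 ∩ φ ⁻¹' (V S (n+1))ᶜ) :=
      isCompact_Icc.inter_right ((V_open S _).isClosed_compl.preimage h1.1)
    obtain ⟨β, ⟨hβ, hβV⟩, hmin⟩ := hc.exists_isLeast ⟨1, ⟨zero_le_one, le_rfl⟩, by rw [mem_preimage, h4]; exact hb2⟩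
    have hlt : ∀ t ∈ Ico 0 β, φ t ∈ V S (n+1) := by
      intro t ht
      by_contra hh
      have := hmin ⟨⟨ht.1, ht.2.le.trans hβ.2⟩, hh⟩
      linarith [ht.2]
    have hβ0 : 0 < β := by
      refine lt_of_le_of_ne hβ.1 (fun h0 => hβV ?_)
      rw [← h0, h3]; exact V_anti S (Nat.le_succ _) ha1
    have hcl : ∀ t ∈ Icc 0 β, φ t ∈ closure (V S (n+1)) := by
      intro t ht
      rw [← closure_Ico hβ0.ne] at ht
      exact map_mem_closure h1.1 ht hlt
    refine ⟨φ, h1, h2, by rw [h3]; exact ha1, β, hβ.1, hβ.2, hcl, ?_, ?_⟩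
    · have := V_bd S (hcl β ⟨hβ.1, le_rfl⟩) hβV
      simp only [F]
      rw [this, rr_succ, mul_div_assoc, div_self (rr_pos S _).ne']; norm_num
    · exact fun h => hβV (V_cl_sub S _ h)

lemma crossing {n : ℕ} {D : Set X} (h : Valid S n D) :
    ∃ φ : ℝ → X, Good S φ ∧ (∀ t, φ t ∈ D) ∧ Trav S φ 0 1 n D 0 (1/2) := by
  obtain ⟨φ, h1, h2, h3, β, hβ0, hβ1, hcl, hF, hβ⟩ := exit_time h
  refine ⟨φ, h1, h2, ?_⟩
  have hc : IsCompact (Icc (0:ℝ) β ∩ φ ⁻¹' (closure (V S (n+1)))) :=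
    isCompact_Icc.inter_right (isClosed_closure.preimage h1.1)
  obtain ⟨α, ⟨hα, hαV⟩, hmax⟩ := hc.exists_isGreatest ⟨0, ⟨le_rfl, hβ0⟩, subset_closure h3⟩
  have hαβ : α < β := lt_of_le_of_ne hα.2 (by rintro rfl; exact hβ hαV)
  have hgt : ∀ t ∈ Ioc α β, φ t ∈ (V S (n+1))ᶜ := by
    intro t ht hh
    have := hmax ⟨⟨hα.1.trans ht.1.le, ht.2⟩, subset_closure hh⟩
    linarith [ht.1]
  have hge : ∀ t ∈ Icc α β, φ t ∈ (V S (n+1))ᶜ := by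
    intro t ht
    rw [← closure_Ioc hαβ.ne] at ht
    have := map_mem_closure h1.1 ht hgt
    rwa [(V_open S _).isClosed_compl.closure_eq] at this
  refine ⟨α, β, hα.1, hαβ, hβ1, fun t ht => ⟨⟨hcl t ⟨hα.1.trans ht.1, ht.2⟩, hge t ht⟩, h2 t⟩, Or.inl ⟨?_, hF⟩⟩
  have := V_bd S hαV (hge α ⟨le_rfl, hαβ.le⟩)
  simp only [F]; rw [this, div_self (rr_pos S _).ne']; simp

lemma finite_valid (n : ℕ) : {D : Set X | Valid S (n+1) D}.Finite := by
  obtain ⟨t, ht, htc⟩ := (Sh_closed S (n+1)).isCompact.elim_nhds_subcover (fun x => Cmp S n x)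
    (fun x hx => (Cmp_open S n x).mem_nhds (Cmp_self S (Sh_sub_W S (n+1) hx)))
  refine (t.finite_toSet.image (fun x => Cmp S n x)).subset ?_
  intro D hD
  obtain ⟨φ, -, -, α, β, -, hab, -, h4, -⟩ := crossing hD
  obtain ⟨h5, h6⟩ := h4 α ⟨le_rfl, hab.le⟩
  have := htc h5
  simp only [mem_iUnion] at this
  obtain ⟨x, hx, hxα⟩ := this
  refine ⟨x, hx, ?_⟩
  have e1 := Cmp_eq S hxα
  have e2 := hD.eq h6
  simp only [Nat.add_sub_cancel] at e2
  dsimp only; rw [← e1, e2]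

variable (S) in
open Classical in
noncomputable def uu (D : Set X) : X := if h : D.Nonempty then h.some else S.p

lemma uu_mem {n : ℕ} {D : Set X} (h : Valid S n D) : uu S D ∈ D := by
  rw [uu, dif_pos h.ne]; exact h.ne.some_mem

variable (S) in
noncomputable def par (n : ℕ) (D : Set X) : Set X := Cmp S (n-1-1) (uu S D)

lemma Valid.par {n : ℕ} {D : Set X} (h : Valid S n D) : Valid S (n-1) (par S n D) :=
  valid_mk (W_anti S (Nat.sub_le _ _) (h.sub (uu_mem h)))

lemma Valid.sub_par {n : ℕ} {D : Set X} (h : Valid S n D) : D ⊆ PureMix.par S n D := by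
  rw [← h.eq (uu_mem h)]
  have e : uu S (Cmp S (n-1) (uu S D)) = uu S D := by rw [h.eq (uu_mem h)]
  unfold PureMix.par; rw [e]
  exact Cmp_mono S (Nat.sub_le _ _) _

lemma shell_compact {n : ℕ} {D : Set X} (h : Valid S n D) : IsCompact (Sh S n ∩ D) := by
  have : Sh S n ∩ D = Sh S n ∩ closure D := by
    refine (inter_subset_inter_right _ subset_closure).antisymm ?_
    rintro x ⟨h1, h2⟩
    refine ⟨h1, ?_⟩
    obtain ⟨y, hy, rfl⟩ := h
    exact Cmp_closed S _ _ ⟨h2, Sh_sub_W S n h1⟩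
  rw [this]
  exact ((Sh_closed S n).inter isClosed_closure).isCompact

lemma exists_path {n : ℕ} {D : Set X} (h : Valid S n D) :
    ∃ ψ, GP S (par S n D) (uu S D) (uu S (par S n D)) ψ ∧ Trav S ψ 0 1 n D 0 (1/2) ∧
      Trav S ψ 0 1 (n-1) (par S n D) 0 (1/2) ∧
      (∀ D', Valid S (n+1) D' → D' ⊆ D → Trav S ψ 0 1 (n+1) D' 0 (1/2)) ∧
      ∀ x ∈ Sh S n ∩ D, ∃ t ∈ Icc (0:ℝ) 1, ψ t = x := by
  set Q := par S n D with hQ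
  have hDQ : D ⊆ Q := h.sub_par
  obtain ⟨φ1, a1, a2, a3⟩ := crossing h
  obtain ⟨φ2, b1, b2, b3⟩ := crossing h.par
  have hch : ∀ D', ∃ φ : ℝ → X, Valid S (n+1) D' → Good S φ ∧ (∀ t, φ t ∈ D') ∧ Trav S φ 0 1 (n+1) D' 0 (1/2) := by
    intro D'
    by_cases hD' : Valid S (n+1) D'
    · obtain ⟨φ, hφ⟩ := crossing hD'; exact ⟨φ, fun _ => hφ⟩
    · exact ⟨fun _ => S.p, fun h => absurd h hD'⟩
  choose crs hcrs using hch
  obtain ⟨Lc, hLc, hLcov⟩ := cover (S := S) h.par.open (shell_compact h) (inter_subset_right.trans hDQ)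
  have hfin : {D' : Set X | Valid S (n+1) D' ∧ D' ⊆ D}.Finite := (finite_valid n).subset (fun _ h => h.1)
  have hall : ∀ φ ∈ φ1 :: φ2 :: (hfin.toFinset.toList.map crs ++ Lc), Good S φ ∧ ∀ t, φ t ∈ Q := by
    intro φ hφ
    simp only [List.mem_cons, List.mem_append, List.mem_map, Finset.mem_toList, Finite.mem_toFinset] at hφ
    rcases hφ with rfl | rfl | ⟨D', hD', rfl⟩ | hφ
    · exact ⟨a1, fun t => hDQ (a2 t)⟩
    · exact ⟨b1, b2⟩
    · have := hcrs D' hD'.1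
      exact ⟨this.1, fun t => hDQ (hD'.2 (this.2.1 t))⟩
    · exact hLc φ hφ
  obtain ⟨ψ, hψ, hocc⟩ := multi (S := S) h.par.open h.par.conn (uu_mem h.par) _ hall (uu S D) (hDQ (uu_mem h))
  refine ⟨ψ, hψ, a3.occ (hocc _ (by simp)), b3.occ (hocc _ (by simp)), ?_, ?_⟩
  · intro D' hD' hsub
    refine (hcrs D' hD').2.2.occ (hocc _ ?_)
    simp only [List.mem_cons, List.mem_append, List.mem_map, Finset.mem_toList, Finite.mem_toFinset]
    exact Or.inr (Or.inr (Or.inl ⟨D', ⟨hD', hsub⟩, rfl⟩))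
  · intro x hx
    obtain ⟨φ, hφ, t, ht, rfl⟩ := hLcov x hx
    obtain ⟨a, b, o1, o2, o3, o4⟩ := hocc φ (by simp [hφ])
    exact ⟨a + (b-a) * t, ⟨by nlinarith [ht.1], by nlinarith [ht.2]⟩, o4 t ht⟩

lemma local_trav {χ : ℝ → X} (hχ : Good S χ) {a b : ℝ} (hab : a < b) :
    ∃ n D lo hi, Valid S n D ∧ -1 ≤ lo ∧ lo < hi ∧ hi ≤ 1 ∧ Trav S χ a b n D lo hi := by
  obtain ⟨s, hs, t, ht, hst⟩ : ∃ s ∈ Icc a b, ∃ t ∈ Icc a b, S.f (χ s) < S.f (χ t) := by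
    obtain ⟨s, hs, t, ht, hst⟩ := hχ.2 a b hab
    rcases hst.lt_or_gt with h | h
    · exact ⟨s, hs, t, ht, h⟩
    · exact ⟨t, ht, s, hs, h⟩
  obtain ⟨v, hv, hvr⟩ := ((countable_range (rr S)).dense_compl ℝ).exists_between hst
  obtain ⟨t0, ht0, ht0v⟩ := (isPreconnected_Icc (a := a) (b := b)).intermediate_value hs ht
    (S.fc.comp hχ.1).continuousOn ⟨hvr.1.le, hvr.2.le⟩
  simp only [Function.comp] at ht0v
  have hp : χ t0 ≠ S.p := by
    intro h
    rw [h, (S.fz _).2 rfl] at ht0v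
    have := S.f0 (χ s)
    linarith [hvr.1]
  obtain ⟨n, hn, hn'⟩ := exists_level S hp
  have hn2 : χ t0 ∉ closure (V S (n+1)) := fun h => hv ⟨n+1, by rw [← ht0v]; exact (V_bd S h hn).symm⟩
  have hmem : χ t0 ∈ W S (n-1) := ⟨V_anti S (Nat.sub_le _ _) hn', hp⟩
  set O : Set X := (V S n ∩ (closure (V S (n+1)))ᶜ) ∩ Cmp S (n-1) (χ t0) with hO
  have hOo : IsOpen O := ((V_open S n).inter isClosed_closure.isOpen_compl).inter (Cmp_open S _ _)
  have hO0 : χ t0 ∈ O := ⟨⟨hn', hn2⟩, Cmp_self S hmem⟩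
  obtain ⟨δ, hδ, hball⟩ := Metric.isOpen_iff.1 (hOo.preimage hχ.1) t0 hO0
  have hOS : ∀ y ∈ O, y ∈ Sh S n ∧ y ∈ Cmp S (n-1) (χ t0) := fun y hy =>
    ⟨⟨subset_closure hy.1.1, fun h => hy.1.2 (subset_closure h)⟩, hy.2⟩
  obtain ⟨a', b', h1, h2, h3, h4⟩ : ∃ a' b', a ≤ a' ∧ a' < b' ∧ b' ≤ b ∧ Icc a' b' ⊆ Metric.ball t0 δ := by
    rcases ht0.2.lt_or_eq with h | h
    · refine ⟨t0, min b (t0 + δ/2), ht0.1, lt_min h (by linarith), min_le_left _ _, fun x hx => ?_⟩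
      have := hx.2.trans (min_le_right _ _)
      rw [Metric.mem_ball, Real.dist_eq, abs_lt]; constructor <;> linarith [hx.1]
    · refine ⟨max a (t0 - δ/2), t0, le_max_left _ _, max_lt (by linarith) (by linarith), ht0.2, fun x hx => ?_⟩
      have := (le_max_right _ _).trans hx.1
      rw [Metric.mem_ball, Real.dist_eq, abs_lt]; constructor <;> linarith [hx.2]
  obtain ⟨s', hs', t', ht', hst'⟩ : ∃ s ∈ Icc a' b', ∃ t ∈ Icc a' b', S.f (χ s) < S.f (χ t) := by
    obtain ⟨s, hs, t, ht, hst⟩ := hχ.2 a' b' h2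
    rcases hst.lt_or_gt with h | h
    · exact ⟨s, hs, t, ht, h⟩
    · exact ⟨t, ht, s, hs, h⟩
  have hF : F S n (χ s') < F S n (χ t') := by
    have := rr_pos S (n+1)
    simp only [F]; gcongr
  have m : ∀ y ∈ Icc a' b', χ y ∈ Sh S n ∧ χ y ∈ Cmp S (n-1) (χ t0) := fun y hy => hOS _ (hball (h4 hy))
  refine ⟨n, _, F S n (χ s'), F S n (χ t'), valid_mk hmem, (F_mem S (m _ hs').1).1, hF, (F_mem S (m _ ht').1).2, ?_⟩
  have hne : s' ≠ t' := by rintro rfl; exact hF.ne rfl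
  rcases hne.lt_or_gt with h | h
  · exact ⟨s', t', h1.trans hs'.1, h, ht'.2.trans h3, fun t ht => m t ⟨hs'.1.trans ht.1, ht.2.trans ht'.2⟩,
      Or.inl ⟨le_rfl, le_rfl⟩⟩
  · exact ⟨t', s', h1.trans ht'.1, h, hs'.2.trans h3, fun t ht => m t ⟨ht'.1.trans ht.1, ht.2.trans hs'.2⟩,
      Or.inr ⟨le_rfl, le_rfl⟩⟩

lemma uniform_trav {χ : ℝ → X} (hχ : Good S χ) (c : ℝ) (hc : 0 < c) : ∃ ε > 0, ∀ a b, -10 ≤ a → b ≤ 10 → c ≤ b - a →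
    ∃ n D lo hi, Valid S n D ∧ -1 ≤ lo ∧ ε ≤ hi - lo ∧ hi ≤ 1 ∧ Trav S χ a b n D lo hi := by
  have hloc : ∀ j : ℤ, ∃ n D lo hi, Valid S n D ∧ -1 ≤ lo ∧ lo < hi ∧ hi ≤ 1 ∧
      Trav S χ (j * (c/2)) ((j+1) * (c/2)) n D lo hi := fun j => local_trav hχ (by nlinarith)
  choose n D lo hi h1 h2 h3 h4 h5 using hloc
  obtain ⟨N, hN⟩ := exists_nat_gt (10 / (c/2))
  have hev : ∀ᶠ ε in 𝓝[>] (0:ℝ), ∀ j ∈ Finset.Icc (-(N:ℤ)) N, ε ≤ hi j - lo j := by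
    rw [Filter.eventually_all_finset]
    intro j _
    exact nhdsWithin_le_nhds (Iic_mem_nhds (sub_pos.2 (h3 j)))
  obtain ⟨ε, hε, hε0⟩ := (hev.and self_mem_nhdsWithin).exists
  refine ⟨ε, hε0, fun a b ha hb hab => ?_⟩
  rw [div_lt_iff₀ (by positivity)] at hN
  set j : ℤ := ⌈a / (c/2)⌉ with hj
  have e1 : a ≤ j * (c/2) := by
    rw [← div_le_iff₀ (by positivity)]; exact Int.le_ceil _
  have e2 : j * (c/2) < a + c/2 := by
    have := Int.ceil_lt_add_one (a / (c/2))
    rw [← lt_div_iff₀ (by positivity), add_div, div_self (by positivity)]; exact this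
  have hjN : j ∈ Finset.Icc (-(N:ℤ)) N := by
    rw [Finset.mem_Icc]
    constructor
    · have : (-(N:ℝ)) ≤ j := by nlinarith
      exact_mod_cast this
    · have : (j:ℝ) ≤ N := by nlinarith
      exact_mod_cast this
  exact ⟨n j, D j, lo j, hi j, h1 j, h2 j, hε j hjN, h4 j, (h5 j).mono e1 (by nlinarith)⟩

end Shell
end PureMix

open Set Topology
set_option linter.unusedSectionVars false
set_option linter.unusedVariables false

namespace PureMix
section TT
variable {X : Type*} [MetricSpace X] [CompactSpace X] [ConnectedSpace X] [LocallyConnectedSpace X] [Nontrivial X]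
variable {S : Setup X}

lemma kap_hits (i : ℤ) : ∃ s ∈ Icc (i:ℝ) (i+1), ∃ t ∈ Icc (i:ℝ) (i+1), kap s = 0 ∧ kap t = 1 := by
  obtain ⟨k, hk | hk⟩ := Int.even_or_odd' i
  · refine ⟨i, by simp, i+1, by simp, ?_, ?_⟩
    · rw [hk]; push_cast; exact kap_even k
    · rw [hk]; push_cast; exact kap_odd k
  · refine ⟨i+1, by simp, i, by simp, ?_, ?_⟩
    · rw [hk]; push_cast
      have := kap_even (k+1)
      push_cast at this
      rw [← this]; congr 1; ring
    · rw [hk]; push_cast; exact kap_odd k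

lemma exists_g {n : ℕ} {D : Set X} (h : Valid S n D) :
    ∃ g : ℝ → X, Continuous g ∧ g 0 = uu S D ∧ g 1 = uu S (par S n D) ∧ (∀ t, g t ∈ par S n D) ∧
      (∀ a b, 1/2 ≤ b - a → Trav S g a b n D 0 (1/2) ∧ Trav S g a b (n-1) (par S n D) 0 (1/2) ∧
        (∀ D', Valid S (n+1) D' → D' ⊆ D → Trav S g a b (n+1) D' 0 (1/2)) ∧
        ∀ x ∈ Sh S n ∩ D, ∃ t ∈ Icc a b, g t = x) ∧
      ∀ a b, a < b → Trav S g a b n D 0 (1/2) ∨ ∃ n' D' lo hi, Valid S n' D' ∧ -1 ≤ lo ∧ hi ≤ 1 ∧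
        2 * (b - a) ≤ hi - lo ∧ Trav S g a b n' D' lo hi := by
  obtain ⟨ψ, ⟨hψ, hψQ, hψ0, hψ1⟩, t1, t2, t3, t4⟩ := exists_path h
  have hχ : Good S (fun t => ψ (kap t)) := hψ.comp nc_kap
  have hε : ∀ c : ℝ, ∃ ε : ℝ, 0 < c → 0 < ε ∧ ∀ a b, -10 ≤ a → b ≤ 10 → c ≤ b - a →
    ∃ n D lo hi, Valid S n D ∧ -1 ≤ lo ∧ ε ≤ hi - lo ∧ hi ≤ 1 ∧ Trav S (fun t => ψ (kap t)) a b n D lo hi := by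
    intro c
    by_cases hc : 0 < c
    · obtain ⟨ε, h1, h2⟩ := uniform_trav hχ c hc
      exact ⟨ε, fun _ => ⟨h1, h2⟩⟩
    · exact ⟨0, fun h => absurd h hc⟩
  choose ε hε using hε
  obtain ⟨w, hw, w0, w1, w10, wbig, wall⟩ := wild ε (fun c hc => (hε c hc).1)
  have full : ∀ {a b x y : ℝ}, x ∈ Icc a b → y ∈ Icc a b → w x + 2 ≤ w y →
      (∀ {n D lo hi}, Trav S ψ 0 1 n D lo hi → Trav S (fun t => ψ (kap (w t))) a b n D lo hi) ∧
      ∀ r ∈ Icc (0:ℝ) 1, ∃ t ∈ Icc a b, kap (w t) = r := by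
    intro a b x y hx hy hxy
    obtain ⟨s, hs, t, ht, ks, kt⟩ := kap_hits ⌈w x⌉
    have i1 := Int.le_ceil (w x)
    have i2 := Int.ceil_lt_add_one (w x)
    have i3 : (⌈w x⌉:ℝ) + 1 ≤ w y := by linarith
    refine ⟨fun {n D lo hi} hT => ?_, fun r hr => ?_⟩
    · have h1 : Trav S (fun t => ψ (kap t)) ⌈w x⌉ (⌈w x⌉ + 1) n D lo hi := hT.comp kap_cont hs ht ks.le kt.ge
      exact h1.comp hw hx hy i1 i3
    · have hr' : r ∈ Icc (kap s) (kap t) := by rwa [ks, kt]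
      obtain ⟨r1, hr1, e1⟩ := (isPreconnected_Icc).intermediate_value hs ht kap_cont.continuousOn hr'
      obtain ⟨r2, hr2, e2⟩ := (isPreconnected_Icc (a := a) (b := b)).intermediate_value hx hy hw.continuousOn
        ⟨i1.trans hr1.1, hr1.2.trans i3⟩
      exact ⟨r2, hr2, by rw [e2, e1]⟩
  refine ⟨fun t => ψ (kap (w t)), hχ.1.comp hw, ?_, ?_, fun t => hψQ _, ?_, ?_⟩
  · simp only [w0, kap_zero]; exact hψ0
  · simp only [w1, kap_one]; exact hψ1
  · intro a b hab
    obtain ⟨x, hx, y, hy, hxy⟩ := wbig a b hab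
    obtain ⟨f1, f2⟩ := full hx hy hxy
    refine ⟨f1 t1, f1 t2, fun D' hD' hs => f1 (t3 D' hD' hs), fun x hx => ?_⟩
    obtain ⟨r, hr, e⟩ := t4 x hx
    obtain ⟨t, ht, e'⟩ := f2 r hr
    exact ⟨t, ht, by dsimp only; rw [e', e]⟩
  · intro a b hab
    rcases wall a b hab with ⟨x, hx, y, hy, hxy⟩ | ⟨c, hc, hcε, x, hx, y, hy, hxy⟩
    · exact Or.inl ((full hx hy hxy).1 t1)
    · obtain ⟨n', D', lo, hi, v1, v2, v3, v4, v5⟩ := (hε c hc).2 (w x) (w y) (w10 x).1 (w10 y).2 (by linarith)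
      exact Or.inr ⟨n', D', lo, hi, v1, v2, v4, by linarith, v5.comp hw hx hy le_rfl le_rfl⟩

variable (S)

open Classical in
noncomputable def gg (n : ℕ) (D : Set X) : ℝ → X := if h : Valid S n D then (exists_g h).choose else fun _ => S.p

variable {S} in
lemma gg_spec {n : ℕ} {D : Set X} (h : Valid S n D) :
    Continuous (gg S n D) ∧ gg S n D 0 = uu S D ∧ gg S n D 1 = uu S (par S n D) ∧ (∀ t, gg S n D t ∈ par S n D) ∧
      (∀ a b, 1/2 ≤ b - a → Trav S (gg S n D) a b n D 0 (1/2) ∧ Trav S (gg S n D) a b (n-1) (par S n D) 0 (1/2) ∧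
        (∀ D', Valid S (n+1) D' → D' ⊆ D → Trav S (gg S n D) a b (n+1) D' 0 (1/2)) ∧
        ∀ x ∈ Sh S n ∩ D, ∃ t ∈ Icc a b, gg S n D t = x) ∧
      ∀ a b, a < b → Trav S (gg S n D) a b n D 0 (1/2) ∨ ∃ n' D' lo hi, Valid S n' D' ∧ -1 ≤ lo ∧ hi ≤ 1 ∧
        2 * (b - a) ≤ hi - lo ∧ Trav S (gg S n D) a b n' D' lo hi := by
  rw [gg, dif_pos h]; exact (exists_g h).choose_spec

open Classical in
noncomputable def T (x : X) : X := if h : x ≠ S.p then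
  (gg S (exists_level S h).choose (Cmp S ((exists_level S h).choose - 1) x)) (F S (exists_level S h).choose x) else S.p

lemma T_p : T S S.p = S.p := by simp [T]

lemma Sh_ne {n : ℕ} {x : X} (h : x ∈ Sh S n) : x ≠ S.p := (Sh_sub_W S n h).2

lemma T_eq {n : ℕ} {x : X} (h : x ∈ Sh S n) : T S x = gg S n (Cmp S (n-1) x) (F S n x) := by
  have hp := Sh_ne S h
  rw [T, dif_pos hp]
  obtain ⟨h1, h2⟩ := (exists_level S hp).choose_spec
  set m := (exists_level S hp).choose
  have hmn : m ≤ n := by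
    by_contra hh
    exact h.2 (V_anti S (by omega) h2)
  rcases hmn.eq_or_lt with e | hlt
  · rw [e]
  · have hn : n = m + 1 := by
      by_contra hh
      obtain ⟨k, rfl⟩ : ∃ k, n = k + 1 := ⟨n - 1, by omega⟩
      exact h1 (V_anti S (by omega) (V_cl_sub S k h.1))
    subst hn
    have hf := V_bd S h.1 h1
    have hr := rr_pos S (m+1)
    have e1 : F S m x = 0 := by simp only [F]; rw [hf, div_self hr.ne']; simp
    have e2 : F S (m+1) x = 1 := by
      simp only [F]; rw [hf, rr_succ, mul_div_assoc, div_self (rr_pos S _).ne']; norm_num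
    have hW1 : x ∈ W S (m + 1 - 1) := Sh_sub_W S (m+1) h
    have hW0 : x ∈ W S (m-1) := W_anti S (by omega) hW1
    have v1 := valid_mk hW1
    have v0 := valid_mk (n := m) hW0
    rw [e1, e2, (gg_spec v0).2.1, (gg_spec v1).2.2.1]
    congr 1
    have hu := v1.sub_par (Cmp_self S hW1)
    have := v1.par.eq hu
    rw [← this]; simp

lemma T_mem {n : ℕ} {x : X} (h : x ∈ Sh S n) : T S x ∈ W S (n-1-1) := by
  rw [T_eq S h]
  have v := valid_mk (Sh_sub_W S n h)
  exact v.par.sub ((gg_spec v).2.2.2.1 _)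

lemma exists_Sh {x : X} (hx : x ≠ S.p) : ∃ n, x ∈ Sh S n := by
  obtain ⟨n, h1, h2⟩ := exists_level S hx
  exact ⟨n, subset_closure h2, h1⟩

lemma T_ne {x : X} (hx : x ≠ S.p) : T S x ≠ S.p := by
  obtain ⟨n, hn⟩ := exists_Sh S hx
  exact (T_mem S hn).2

lemma T_contOn (n : ℕ) : ContinuousOn (T S) (Sh S n) := by
  intro x hx
  have hW := Sh_sub_W S n hx
  have v := valid_mk hW
  have h1 : ContinuousWithinAt (fun y => gg S n (Cmp S (n-1) x) (F S n y)) (Sh S n) x :=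
    ((gg_spec v).1.comp (F_cont S n)).continuousWithinAt
  refine h1.congr_of_eventuallyEq ?_ (T_eq S hx)
  filter_upwards [self_mem_nhdsWithin, mem_nhdsWithin_of_mem_nhds ((Cmp_open S (n-1) x).mem_nhds (Cmp_self S hW))]
    with y hy hy'
  rw [T_eq S hy, Cmp_eq S hy']

lemma T_cont : Continuous (T S) := by
  rw [continuous_iff_continuousAt]
  intro x
  by_cases hx : x = S.p
  · subst hx
    rw [ContinuousAt, T_p]
    intro U hU
    obtain ⟨m, hm⟩ := V_nhds S hU
    rw [Filter.mem_map]
    filter_upwards [(V_open S (m+3)).mem_nhds (p_mem_V S _)] with y hy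
    apply hm
    by_cases hyp : y = S.p
    · rw [hyp, T_p]; exact p_mem_V S _
    · obtain ⟨n, hn⟩ := exists_Sh S hyp
      have : m + 3 ≤ n := by
        by_contra hh
        exact hn.2 (V_anti S (by omega) hy)
      exact V_anti S (by omega) (T_mem S hn).1
  · obtain ⟨m, h1, h2⟩ := exists_level S hx
    have hU : V S m ∩ (closure (V S (m+2)))ᶜ ∈ 𝓝 x :=
      ((V_open S m).inter isClosed_closure.isOpen_compl).mem_nhds ⟨h2, fun h => h1 (V_cl_sub S (m+1) h)⟩
    have hs : V S m ∩ (closure (V S (m+2)))ᶜ ⊆ Sh S m ∪ Sh S (m+1) := by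
      rintro y ⟨k1, k2⟩
      by_cases hy : y ∈ V S (m+1)
      · exact Or.inr ⟨subset_closure hy, fun h => k2 (subset_closure h)⟩
      · exact Or.inl ⟨subset_closure k1, hy⟩
    have hc : ContinuousOn (T S) (Sh S m ∪ Sh S (m+1)) :=
      (T_contOn S m).union_of_isClosed (T_contOn S (m+1)) (Sh_closed S _) (Sh_closed S _)
    exact hc.continuousAt (Filter.mem_of_superset hU hs)

def Cov (m : ℕ) (g : ℝ → X) (a b : ℝ) (g' : ℝ → X) (a' b' : ℝ) : Prop :=
  ∀ c d, a' ≤ c → c < d → d ≤ b' → ∃ a1 b1, ∃ θ : ℝ → ℝ, a ≤ a1 ∧ a1 < b1 ∧ b1 ≤ b ∧ ContinuousOn θ (Icc a1 b1) ∧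
    (∀ t ∈ Icc a1 b1, θ t ∈ Icc c d) ∧ ((θ a1 = c ∧ θ b1 = d) ∨ (θ a1 = d ∧ θ b1 = c)) ∧
    ∀ t ∈ Icc a1 b1, (T S)^[m] (g t) = g' (θ t)

variable {S}

lemma Cov.trans {m m' : ℕ} {g g' g'' : ℝ → X} {a b a' b' a'' b'' : ℝ} (h : Cov S m g a b g' a' b')
    (h' : Cov S m' g' a' b' g'' a'' b'') : Cov S (m' + m) g a b g'' a'' b'' := by
  intro c d hc hcd hd
  obtain ⟨a1, b1, θ, k1, k2, k3, k4, k5, k6, k7⟩ := h' c d hc hcd hd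
  obtain ⟨a2, b2, η, l1, l2, l3, l4, l5, l6, l7⟩ := h a1 b1 k1 k2 k3
  refine ⟨a2, b2, θ ∘ η, l1, l2, l3, k4.comp l4 l5, fun t ht => k5 _ (l5 t ht), ?_, ?_⟩
  · simp only [Function.comp]
    rcases l6 with ⟨e1, e2⟩ | ⟨e1, e2⟩
    · rw [e1, e2]; exact k6
    · rw [e1, e2]; exact k6.symm.imp And.symm And.symm
  · intro t ht
    rw [Function.iterate_add_apply, l7 t ht, k7 _ (l5 t ht)]; rfl

lemma Trav.cov {g : ℝ → X} (hg : Continuous g) {a b : ℝ} {n : ℕ} {D : Set X} {lo hi : ℝ} (hD : Valid S n D)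
    (h : Trav S g a b n D lo hi) : Cov S 1 g a b (gg S n D) lo hi := by
  intro c d hc hcd hd
  obtain ⟨α, β, h1, h2, h3, h4, h5⟩ := h
  have hcont : ContinuousOn (fun t => F S n (g t)) (Icc α β) := ((F_cont S n).comp hg).continuousOn
  have hα : α ∈ Icc α β := ⟨le_rfl, h2.le⟩
  have hβ : β ∈ Icc α β := ⟨h2.le, le_rfl⟩
  have key : ∃ a1 b1, α ≤ a1 ∧ a1 < b1 ∧ b1 ≤ β ∧ (∀ t ∈ Icc a1 b1, F S n (g t) ∈ Icc c d) ∧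
      ((F S n (g a1) = c ∧ F S n (g b1) = d) ∨ (F S n (g a1) = d ∧ F S n (g b1) = c)) := by
    rcases h5 with ⟨e1, e2⟩ | ⟨e1, e2⟩
    · exact ivt_sub hcont hα hβ hcd (e1.trans hc) (hd.trans e2)
    · exact ivt_sub hcont hβ hα hcd (e2.trans hc) (hd.trans e1)
  obtain ⟨a1, b1, k1, k2, k3, k4, k5⟩ := key
  refine ⟨a1, b1, fun t => F S n (g t), h1.trans k1, k2, k3.trans h3, hcont.mono (Icc_subset_Icc k1 k3), k4, k5, ?_⟩
  intro t ht
  obtain ⟨s1, s2⟩ := h4 t ⟨k1.trans ht.1, ht.2.trans k3⟩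
  rw [Function.iterate_one, T_eq S s1, hD.eq s2]

lemma cov_self {n : ℕ} {D : Set X} (h : Valid S n D) : Cov S 1 (gg S n D) 0 (1/2) (gg S n D) 0 (1/2) :=
  ((gg_spec h).2.2.2.2.1 0 (1/2) (by norm_num)).1.cov (gg_spec h).1 h

lemma cov_par {n : ℕ} {D : Set X} (h : Valid S n D) :
    Cov S 1 (gg S n D) 0 (1/2) (gg S (n-1) (par S n D)) 0 (1/2) :=
  ((gg_spec h).2.2.2.2.1 0 (1/2) (by norm_num)).2.1.cov (gg_spec h).1 h.par

lemma cov_child {n : ℕ} {D D' : Set X} (h : Valid S n D) (h' : Valid S (n+1) D') (hs : D' ⊆ D) :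
    Cov S 1 (gg S n D) 0 (1/2) (gg S (n+1) D') 0 (1/2) :=
  ((gg_spec h).2.2.2.2.1 0 (1/2) (by norm_num)).2.2.1 D' h' hs |>.cov (gg_spec h).1 h'

lemma valid_zero {D : Set X} (h : Valid S 0 D) : D = W S 0 := by
  obtain ⟨x, hx, rfl⟩ := h; exact Cmp_zero S hx

lemma cov_root (n : ℕ) : ∀ D, Valid S n D → ∃ m, Cov S m (gg S n D) 0 (1/2) (gg S 0 (W S 0)) 0 (1/2) := by
  induction n with
  | zero => intro D h; exact ⟨1, by have := cov_self h; rwa [valid_zero h] at this ⊢⟩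
  | succ n ih =>
    intro D h
    obtain ⟨m, hm⟩ := ih _ h.par
    exact ⟨_, (cov_par h).trans hm⟩

lemma root_cov (n : ℕ) : ∀ D, Valid S n D → ∃ m, Cov S m (gg S 0 (W S 0)) 0 (1/2) (gg S n D) 0 (1/2) := by
  induction n with
  | zero => intro D h; exact ⟨1, by have := cov_self h; rwa [valid_zero h] at this ⊢⟩
  | succ n ih =>
    intro D h
    obtain ⟨m, hm⟩ := ih _ h.par
    exact ⟨_, hm.trans (cov_child h.par h h.sub_par)⟩

lemma cov_all {n n' : ℕ} {D D' : Set X} (h : Valid S n D) (h' : Valid S n' D') :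
    ∃ m0, ∀ m ≥ m0, Cov S m (gg S n D) 0 (1/2) (gg S n' D') 0 (1/2) := by
  obtain ⟨m1, h1⟩ := cov_root n D h
  obtain ⟨m2, h2⟩ := root_cov n' D' h'
  refine ⟨m2 + m1, fun m hm => ?_⟩
  induction m, hm using Nat.le_induction with
  | base => exact h1.trans h2
  | succ m _ ih => have := ih.trans (cov_self h'); rwa [add_comm] at this

lemma expand (k : ℕ) : ∀ n D a b, Valid S n D → -1 ≤ a → b ≤ 1 → 2 < (b - a) * 2 ^ k →
    ∃ m n' D', Valid S n' D' ∧ Cov S m (gg S n D) a b (gg S n' D') 0 (1/2) := by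
  induction k with
  | zero => intro n D a b _ h1 h2 h3; simp only [pow_zero] at h3; linarith
  | succ k ih =>
    intro n D a b hv h1 h2 h3
    have hab : a < b := by
      by_contra hh
      have : (b - a) * 2 ^ (k+1) ≤ 0 := mul_nonpos_of_nonpos_of_nonneg (by linarith) (by positivity)
      linarith
    rcases (gg_spec hv).2.2.2.2.2 a b hab with ht | ⟨n', D', lo, hi, v, l1, l2, l3, ht⟩
    · exact ⟨1, n, D, hv, ht.cov (gg_spec hv).1 hv⟩
    · have : 2 < (hi - lo) * 2 ^ k := by
        have : 2 * (b-a) * 2 ^ k ≤ (hi - lo) * 2 ^ k := by gcongr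
        rw [pow_succ] at h3
        linarith
      obtain ⟨m, n'', D'', v', hc⟩ := ih n' D' lo hi v l1 l2 this
      exact ⟨_, n'', D'', v', (ht.cov (gg_spec hv).1 v).trans hc⟩

lemma cov_from {n n' : ℕ} {D D' : Set X} (h : Valid S n D) (h' : Valid S n' D') {a b : ℝ} (ha : -1 ≤ a) (hb : b ≤ 1)
    (hab : a < b) : ∃ m0, ∀ m ≥ m0, Cov S m (gg S n D) a b (gg S n' D') 0 (1/2) := by
  have hpos : 0 < b - a := sub_pos.2 hab
  obtain ⟨k, hk⟩ := pow_unbounded_of_one_lt (2 / (b - a)) (by norm_num : (1:ℝ) < 2)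
  rw [div_lt_iff₀ hpos] at hk
  obtain ⟨m, n1, D1, v1, hc⟩ := expand k n D a b h ha hb (by linarith)
  obtain ⟨m0, hm0⟩ := cov_all v1 h'
  refine ⟨m0 + m, fun j hj => ?_⟩
  have := hc.trans (hm0 (j - m) (by omega))
  rwa [Nat.sub_add_cancel (by omega)] at this

variable (S)

lemma open_contains {U : Set X} (hU : IsOpen U) (hne : U.Nonempty) :
    ∃ n D a b, Valid S n D ∧ 0 ≤ a ∧ a < b ∧ b ≤ 1/2 ∧ ∀ t ∈ Icc a b, gg S n D t ∈ U := by
  obtain ⟨x, hxU, hxp⟩ : ∃ x ∈ U, x ≠ S.p := by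
    by_contra hcon
    push Not at hcon
    have : U = {S.p} := by
      obtain ⟨y, hy⟩ := hne
      refine Subset.antisymm (fun z hz => hcon z hz) ?_
      rintro z rfl
      rw [← hcon y hy]; exact hy
    have h1 : IsClopen ({S.p} : Set X) := ⟨isClosed_singleton, this ▸ hU⟩
    have h2 := h1.eq_univ (singleton_nonempty _)
    exact xm_ne S (by have : xm S ∈ ({S.p} : Set X) := by rw [h2]; trivial
                      exact this)
  obtain ⟨n, hn⟩ := exists_Sh S hxp
  have hW := Sh_sub_W S n hn
  have v := valid_mk hW
  obtain ⟨t, ht, e⟩ := ((gg_spec v).2.2.2.2.1 0 (1/2) (by norm_num)).2.2.2 x ⟨hn, Cmp_self S hW⟩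
  obtain ⟨δ, hδ, hball⟩ := Metric.isOpen_iff.1 (hU.preimage (gg_spec v).1) t (by rw [mem_preimage, e]; exact hxU)
  refine ⟨n, Cmp S (n-1) x, ?_⟩
  rcases ht.2.lt_or_eq with h | h
  · refine ⟨t, min (1/2) (t + δ/2), v, ht.1, lt_min h (by linarith), min_le_left _ _, fun x hx => hball ?_⟩
    have := hx.2.trans (min_le_right _ _)
    rw [Metric.mem_ball, Real.dist_eq, abs_lt]; constructor <;> linarith [hx.1]
  · refine ⟨max 0 (t - δ/2), t, v, le_max_left _ _, max_lt (by linarith) (by linarith), ht.2, fun x hx => hball ?_⟩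
    have := (le_max_right _ _).trans hx.1
    rw [Metric.mem_ball, Real.dist_eq, abs_lt]; constructor <;> linarith [hx.2]

lemma T_mixing {U V : Set X} (hU : IsOpen U) (hU' : U.Nonempty) (hV : IsOpen V) (hV' : V.Nonempty) :
    ∃ n₀, ∀ n ≥ n₀, ((T S)^[n] '' U ∩ V).Nonempty := by
  obtain ⟨n, D, a, b, v, h1, h2, h3, h4⟩ := open_contains S hU hU'
  obtain ⟨n', D', a', b', v', h1', h2', h3', h4'⟩ := open_contains S hV hV'
  obtain ⟨m0, hm⟩ := cov_from v v' (by linarith) (by linarith) h2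
  refine ⟨m0, fun m hmm => ?_⟩
  obtain ⟨a1, b1, θ, k1, k2, k3, k4, k5, k6, k7⟩ := hm m hmm a' b' h1' h2' h3'
  have ha1 : a1 ∈ Icc a1 b1 := ⟨le_rfl, k2.le⟩
  exact ⟨_, ⟨_, h4 a1 ⟨k1, k2.le.trans k3⟩, rfl⟩, by rw [k7 a1 ha1]; exact h4' _ (k5 a1 ha1)⟩

lemma T_per : Dense {z : X | ∃ n : ℕ, 1 ≤ n ∧ (T S)^[n] z = z} := by
  rw [dense_iff_inter_open]
  intro U hU hU'
  obtain ⟨n, D, a, b, v, h1, h2, h3, h4⟩ := open_contains S hU hU'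
  obtain ⟨m0, hm⟩ := cov_from v v (by linarith) (by linarith) h2
  obtain ⟨a1, b1, θ, k1, k2, k3, k4, k5, k6, k7⟩ := hm (m0 + 1) (by omega) a b h1 h2 h3
  have ha1 : a1 ∈ Icc a1 b1 := ⟨le_rfl, k2.le⟩
  have hb1 : b1 ∈ Icc a1 b1 := ⟨k2.le, le_rfl⟩
  have hc : ContinuousOn (fun t => θ t - t) (Icc a1 b1) := k4.sub continuousOn_id
  obtain ⟨t, ht, e⟩ : ∃ t ∈ Icc a1 b1, θ t - t = 0 := by
    rcases k6 with ⟨e1, e2⟩ | ⟨e1, e2⟩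
    · exact isPreconnected_Icc.intermediate_value ha1 hb1 hc ⟨by rw [e1]; linarith, by rw [e2]; linarith⟩
    · exact isPreconnected_Icc.intermediate_value hb1 ha1 hc ⟨by rw [e2]; linarith, by rw [e1]; linarith⟩
  refine ⟨gg S n D t, h4 t ⟨k1.trans ht.1, ht.2.trans k3⟩, m0 + 1, by omega, ?_⟩
  rw [k7 t ht, sub_eq_zero.1 e]

lemma T_surj : Function.Surjective (T S) := by
  have hcl : IsClosed (range (T S)) := (isCompact_range (T_cont S)).isClosed
  rw [← range_eq_univ, ← hcl.closure_eq, ← dense_iff_closure_eq, dense_iff_inter_open]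
  intro V hV hV'
  obtain ⟨n0, h⟩ := T_mixing S isOpen_univ univ_nonempty hV hV'
  obtain ⟨y, ⟨x, -, rfl⟩, hy⟩ := h (n0+1) (by omega)
  refine ⟨_, hy, ?_⟩
  rw [Function.iterate_succ_apply']
  exact mem_range_self _

lemma T_iter_ne (n : ℕ) {x : X} (hx : x ≠ S.p) : (T S)^[n] x ≠ S.p := by
  induction n with
  | zero => exact hx
  | succ n ih => rw [Function.iterate_succ_apply']; exact T_ne S ih

end TT
end PureMix

/-- Every nondegenerate Peano continuum admits a pure mixing (mixing but not
exact) continuous surjection with a dense set of periodic points. -/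
theorem exists_pure_mixing_map {X : Type*} [MetricSpace X] [CompactSpace X]
    [ConnectedSpace X] [LocallyConnectedSpace X] [Nontrivial X] :
    ∃ T : X → X, Continuous T ∧ Function.Surjective T ∧ TopMixing T ∧
      ¬ TopExact T ∧ Dense {z : X | ∃ n : ℕ, 1 ≤ n ∧ T^[n] z = z} := by
  obtain ⟨S⟩ := PureMix.exists_setup X
  refine ⟨PureMix.T S, PureMix.T_cont S, PureMix.T_surj S, fun U V hU hV hU' hV' => PureMix.T_mixing S hU hU' hV hV', ?_, PureMix.T_per S⟩
  intro hex
  obtain ⟨n, hn⟩ := hex {S.p}ᶜ isOpen_compl_singleton ⟨PureMix.xm S, PureMix.xm_ne S⟩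
  have : S.p ∈ (PureMix.T S)^[n] '' {S.p}ᶜ := by rw [hn]; trivial
  obtain ⟨x, hx, e⟩ := this
  exact PureMix.T_iter_ne S n hx e
end

section
/- Let X be a nondegenerate continuum, Y a Peano continuum, x₁, …, xₙ distinct points of X, and y₁, …, yₙ arbitrary points of Y. Then there is a continuous surjection f : X → Y with f(xᵢ) = yᵢ for every 1 ≤ i ≤ n. -/
open Set Topology

theorem pc_chain {Y : Type*} [MetricSpace Y] [LocallyConnectedSpace Y] (V : Set Y) (hV : IsOpen V)
    (hc : IsPreconnected V) (p q : Y) (hp : p ∈ V) (hq : q ∈ V) (ε : ℝ) (hε : 0 < ε) :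
    ∃ (k : ℕ) (P : ℕ → Y) (W : ℕ → Set Y), P 0 = p ∧ (∀ r, k ≤ r → P r = q) ∧
      ∀ r, IsOpen (W r) ∧ IsPreconnected (W r) ∧ W r ⊆ V ∧ (∀ x ∈ W r, ∀ y ∈ W r, dist x y ≤ ε) ∧
        P r ∈ W r ∧ P (r+1) ∈ W r := by
  have small : ∀ x ∈ V, ∃ W, IsOpen W ∧ IsPreconnected W ∧ W ⊆ V ∧
      (∀ x ∈ W, ∀ y ∈ W, dist x y ≤ ε) ∧ x ∈ W := by
    intro x hx
    have h1 : V ∩ Metric.ball x (ε/2) ∈ 𝓝 x :=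
      Filter.inter_mem (hV.mem_nhds hx) (Metric.ball_mem_nhds x (by positivity))
    obtain ⟨W, hW, ho, hx, hcn⟩ := locallyConnectedSpace_iff_subsets_isOpen_isConnected.1 inferInstance x _ h1
    refine ⟨W, ho, hcn.isPreconnected, fun y hy => (hW hy).1, ?_, hx⟩
    intro a ha b hb
    have h1 := Metric.mem_ball.1 (hW ha).2
    have h2 := Metric.mem_ball.1 (hW hb).2
    have := dist_triangle_right a b x
    linarith
  let R : Y → Y → Prop := fun a b => ∃ W, IsOpen W ∧ IsPreconnected W ∧ W ⊆ V ∧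
      (∀ x ∈ W, ∀ y ∈ W, dist x y ≤ ε) ∧ a ∈ W ∧ b ∈ W
  have Rs : ∀ a b, R a b → R b a := by
    rintro a b ⟨W, h1, h2, h3, h4, h5, h6⟩
    exact ⟨W, h1, h2, h3, h4, h6, h5⟩
  have key : Relation.ReflTransGen R p q := by
    refine IsPreconnected.induction₂ hc (Relation.ReflTransGen R) ?_ ?_ ?_ hp hq
    · intro x hx
      obtain ⟨W, h1, h2, h3, h4, h5⟩ := small x hx
      filter_upwards [mem_nhdsWithin_of_mem_nhds (h1.mem_nhds h5)] with y hy
      exact Relation.ReflTransGen.single ⟨W, h1, h2, h3, h4, h5, hy⟩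
    · intro x y z _ _ _ h1 h2
      exact h1.trans h2
    · intro x y _ _ h
      induction h with
      | refl => exact Relation.ReflTransGen.refl
      | tail _ h2 ih => exact Relation.ReflTransGen.head (Rs _ _ h2) (ih (by obtain ⟨W, _, _, h3, _, h5, _⟩ := h2; exact h3 h5))
  clear hq
  induction key with
  | refl =>
    obtain ⟨W, h1, h2, h3, h4, h5⟩ := small p hp
    exact ⟨0, fun _ => p, fun _ => W, rfl, fun _ _ => rfl, fun _ => ⟨h1, h2, h3, h4, h5, h5⟩⟩
  | @tail b c hb hbc ih =>
    obtain ⟨k, P, W, hP0, hPk, hW⟩ := ih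
    obtain ⟨U, h1, h2, h3, h4, h5, h6⟩ := hbc
    refine ⟨k+1, fun r => if r ≤ k then P r else c, fun r => if r < k then W r else U, by simp [hP0],
      fun r hr => if_neg (by omega), ?_⟩
    intro r
    rcases lt_trichotomy r k with h | h | h
    · have e1 : r ≤ k := h.le
      have e2 : r + 1 ≤ k := h
      simpa only [if_pos h, if_pos e1, if_pos e2] using hW r
    · subst h
      simp only [lt_irrefl, if_false, le_refl, if_true]
      rw [if_neg (by omega), hPk r le_rfl]
      exact ⟨h1, h2, h3, h4, h5, h6⟩
    · simp only [if_neg (not_lt.2 h.le), if_neg (not_le.2 h)]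
      rw [if_neg (by omega)]
      exact ⟨h1, h2, h3, h4, h6, h6⟩

structure PCState (Y : Type*) where
  N : ℕ
  P : ℕ → Y
  V : ℕ → Set Y

structure PCGood {Y : Type*} [MetricSpace Y] (s : PCState Y) : Prop where
  pos : 0 < s.N
  op : ∀ j, IsOpen (s.V j)
  con : ∀ j, IsPreconnected (s.V j)
  left : ∀ j, s.P j ∈ s.V j
  right : ∀ j, s.P (j+1) ∈ s.V j
  fin : (range fun j => (s.P j, s.V j)).Finite

theorem pc_step {Y : Type*} [MetricSpace Y] [LocallyConnectedSpace Y] (s : PCState Y) (hs : PCGood s)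
    (ε : ℝ) (hε : 0 < ε) : ∃ s' : PCState Y, PCGood s' ∧
      (∀ j, ∀ x ∈ s'.V j, ∀ y ∈ s'.V j, dist x y ≤ ε) ∧
      ∃ k, 0 < k ∧ s'.N = s.N * k ∧ (∀ j, s'.P (k * j) = s.P j) ∧ ∀ i, s'.V i ⊆ s.V (i / k) := by
  have H : ∀ τ : (Y × Set Y) × Y, ∃ (k : ℕ) (P : ℕ → Y) (W : ℕ → Set Y),
      IsOpen τ.1.2 → IsPreconnected τ.1.2 → τ.1.1 ∈ τ.1.2 → τ.2 ∈ τ.1.2 → 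
      P 0 = τ.1.1 ∧ (∀ r, k ≤ r → P r = τ.2) ∧
      ∀ r, IsOpen (W r) ∧ IsPreconnected (W r) ∧ W r ⊆ τ.1.2 ∧ (∀ x ∈ W r, ∀ y ∈ W r, dist x y ≤ ε) ∧
        P r ∈ W r ∧ P (r+1) ∈ W r := by
    intro τ
    by_cases h : IsOpen τ.1.2 ∧ IsPreconnected τ.1.2 ∧ τ.1.1 ∈ τ.1.2 ∧ τ.2 ∈ τ.1.2
    · obtain ⟨k, P, W, h'⟩ := pc_chain τ.1.2 h.1 h.2.1 τ.1.1 τ.2 h.2.2.1 h.2.2.2 ε hε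
      exact ⟨k, P, W, fun _ _ _ _ => h'⟩
    · exact ⟨0, fun _ => τ.2, fun _ => ∅, fun a b c d => absurd ⟨a, b, c, d⟩ h⟩
  choose K P W hPW using H
  let τ : ℕ → (Y × Set Y) × Y := fun j => ((s.P j, s.V j), s.P (j+1))
  have hτ : (range τ).Finite := by
    refine (hs.fin.prod (hs.fin.image Prod.fst)).subset ?_
    rintro _ ⟨j, rfl⟩
    exact ⟨⟨j, rfl⟩, ⟨_, ⟨j+1, rfl⟩, rfl⟩⟩
  have G := fun j => hPW (τ j) (hs.op j) (hs.con j) (hs.left j) (hs.right j)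
  obtain ⟨k0, hk0⟩ := (hτ.image K).bddAbove
  have hk : ∀ j, K (τ j) ≤ k0 + 1 := fun j => 
    (hk0 ⟨τ j, ⟨j, rfl⟩, rfl⟩ : K (τ j) ≤ k0).trans (Nat.le_succ _)
  generalize hkk : k0 + 1 = k at hk
  have kpos : 0 < k := by omega
  refine ⟨⟨s.N * k, fun i => P (τ (i / k)) (i % k), fun i => W (τ (i/k)) (i % k)⟩, 
    ⟨Nat.mul_pos hs.pos kpos, fun i => ((G _).2.2 _).1, fun i => ((G _).2.2 _).2.1, 
     fun i => ((G _).2.2 _).2.2.2.2.1, ?_, ?_⟩, fun i => ((G _).2.2 _).2.2.2.1, k, kpos, rfl, ?_, 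
      fun i => ((G _).2.2 _).2.2.1⟩
  · intro i
    have h := ((G (i/k)).2.2 (i%k)).2.2.2.2.2
    have hm := Nat.mod_lt i kpos
    have hd := Nat.div_add_mod i k
    by_cases h' : i % k + 1 < k
    · have e1 : (i+1)/k = i/k := by
        rw [Nat.div_eq_iff kpos]; rw [mul_comm (i/k) k]; omega
      have e2 : (i+1)%k = i%k+1 := by
        have := Nat.div_add_mod (i+1) k
        rw [e1] at this; omega
      simpa only [e1, e2] using h
    · have e0 : i + 1 = k * (i/k+1) := by rw [mul_add]; omega
      have e1 : (i+1)/k = i/k+1 := by rw [e0, Nat.mul_div_cancel_left _ kpos]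
      have e2 : (i+1)%k = 0 := by rw [e0, Nat.mul_mod_right]
      have e3 : i % k + 1 = k := by omega
      rw [e3, (G (i/k)).2.1 k (hk _)] at h
      show P (τ ((i+1)/k)) ((i+1)%k) ∈ _
      rw [e1, e2, (G _).1]
      exact h
  · refine ((hτ.prod (Set.finite_lt_nat k)).image fun z => (P z.1 z.2, W z.1 z.2)).subset ?_
    rintro _ ⟨i, rfl⟩
    exact ⟨(τ (i/k), i%k), ⟨⟨_, rfl⟩, Nat.mod_lt i kpos⟩, rfl⟩
  · intro j
    show P (τ (k*j/k)) (k*j%k) = _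
    rw [Nat.mul_div_cancel_left _ kpos, Nat.mul_mod_right, (G _).1]

theorem pc_path {Y : Type*} [MetricSpace Y] [CompactSpace Y] [LocallyConnectedSpace Y] (V : Set Y) (hV : IsOpen V)
    (hc : IsPreconnected V) (p q : Y) (hp : p ∈ V) (hq : q ∈ V) :
    ∃ f : ℝ → Y, Continuous f ∧ f 0 = p ∧ f 1 = q ∧ ∀ t, f t ∈ closure V := by
  let s0 : {s : PCState Y // PCGood s} := ⟨⟨1, fun j => if j = 0 then p else q, fun _ => V⟩, by
    refine ⟨one_pos, fun _ => hV, fun _ => hc, ?_, ?_, ?_⟩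
    · intro j; dsimp only; split_ifs <;> assumption
    · intro j; simpa using hq
    · refine (Set.toFinite {(p, V), (q, V)}).subset ?_
      rintro _ ⟨j, rfl⟩
      dsimp only; split_ifs <;> simp⟩
  have H : ∀ (n : ℕ) (s : {s : PCState Y // PCGood s}), ∃ s' : {s : PCState Y // PCGood s}, 
      (∀ j, ∀ x ∈ s'.1.V j, ∀ y ∈ s'.1.V j, dist x y ≤ (1/2)^n) ∧
      ∃ k, 0 < k ∧ s'.1.N = s.1.N * k ∧ (∀ j, s'.1.P (k * j) = s.1.P j) ∧ ∀ i, s'.1.V i ⊆ s.1.V (i / k) := by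
    intro n s
    obtain ⟨s', h, h'⟩ := pc_step s.1 s.2 ((1/2)^n) (by positivity)
    exact ⟨⟨s', h⟩, h'⟩
  choose nx hsm k kpos hN hP hVs using H
  let S : ℕ → {s : PCState Y // PCGood s} := fun n => Nat.rec s0 (fun n s => nx n s) n
  have hS : ∀ n, S (n+1) = nx n (S n) := fun n => rfl
  let I : ℕ → ℝ → ℕ := fun n t => ⌊t * (S n).1.N⌋₊
  have hI : ∀ n t, I (n+1) t / k n (S n) = I n t := by
    intro n t
    have hk : (k n (S n) : ℝ) ≠ 0 := by exact_mod_cast (kpos n (S n)).ne'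
    simp only [I]
    rw [← Nat.floor_div_natCast, hS, hN]
    congr 1
    push_cast
    field_simp
  let A : ℕ → ℝ → Set Y := fun n t => (S n).1.V (I n t)
  have hA : ∀ n t, A (n+1) t ⊆ A n t := by
    intro n t
    have := hVs n (S n) (I (n+1) t)
    rw [hI] at this
    exact this
  have hAm : ∀ n m t, n ≤ m → A m t ⊆ A n t := by
    intro n m t h
    induction h with
    | refl => exact subset_rfl
    | step _ ih => exact (hA _ t).trans ih
  let g : ℕ → ℝ → Y := fun n t => (S n).1.P (I n t)
  have hg : ∀ n t, g n t ∈ A n t := fun n t => (S n).2.left _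
  have hlim : ∀ t, ∃ y, ∀ n, y ∈ closure (A n t) := by
    intro t
    have := IsCompact.nonempty_iInter_of_sequence_nonempty_isCompact_isClosed (fun n => closure (A n t))
      (fun n => closure_mono (hA n t)) (fun n => ⟨_, subset_closure (hg n t)⟩) isClosed_closure.isCompact
      (fun n => isClosed_closure)
    obtain ⟨y, hy⟩ := this
    exact ⟨y, fun n => mem_iInter.1 hy n⟩
  choose f hf using hlim
  have hsmall : ∀ n j, ∀ x ∈ closure ((S (n+1)).1.V j), ∀ y ∈ closure ((S (n+1)).1.V j), dist x y ≤ (1/2)^n := by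
    intro n j x hx y hy
    have h1 : Metric.ediam ((S (n+1)).1.V j) ≤ ENNReal.ofReal ((1/2)^n) := by
      apply Metric.ediam_le
      intro a ha b hb
      rw [edist_dist]
      exact ENNReal.ofReal_le_ofReal (hsm n (S n) j a ha b hb)
    rw [← Metric.ediam_closure] at h1
    have h2 := (Metric.edist_le_ediam_of_mem hx hy).trans h1
    rwa [edist_dist, ENNReal.ofReal_le_ofReal_iff (by positivity)] at h2
  have huniq : ∀ t y, (∀ n, y ∈ closure (A n t)) → f t = y := by
    intro t y hy
    refine dist_le_zero.1 (ge_of_tendsto' (tendsto_pow_atTop_nhds_zero_of_lt_one (r := (1/2:ℝ)) (by norm_num) (by norm_num)) fun n => ?_)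
    exact hsmall n _ _ (hf t (n+1)) _ (hy (n+1))
  refine ⟨f, ?_, ?_, ?_, fun t => hf t 0⟩
  · rw [Metric.continuous_iff]
    intro t ε hε
    obtain ⟨n, hn⟩ := exists_pow_lt_of_lt_one (show 0 < ε / 2 by positivity) (show (1/2:ℝ) < 1 by norm_num)
    have Npos : (0:ℝ) < (S (n+1)).1.N := by exact_mod_cast (S (n+1)).2.pos
    refine ⟨1 / (S (n+1)).1.N, by positivity, ?_⟩
    have main : ∀ a b : ℝ, a ≤ b → b - a < 1 / (S (n+1)).1.N → dist (f a) (f b) < ε := by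
      intro a b hab hlt
      have h1 : I (n+1) a ≤ I (n+1) b := Nat.floor_le_floor (by gcongr)
      have h2 : I (n+1) b ≤ I (n+1) a + 1 := by
        rw [lt_div_iff₀ Npos] at hlt
        have h3 := Nat.lt_floor_add_one (a * (S (n+1)).1.N)
        have : b * (S (n+1)).1.N < ((I (n+1) a + 1 + 1 : ℕ):ℝ) := by
          push_cast
          simp only [I]
          linarith
        have := Nat.floor_lt' (by omega) |>.2 this
        simp only [I] at this ⊢
        omega
      rcases (by omega : I (n+1) b = I (n+1) a ∨ I (n+1) b = I (n+1) a + 1) with h | h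
      · have h4 := hf b (n+1)
        simp only [A] at h4
        rw [h] at h4
        have := hsmall n _ _ (hf a (n+1)) _ h4
        linarith
      · have h5 := hsmall n _ _ (hf a (n+1)) _ (subset_closure ((S (n+1)).2.right _))
        have h6 := hsmall n _ _ (hf b (n+1)) _ (subset_closure (hg (n+1) b))
        simp only [g] at h6
        rw [h] at h6
        have := dist_triangle_right (f a) (f b) ((S (n+1)).1.P (I (n+1) a + 1))
        linarith
    intro b hb
    rw [Real.dist_eq] at hb
    rcases le_total b t with h | h
    · exact main b t h (by rw [abs_sub_comm] at hb; exact (le_abs_self _).trans_lt hb)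
    · rw [dist_comm]; exact main t b h ((le_abs_self _).trans_lt hb)
  · apply huniq
    intro n
    have : g n 0 = p := by
      induction n with
      | zero => simp [g, I, S, s0]
      | succ n ih =>
        have := hP n (S n) 0
        simp only [g, I, zero_mul, Nat.floor_zero] at ih ⊢
        rw [← ih, ← this, mul_zero, hS]
    rw [← this]; exact subset_closure (hg n 0)
  · apply huniq
    intro n
    have : g n 1 = q := by
      induction n with
      | zero => simp [g, I, S, s0]
      | succ n ih =>
        have := hP n (S n) (S n).1.N
        simp only [g, I, one_mul, Nat.floor_natCast] at ih ⊢
        rw [← ih, ← this, hS, hN, mul_comm]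
    rw [← this]; exact subset_closure (hg n 1)

theorem pc_gamma {Y : Type*} [MetricSpace Y] [CompactSpace Y] [ConnectedSpace Y]
    [LocallyConnectedSpace Y] : ∃ γ : Y → Y → ℝ → Y, (∀ p q, Continuous (γ p q)) ∧ (∀ p q, γ p q 0 = p) ∧
      (∀ p q, γ p q 1 = q) ∧ (∀ p t, γ p p t = p) ∧
      ∀ ε > 0, ∃ δ > 0, ∀ p q, dist p q < δ → ∀ t, dist p (γ p q t) ≤ ε := by
  have H : ∀ p q : Y, ∃ f : ℝ → Y, (Continuous f ∧ f 0 = p ∧ f 1 = q) ∧ (p = q → ∀ t, f t = p) ∧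
      ∀ r, ∀ g : ℝ → Y, Continuous g → g 0 = p → g 1 = q → (∀ t, dist p (g t) ≤ r) →
        ∀ t, dist p (f t) ≤ 2 * r := by
    intro p q
    by_cases hpq : p = q
    · subst hpq
      refine ⟨fun _ => p, ⟨continuous_const, rfl, rfl⟩, fun _ _ => rfl, ?_⟩
      intro r g _ _ _ h _
      have := (dist_nonneg).trans (h 0)
      simp only [dist_self]; linarith
    · let T : Set ℝ := {r | ∃ g : ℝ → Y, Continuous g ∧ g 0 = p ∧ g 1 = q ∧ ∀ t, dist p (g t) ≤ r}
      have hb : ∀ r ∈ T, dist p q ≤ r := by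
        rintro r ⟨g, _, _, h1, h⟩
        rw [← h1]; exact h 1
      have hne : T.Nonempty := by
        obtain ⟨g, h1, h2, h3, _⟩ := pc_path (univ : Set Y) isOpen_univ isPreconnected_univ p q trivial trivial
        exact ⟨Metric.diam (univ : Set Y), g, h1, h2, h3, fun t => 
          Metric.dist_le_diam_of_mem isCompact_univ.isBounded trivial trivial⟩
      have hpos : 0 < sInf T := (dist_pos.2 hpq).trans_le (le_csInf hne hb)
      obtain ⟨r0, ⟨g, g1, g2, g3, g4⟩, hr⟩ := exists_lt_of_csInf_lt hne (show sInf T < 2 * sInf T by linarith)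
      refine ⟨g, ⟨g1, g2, g3⟩, fun h => absurd h hpq, ?_⟩
      intro r g' h1 h2 h3 h4 t
      have : sInf T ≤ r := csInf_le ⟨_, hb⟩ ⟨g', h1, h2, h3, h4⟩
      linarith [g4 t]
  choose γ h1 h2 h3 using H
  refine ⟨γ, fun p q => (h1 p q).1, fun p q => (h1 p q).2.1, fun p q => (h1 p q).2.2, 
    fun p t => h2 p p rfl t, ?_⟩
  intro ε hε
  have hcov : ∀ x : Y, ∃ W, IsOpen W ∧ IsPreconnected W ∧ x ∈ W ∧ W ⊆ Metric.ball x (ε/4) := by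
    intro x
    obtain ⟨W, hW, ho, hx, hcn⟩ := locallyConnectedSpace_iff_subsets_isOpen_isConnected.1 inferInstance x _
      (Metric.ball_mem_nhds x (show 0 < ε/4 by positivity))
    exact ⟨W, ho, hcn.isPreconnected, hx, hW⟩
  choose W w1 w2 w3 w4 using hcov
  obtain ⟨δ, hδ, hL⟩ := lebesgue_number_lemma_of_metric (isCompact_univ (X := Y)) w1 
    (fun x _ => mem_iUnion.2 ⟨x, w3 x⟩)
  refine ⟨δ, hδ, ?_⟩
  intro p q hpq t
  obtain ⟨x, hx⟩ := hL p trivial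
  have hp := hx (Metric.mem_ball_self hδ)
  have hq := hx (Metric.mem_ball'.2 hpq)
  obtain ⟨g, g1, g2, g3, g4⟩ := pc_path _ (w1 x) (w2 x) p q hp hq
  have := h3 p q (ε/2) g g1 g2 g3 ?_ t
  · linarith
  intro t
  have a := closure_mono (w4 x) (g4 t)
  have a := Metric.closure_ball_subset_closedBall a
  have b := Metric.mem_ball.1 (w4 x hp)
  have a := Metric.mem_closedBall.1 a
  have := dist_triangle_right p (g t) x
  linarith

theorem pc_extend {Y : Type*} [MetricSpace Y] [CompactSpace Y] [ConnectedSpace Y]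
    [LocallyConnectedSpace Y] (K : Set ℝ) (hK : IsClosed K) (hl : ∀ t, ∃ k ∈ K, k ≤ t)
    (hu : ∀ t, ∃ k ∈ K, t ≤ k) (φ : ℝ → Y) (hφ : ContinuousOn φ K) :
    ∃ f : ℝ → Y, Continuous f ∧ ∀ t ∈ K, f t = φ t := by
  obtain ⟨γ, γc, γ0, γ1, γs, γu⟩ := pc_gamma (Y := Y)
  have HA : ∀ t, ∃ a ∈ K, a ≤ t ∧ ∀ k ∈ K, k ≤ t → k ≤ a := by
    intro t
    obtain ⟨k, hk, hkt⟩ := hl t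
    have bd : BddAbove (K ∩ Iic t) := ⟨t, fun _ h => h.2⟩
    have := (hK.inter isClosed_Iic).csSup_mem ⟨k, hk, hkt⟩ bd
    exact ⟨_, this.1, this.2, fun k h1 h2 => le_csSup bd ⟨h1, h2⟩⟩
  have HB : ∀ t, ∃ a ∈ K, t ≤ a ∧ ∀ k ∈ K, t ≤ k → a ≤ k := by
    intro t
    obtain ⟨k, hk, hkt⟩ := hu t
    have bd : BddBelow (K ∩ Ici t) := ⟨t, fun _ h => h.2⟩
    have := (hK.inter isClosed_Ici).csInf_mem ⟨k, hk, hkt⟩ bd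
    exact ⟨_, this.1, this.2, fun k h1 h2 => csInf_le bd ⟨h1, h2⟩⟩
  choose A AK At Am using HA
  choose B BK Bt Bm using HB
  have gapA : ∀ a ∈ K, ∀ b, (∀ k ∈ K, k ≤ a ∨ b ≤ k) → ∀ s, a ≤ s → s < b → A s = a := by
    intro a ha b h s h1 h2
    apply le_antisymm _ (Am s a ha h1)
    rcases h _ (AK s) with h3 | h3
    · exact h3
    · linarith [At s]
  have gapB : ∀ a, ∀ b ∈ K, (∀ k ∈ K, k ≤ a ∨ b ≤ k) → ∀ s, a < s → s ≤ b → B s = b := by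
    intro a b hb h s h1 h2
    apply le_antisymm (Bm s b hb h2) 
    rcases h _ (BK s) with h3 | h3
    · linarith [Bt s]
    · exact h3
  have hAK : ∀ t ∈ K, A t = t := fun t h => le_antisymm (At t) (Am t t h le_rfl)
  have hBK : ∀ t ∈ K, B t = t := fun t h => le_antisymm (Bm t t h le_rfl) (Bt t)
  let f : ℝ → Y := fun t => γ (φ (A t)) (φ (B t)) ((t - A t) / (B t - A t))
  have hf : ∀ t ∈ K, f t = φ t := by
    intro t ht
    simp only [f, hAK t ht, hBK t ht, γs]
  have hfg : ∀ a ∈ K, ∀ b ∈ K, a < b → (∀ k ∈ K, k ≤ a ∨ b ≤ k) → ∀ s, a ≤ s → s ≤ b → 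
      f s = γ (φ a) (φ b) ((s - a) / (b - a)) := by
    intro a ha b hb hab h s h1 h2
    rcases h1.eq_or_lt with rfl | h1
    · simp [hf _ ha, γ0]
    rcases h2.eq_or_lt with rfl | h2
    · rw [hf _ hb, div_self (by linarith), γ1]
    simp only [f, gapA a ha b h s h1.le h2, gapB a b hb h s h1 h2.le]
  have cont : ∀ a b, Continuous fun s => γ (φ a) (φ b) ((s - a) / (b - a)) := fun a b => 
    (γc _ _).comp (by fun_prop)
  -- oscillation on small intervals with endpoints in `K`
  have near : ∀ t ∈ K, ∀ ε > 0, ∃ η > 0, ∀ s, |A s - t| < η → |B s - t| < η → dist (f s) (f t) < ε := by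
    intro t ht ε hε
    obtain ⟨δ, hδ, hγ⟩ := γu (ε/2) (by positivity)
    obtain ⟨η, hη, hc⟩ := Metric.continuousOn_iff.1 hφ t ht (min (ε/2) (δ/2)) (by positivity)
    refine ⟨η, hη, fun s h1 h2 => ?_⟩
    have e1 := hc _ (AK s) h1
    have e2 := hc _ (BK s) h2
    rw [lt_min_iff] at e1 e2
    have e3 := hγ (φ (A s)) (φ (B s)) (by linarith [dist_triangle_right (φ (A s)) (φ (B s)) (φ t)]) 
      ((s - A s) / (B s - A s))
    rw [hf t ht]
    have := dist_triangle_left (f s) (φ t) (φ (A s))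
    simp only [f] at this ⊢
    linarith
  refine ⟨f, continuous_iff_continuousAt.2 fun t => ?_, hf⟩
  by_cases ht : t ∈ K
  · rw [continuousAt_iff_continuous_left_right]
    constructor
    · by_cases hgap : ∃ a ∈ K, a < t ∧ ∀ k ∈ K, k ≤ a ∨ t ≤ k
      · obtain ⟨a, ha, hat, h⟩ := hgap
        refine ((cont a t).continuousWithinAt).congr_of_eventuallyEq ?_ (hfg a ha t ht hat h t hat.le le_rfl)
        filter_upwards [self_mem_nhdsWithin, mem_nhdsWithin_of_mem_nhds (Ioi_mem_nhds hat)] with s h1 h2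
        exact hfg a ha t ht hat h s (le_of_lt h2) h1
      · rw [Metric.continuousWithinAt_iff]
        intro ε hε
        obtain ⟨η, hη, hn⟩ := near t ht ε hε
        have : ∃ k ∈ K, t - η < k ∧ k < t := by
          by_contra! hcon
          refine hgap ⟨A (t - η/2), AK _, by linarith [At (t - η/2)], fun k hk => ?_⟩
          by_contra! h'
          rcases le_or_gt k (t - η/2) with h | h
          · linarith [Am _ k hk h]
          · linarith [hcon k hk (by linarith)]
        obtain ⟨k, hk, hk1, hk2⟩ := this
        refine ⟨t - k, by linarith, fun s hs hd => ?_⟩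
        rw [Real.dist_eq, abs_lt] at hd
        have hs : s ≤ t := hs
        have a1 := Am s k hk (by linarith)
        have a2 := At s
        have b1 := Bm s t ht hs
        have b2 := Bt s
        exact hn s (abs_lt.2 ⟨by linarith, by linarith⟩) (abs_lt.2 ⟨by linarith, by linarith⟩)
    · by_cases hgap : ∃ b ∈ K, t < b ∧ ∀ k ∈ K, k ≤ t ∨ b ≤ k
      · obtain ⟨b, hb, hbt, h⟩ := hgap
        refine ((cont t b).continuousWithinAt).congr_of_eventuallyEq ?_ (hfg t ht b hb hbt h t le_rfl hbt.le)
        filter_upwards [self_mem_nhdsWithin, mem_nhdsWithin_of_mem_nhds (Iio_mem_nhds hbt)] with s h1 h2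
        exact hfg t ht b hb hbt h s h1 (le_of_lt h2)
      · rw [Metric.continuousWithinAt_iff]
        intro ε hε
        obtain ⟨η, hη, hn⟩ := near t ht ε hε
        have : ∃ k ∈ K, t < k ∧ k < t + η := by
          by_contra! hcon
          refine hgap ⟨B (t + η/2), BK _, by linarith [Bt (t + η/2)], fun k hk => ?_⟩
          by_contra! h'
          rcases le_or_gt (t + η/2) k with h | h
          · linarith [Bm _ k hk h]
          · linarith [hcon k hk (by linarith)]
        obtain ⟨k, hk, hk1, hk2⟩ := this
        refine ⟨k - t, by linarith, fun s hs hd => ?_⟩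
        rw [Real.dist_eq, abs_lt] at hd
        have hs : t ≤ s := hs
        have a1 := Am s t ht hs
        have a2 := At s
        have b1 := Bm s k hk (by linarith)
        have b2 := Bt s
        exact hn s (abs_lt.2 ⟨by linarith, by linarith⟩) (abs_lt.2 ⟨by linarith, by linarith⟩)
  · have h1 : A t < t := lt_of_le_of_ne (At t) fun h => ht (h ▸ AK t)
    have h2 : t < B t := lt_of_le_of_ne (Bt t) fun h => ht (h ▸ BK t)
    have h : ∀ k ∈ K, k ≤ A t ∨ B t ≤ k := fun k hk => (le_total k t).imp (Am t k hk) (Bm t k hk)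
    refine ((cont (A t) (B t)).continuousAt).congr ?_
    filter_upwards [Ioo_mem_nhds h1 h2] with s hs
    exact (hfg _ (AK t) _ (BK t) (h1.trans h2) h s hs.1.le hs.2.le).symm

/-- For every nondegenerate continuum `X`, Peano continuum `Y`, distinct points
`x₁, …, xₙ` of `X` and arbitrary points `y₁, …, yₙ` of `Y`, there is a continuous
surjection `f : X → Y` with `f xᵢ = yᵢ` for every `i`. -/
theorem exists_surjection_with_prescribed_values {X Y : Type*}
    [MetricSpace X] [CompactSpace X] [ConnectedSpace X] [Nontrivial X]
    [MetricSpace Y] [CompactSpace Y] [ConnectedSpace Y] [LocallyConnectedSpace Y]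
    (n : ℕ) (x : Fin n → X) (hx : Function.Injective x) (y : Fin n → Y) :
    ∃ f : X → Y, Continuous f ∧ Function.Surjective f ∧ ∀ i, f (x i) = y i := by
  obtain ⟨y0⟩ : Nonempty Y := inferInstance
  obtain ⟨c, hc, hcs⟩ := exists_nat_bool_continuous_surjective_of_compact Y
  -- two further points
  have inf : Infinite X := 
    infinite_univ_iff.mp <| isPreconnected_univ.infinite_of_nontrivial nontrivial_univ
  obtain ⟨p, hp⟩ := (Set.finite_range x).exists_notMem
  obtain ⟨q, hq⟩ := ((Set.finite_range x).insert p).exists_notMem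
  let z : Option (Option (Fin n)) → X := fun o => o.elim p (fun o => o.elim q x)
  have hz : Function.Injective z := by
    simp only [mem_insert_iff, mem_range, not_or, not_exists] at hp hq
    rintro (_ | _ | i) (_ | _ | j) h
    · rfl
    · exact absurd h.symm hq.1
    · exact absurd h.symm (hp j)
    · exact absurd h hq.1
    · rfl
    · exact absurd h.symm (hq.2 j)
    · exact absurd h (hp i)
    · exact absurd h (hq.2 i)
    · rw [hx h]
  let _ : TopologicalSpace (Option (Option (Fin n))) := ⊥
  have : DiscreteTopology (Option (Option (Fin n))) := ⟨rfl⟩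
  have hze : IsClosedEmbedding z := continuous_of_discreteTopology.isClosedEmbedding hz
  obtain ⟨g, hg⟩ := ContinuousMap.exists_extension' (Y := ℝ) hze
    ⟨fun o => o.elim 0 (fun o => o.elim 1 fun i => (i:ℝ) + 2), continuous_of_discreteTopology⟩
  have gp : g p = 0 := congrFun hg none
  have gq : g q = 1 := congrFun hg (some none)
  have gx : ∀ i, g (x i) = (i:ℝ) + 2 := fun i => congrFun hg (some (some i))
  classical
  let F : Set ℝ := (Int.cast : ℤ → ℝ) '' {m | m < 0 ∨ 1 < m}
  have hF : IsClosed F := (Int.isClosedEmbedding_coe_real.isClosedMap) _ (isClosed_discrete _)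
  have hFm : ∀ t ∈ F, t ∉ cantorSet := by
    rintro _ ⟨m, hm, rfl⟩ h
    have := cantorSet_subset_unitInterval h
    have h0 : 0 ≤ m := by exact_mod_cast this.1
    have h1 : m ≤ 1 := by exact_mod_cast this.2
    rcases hm with hm | hm <;> omega
  let ψ : ℤ → Y := fun m => if h : 2 ≤ m ∧ (m - 2).toNat < n then y ⟨(m-2).toNat, h.2⟩ else y0
  let φ : ℝ → Y := fun t => if h : t ∈ cantorSet then c (cantorSetHomeomorphNatToBool ⟨t, h⟩) else ψ ⌊t⌋
  have hφ : ContinuousOn φ (cantorSet ∪ F) := by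
    refine ContinuousOn.union_of_isClosed ?_ ?_ isClosed_cantorSet hF
    · rw [continuousOn_iff_continuous_domRestrict]
      have : cantorSet.domRestrict φ = fun t => c (cantorSetHomeomorphNatToBool t) := by
        ext t
        simp [φ]
      rw [this]
      fun_prop
    · rw [Metric.continuousOn_iff]
      intro b hb ε hε
      refine ⟨1, one_pos, fun a ha hab => ?_⟩
      have : a = b := by
        obtain ⟨m, _, rfl⟩ := ha
        obtain ⟨k, _, rfl⟩ := hb
        rw [Int.dist_cast_real, Int.dist_eq'] at hab
        have : |m - k| < 1 := by exact_mod_cast hab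
        rw [Int.abs_lt_one_iff] at this
        rw [sub_eq_zero.1 this]
      rw [this, dist_self]; exact hε
  have hlow : ∀ t : ℝ, ∃ k ∈ cantorSet ∪ F, k ≤ t := by
    intro t
    refine ⟨((min ⌊t⌋ (-1) : ℤ) : ℝ), Or.inr ⟨_, Or.inl (by omega), rfl⟩, ?_⟩
    exact (Int.cast_le.2 (min_le_left _ _)).trans (Int.floor_le t)
  have hupp : ∀ t : ℝ, ∃ k ∈ cantorSet ∪ F, t ≤ k := by
    intro t
    refine ⟨((max ⌈t⌉ 2 : ℤ) : ℝ), Or.inr ⟨_, Or.inr (by omega), rfl⟩, ?_⟩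
    exact (Int.le_ceil t).trans (Int.cast_le.2 (le_max_left _ _))
  obtain ⟨f, hfc, hf⟩ := pc_extend (cantorSet ∪ F) (isClosed_cantorSet.union hF) hlow hupp φ hφ
  · refine ⟨f ∘ g, hfc.comp g.continuous, ?_, ?_⟩
    · intro w
      obtain ⟨b, rfl⟩ := hcs w
      let t := cantorSetHomeomorphNatToBool.symm b
      have ht := cantorSet_subset_unitInterval t.2
      obtain ⟨u, hu⟩ : (t : ℝ) ∈ range g := by
        refine mem_range_of_exists_le_of_exists_ge g.continuous ⟨p, ?_⟩ ⟨q, ?_⟩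
        · rw [gp]; exact ht.1
        · rw [gq]; exact ht.2
      refine ⟨u, ?_⟩
      rw [Function.comp_apply, hu, hf _ (Or.inl t.2)]
      simp [φ, t]
    · intro i
      have hi : ((i:ℝ) + 2) ∈ F := ⟨(i:ℤ) + 2, Or.inr (by omega), by push_cast; rfl⟩
      rw [Function.comp_apply, gx, hf _ (Or.inr hi)]
      have e : ⌊((i:ℕ):ℝ) + 2⌋ = (i:ℤ) + 2 := by
        rw [Int.floor_eq_iff]; push_cast; constructor <;> linarith
      simp only [φ, dif_neg (hFm _ hi), e, ψ]
      rw [dif_pos ⟨by omega, by have := i.2; omega⟩]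
      congr 1
      ext
      simp
end
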